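/- Let n > 2. A compact metric space X of covering dimension at most n quasi-embeds in ℝ^{2n} (i.e., for every ε > 0 there is an ε-map X → ℝ^{2n}) if and only if for every compact subset K ⊆ X̃ = {(x,y) ∈ X×X : x ≠ y} invariant under the swap (x,y) ↦ (y,x), there exists a continuous map f : K → S^{2n-1} with f(y,x) = −f(x,y) for all (x,y) ∈ K. -/

import Mathlib

open Topology Metric

/-- Covering dimension at most `n`: every open cover admits an open refinement in which
each point lies in at most `n+1` members. -/
def CoveringDimLE (X : Type*) [TopologicalSpace X] (n : ℕ) : Prop :=
  ∀ U : Set (Set X), (∀ u ∈ U, IsOpen u) → ⋃₀ U = Set.univ →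
    ∃ V : Set (Set X), (∀ v ∈ V, IsOpen v) ∧ ⋃₀ V = Set.univ ∧
      (∀ v ∈ V, ∃ u ∈ U, v ⊆ u) ∧
      ∀ x : X, {v ∈ V | x ∈ v}.Finite ∧ {v ∈ V | x ∈ v}.ncard ≤ n + 1

namespace QE

set_option linter.unusedSectionVars false

/-- `φ` and `ψ` are homotopic as maps from the set `C` to the set `Y`. -/
def Hot {W E : Type*} [TopologicalSpace W] [TopologicalSpace E] (C : Set W) (Y : Set E)
    (φ ψ : W → E) : Prop :=
  ∃ K : W × ℝ → E, ContinuousOn K (C ×ˢ Set.Icc 0 1) ∧ Set.MapsTo K (C ×ˢ Set.Icc 0 1) Y ∧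
    (∀ w ∈ C, K (w, 0) = φ w) ∧ ∀ w ∈ C, K (w, 1) = ψ w

section Hot
variable {W E : Type*} [TopologicalSpace W] [NormedAddCommGroup E] {C : Set W} {Y : Set E}
  {φ ψ χ : W → E}

theorem Hot.symm (h : Hot C Y φ ψ) : Hot C Y ψ φ := by
  obtain ⟨K, hc, hm, h0, h1⟩ := h
  have hmap : Set.MapsTo (fun p : W × ℝ => (p.1, 1 - p.2)) (C ×ˢ Set.Icc 0 1)
      (C ×ˢ Set.Icc 0 1) := by
    rintro ⟨w, t⟩ ⟨hw, ht⟩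
    exact ⟨hw, by simpa using ht.2, by simpa using ht.1⟩
  refine ⟨fun p => K (p.1, 1 - p.2), hc.comp (by fun_prop) hmap, hm.comp hmap, ?_, ?_⟩
  · intro w hw; simpa using h1 w hw
  · intro w hw; simpa using h0 w hw

theorem Hot.trans (h : Hot C Y φ ψ) (h' : Hot C Y ψ χ) : Hot C Y φ χ := by
  obtain ⟨K, hc, hm, h0, h1⟩ := h
  obtain ⟨K', hc', hm', h0', h1'⟩ := h'
  have m1 : Set.MapsTo (fun p : W × ℝ => (p.1, min (2 * p.2) 1)) (C ×ˢ Set.Icc 0 1)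
      (C ×ˢ Set.Icc 0 1) := by
    rintro ⟨w, t⟩ ⟨hw, ht⟩
    exact ⟨hw, le_min (by have := ht.1; simp at this; simpa using this) zero_le_one, min_le_right _ _⟩
  have m2 : Set.MapsTo (fun p : W × ℝ => (p.1, max (2 * p.2 - 1) 0)) (C ×ˢ Set.Icc 0 1)
      (C ×ˢ Set.Icc 0 1) := by
    rintro ⟨w, t⟩ ⟨hw, ht⟩
    refine ⟨hw, le_max_right _ _, max_le ?_ zero_le_one⟩
    have := ht.2; simp at this; simp; linarith
  have m3 : Set.MapsTo (fun p : W × ℝ => (p.1, (0 : ℝ))) (C ×ˢ Set.Icc 0 1)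
      (C ×ˢ Set.Icc 0 1) := by
    rintro ⟨w, t⟩ ⟨hw, ht⟩
    exact ⟨hw, by simp⟩
  refine ⟨fun p => K (p.1, min (2 * p.2) 1) + K' (p.1, max (2 * p.2 - 1) 0) - K' (p.1, 0),
    ((hc.comp (by fun_prop) m1).add (hc'.comp (by fun_prop) m2)).sub
      (hc'.comp (by fun_prop) m3), ?_, ?_, ?_⟩
  · rintro ⟨w, t⟩ ⟨hw, ht⟩
    have hw : w ∈ C := hw
    simp only [Set.mem_Icc] at ht
    rcases le_total (2 * t) 1 with hl | hl
    · simp only [max_eq_right (show 2 * t - 1 ≤ 0 by linarith), add_sub_cancel_right]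
      exact hm (m1 (x := (w, t)) ⟨hw, ht⟩)
    · simp only [min_eq_right hl, h1 w hw, h0' w hw, add_sub_cancel_left]
      exact hm' (m2 (x := (w, t)) ⟨hw, ht⟩)
  · intro w hw
    simp [h0 w hw]
  · intro w hw
    norm_num [h1 w hw, h0' w hw, h1' w hw]

theorem Hot.comp {W' : Type*} [TopologicalSpace W'] {C' : Set W'} (h : Hot C Y φ ψ) {θ : W' → W}
    (hθ : ContinuousOn θ C') (hm : Set.MapsTo θ C' C) : Hot C' Y (φ ∘ θ) (ψ ∘ θ) := by
  obtain ⟨K, hc, hK, h0, h1⟩ := h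
  have m1 : Set.MapsTo (fun p : W' × ℝ => (θ p.1, p.2)) (C' ×ˢ Set.Icc 0 1)
      (C ×ˢ Set.Icc 0 1) := fun p hp => ⟨hm hp.1, hp.2⟩
  refine ⟨fun p => K (θ p.1, p.2), hc.comp ?_ m1, hK.comp m1, fun w hw => h0 _ (hm hw),
    fun w hw => h1 _ (hm hw)⟩
  exact (hθ.comp continuousOn_fst (fun p hp => hp.1)).prodMk continuousOn_snd

theorem Hot.congr {φ' ψ' : W → E} (h : Hot C Y φ ψ) (h1 : Set.EqOn φ φ' C) (h2 : Set.EqOn ψ ψ' C) :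
    Hot C Y φ' ψ' := by
  obtain ⟨K, hc, hK, h0, h1'⟩ := h
  exact ⟨K, hc, hK, fun w hw => (h0 w hw).trans (h1 hw), fun w hw => (h1' w hw).trans (h2 hw)⟩

end Hot

/-- Borsuk homotopy extension for maps of a compact set into an open subset of a
finite-dimensional space. -/
theorem Hot.extend {X E : Type*} [MetricSpace X] [NormedAddCommGroup E] [NormedSpace ℝ E]
    [FiniteDimensional ℝ E] {S A : Set X} (hS : IsCompact S) (hA : IsClosed A)
    {Y : Set E} (hY : IsOpen Y) {φ ψ g : X → E} (h : Hot A Y φ ψ) (hg : ContinuousOn g S)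
    (hgY : Set.MapsTo g S Y) (hgφ : Set.EqOn g φ A) :
    ∃ g' : X → E, ContinuousOn g' S ∧ Set.MapsTo g' S Y ∧ Set.EqOn g' ψ A := by
  obtain ⟨K, hc, hK, h0, h1⟩ := h
  have hcl : IsClosed (A ×ˢ Set.Icc (0 : ℝ) 1) := hA.prod isClosed_Icc
  obtain ⟨k, hk⟩ := ContinuousMap.exists_restrict_eq hcl ⟨_, hc.domRestrict⟩
  have hk' : ∀ p ∈ A ×ˢ Set.Icc (0 : ℝ) 1, k p = K p := fun p hp =>
    congrArg (fun q => q ⟨p, hp⟩) hk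
  let H : X × ℝ → E := fun p => k p + g p.1 - k (p.1, 0)
  have hH : ContinuousOn H (S ×ˢ Set.univ) := by
    refine ((k.continuous.continuousOn).add (hg.comp continuousOn_fst fun p hp => hp.1)).sub ?_
    exact (k.continuous.comp (by fun_prop : Continuous fun p : X × ℝ => (p.1, (0:ℝ)))).continuousOn
  have hHA : ∀ p ∈ A ×ˢ Set.Icc (0 : ℝ) 1, H p = K p := by
    rintro ⟨x, t⟩ ⟨hx, ht⟩
    have hx : x ∈ A := hx
    simp only [H]
    rw [hk' (x, t) ⟨hx, ht⟩, hk' (x, 0) ⟨hx, by simp⟩, h0 x hx, hgφ hx]; simp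
  set N : Set X := Prod.fst '' ((S ×ˢ Set.Icc (0:ℝ) 1) ∩ H ⁻¹' Yᶜ) with hN
  have hNc : IsCompact N := by
    refine IsCompact.image ?_ continuous_fst
    have : IsCompact (S ×ˢ Set.Icc (0 : ℝ) 1) := hS.prod isCompact_Icc
    exact this.of_isClosed_subset
      ((hH.mono (Set.prod_mono_right (Set.subset_univ _))).preimage_isClosed_of_isClosed
        this.isClosed hY.isClosed_compl) Set.inter_subset_left
  have hdisj : Disjoint N A := by
    rw [Set.disjoint_left]
    rintro _ ⟨⟨x, t⟩, ⟨⟨hx, ht⟩, hy⟩, rfl⟩ hxA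
    apply hy
    rw [hHA (x, t) ⟨hxA, ht⟩]
    exact hK ⟨hxA, ht⟩
  obtain ⟨φ', hφ0, hφ1, hφI⟩ := exists_continuous_zero_one_of_isClosed hNc.isClosed hA hdisj
  refine ⟨fun x => H (x, φ' x), hH.comp (by fun_prop) (fun x hx => ⟨hx, trivial⟩), ?_, ?_⟩
  · intro x hx
    by_contra hy
    have hxN : x ∈ N := ⟨(x, φ' x), ⟨⟨hx, hφI x⟩, hy⟩, rfl⟩
    apply hy
    have : φ' x = 0 := hφ0 hxN
    simp only [this, H]
    simpa using hgY hx
  · intro x hx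
    have : φ' x = 1 := hφ1 hx
    simp only [this]
    rw [hHA (x, 1) ⟨hx, by simp⟩, h1 x hx]

/-- Every loop in `Y` is null-homotopic in `Y`. -/
def LoopsNull {E : Type*} [TopologicalSpace E] (Y : Set E) : Prop :=
  ∀ γ : ℝ → E, ContinuousOn γ (Set.Icc 0 1) → Set.MapsTo γ (Set.Icc 0 1) Y → γ 0 = γ 1 →
    ∃ Γ : ℝ × ℝ → E, ContinuousOn Γ (Set.Icc 0 1 ×ˢ Set.Icc 0 1) ∧
      Set.MapsTo Γ (Set.Icc 0 1 ×ˢ Set.Icc 0 1) Y ∧ (∀ t ∈ Set.Icc (0:ℝ) 1, Γ (t, 0) = γ t) ∧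
      ∀ t ∈ Set.Icc (0:ℝ) 1, Γ (t, 1) = γ 0 ∧ Γ (0, t) = γ 0 ∧ Γ (1, t) = γ 0

section
variable {F E : Type*} [NormedAddCommGroup F] [NormedSpace ℝ F] [FiniteDimensional ℝ F]
  [NormedAddCommGroup E] [NormedSpace ℝ E] [FiniteDimensional ℝ E]

/-- The reflection in the first coordinate. -/
def flip0 (w : ℝ × F) : ℝ × F := (-w.1, w.2)

/-- A homotopy between `G` and its reflection on the boundary of the right half box can be made
stationary on the separating disc. -/
theorem homotopy_stationary {Y : Set E} (hY : IsOpen Y) (hSC : LoopsNull Y) {G : ℝ × F → E}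
    (hG : ContinuousOn G (sphere ((1, 0) : ℝ × F) 1))
    (hGY : Set.MapsTo G (sphere ((1, 0) : ℝ × F) 1) Y)
    (hK : Hot (sphere ((1, 0) : ℝ × F) 1) Y G (G ∘ flip0)) :
    ∃ K : (ℝ × F) × ℝ → E, ContinuousOn K (sphere ((1, 0) : ℝ × F) 1 ×ˢ Set.Icc 0 1) ∧
      Set.MapsTo K (sphere ((1, 0) : ℝ × F) 1 ×ˢ Set.Icc 0 1) Y ∧
      (∀ w ∈ sphere ((1, 0) : ℝ × F) 1, K (w, 0) = G w) ∧
      (∀ w ∈ sphere ((1, 0) : ℝ × F) 1, K (w, 1) = G (flip0 w)) ∧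
      ∀ u : F, ‖u‖ ≤ 1 → ∀ t ∈ Set.Icc (0:ℝ) 1, K ((0, u), t) = G (0, u) := by
  obtain ⟨K, hc, hm, h0, h1⟩ := hK
  set C := sphere ((1, 0) : ℝ × F) 1 with hC
  set I := Set.Icc (0 : ℝ) 1 with hI
  have I0 : (0 : ℝ) ∈ I := by simp [hI]
  have I1 : (1 : ℝ) ∈ I := by simp [hI]
  have hEC : ∀ u : F, ‖u‖ ≤ 1 → ((0, u) : ℝ × F) ∈ C := by
    intro u hu
    simp [hC, Prod.norm_def, hu]
  have hCc : IsCompact C := isCompact_sphere _ _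
  have hScpt : IsCompact (C ×ˢ I) := hCc.prod isCompact_Icc
  have hends : IsClosed (C ×ˢ ({0, 1} : Set ℝ)) :=
    hCc.isClosed.prod (Set.Finite.isClosed (by simp))
  have hendsI : ∀ t ∈ ({0, 1} : Set ℝ), t ∈ I := by
    rintro t (rfl | rfl) <;> assumption
  -- contract the loop over the centre of the disc
  have hc0 : ((0, 0) : ℝ × F) ∈ C := hEC 0 (by simp)
  obtain ⟨Γ, hΓc, hΓY, hΓ0, hΓ1⟩ := hSC (fun t => K ((0, 0), t))
    (hc.comp (by fun_prop) (fun t ht => ⟨hc0, ht⟩)) (fun t ht => hm ⟨hc0, ht⟩)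
    (by simp only [h0 _ hc0, h1 _ hc0]; simp [flip0])
  have hΓ0' : ∀ s ∈ I, Γ (0, s) = Γ (0, 0) := fun s hs => by
    rw [(hΓ1 s hs).2.1, (hΓ1 0 I0).2.1]
  have hΓ1' : ∀ s ∈ I, Γ (1, s) = Γ (1, 0) := fun s hs => by
    rw [(hΓ1 s hs).2.2, (hΓ1 0 I0).2.2]
  let A1 : Set ((ℝ × F) × ℝ) := ({((0, 0) : ℝ × F)} ×ˢ I) ∪ (C ×ˢ {0, 1})
  have hA1 : IsClosed A1 := (isClosed_singleton.prod isClosed_Icc).union hends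
  have hA1S : A1 ⊆ C ×ˢ I := by
    rintro ⟨w, t⟩ (⟨hw, ht⟩ | ⟨hw, ht⟩)
    · exact ⟨by rw [Set.mem_singleton_iff.1 hw]; exact hc0, ht⟩
    · exact ⟨hw, hendsI _ ht⟩
  obtain ⟨K1, hK1c, hK1Y, hK1⟩ := Hot.extend (S := C ×ˢ I) hScpt hA1 hY (g := K) (φ := K)
    (ψ := fun p => K p + Γ (p.2, 1) - Γ (p.2, 0)) (by
      refine ⟨fun q => K q.1 + Γ (q.1.2, q.2) - Γ (q.1.2, 0), ?_, ?_, ?_, ?_⟩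
      · refine ((hc.comp continuousOn_fst fun q hq => hA1S hq.1).add
          (hΓc.comp (by fun_prop) fun q hq => ⟨(hA1S hq.1).2, hq.2⟩)).sub
          (hΓc.comp (by fun_prop) fun q hq => ⟨(hA1S hq.1).2, I0⟩)
      · rintro ⟨⟨w, t⟩, s⟩ ⟨hwt, hs⟩
        have hwt : (w, t) ∈ A1 := hwt
        have hs : s ∈ I := hs
        rcases hwt with ⟨hw, ht⟩ | ⟨hw, ht⟩
        · have hw : w = (0, 0) := hw
          have ht : t ∈ I := ht
          simp only [hw, hΓ0 t ht, add_sub_cancel_left]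
          exact hΓY ⟨ht, hs⟩
        · have hKY : K (w, t) ∈ Y := hm ⟨hw, hendsI _ ht⟩
          have ht : t = 0 ∨ t = 1 := ht
          rcases ht with rfl | rfl
          · simpa [hΓ0' s hs] using hKY
          · simpa [hΓ1' s hs] using hKY
      · intro w hw; simp
      · intro w hw; rfl) hc hm (fun _ _ => rfl)
  have hK1e : ∀ t ∈ I, K1 ((0, 0), t) = G (0, 0) := by
    intro t ht
    rw [hK1 (show (((0, 0) : ℝ × F), t) ∈ A1 from Or.inl ⟨rfl, ht⟩)]
    simp only [hΓ0 t ht, add_sub_cancel_left, (hΓ1 t ht).1, h0 _ hc0]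
  have hK10 : ∀ w ∈ C, K1 (w, 0) = G w := by
    intro w hw
    rw [hK1 (Or.inr ⟨hw, by simp⟩)]
    simp [hΓ0' 1 I1, h0 w hw]
  have hK11 : ∀ w ∈ C, K1 (w, 1) = G (flip0 w) := by
    intro w hw
    rw [hK1 (Or.inr ⟨hw, by simp⟩)]
    simp [hΓ1' 1 I1, h1 w hw]
  clear hK1 hΓ0' hΓ1' hΓ0 hΓ1 hΓc hΓY
  -- contract the disc to its centre
  let A2 : Set ((ℝ × F) × ℝ) := ((({0} : Set ℝ) ×ˢ closedBall (0 : F) 1) ×ˢ I) ∪ (C ×ˢ {0, 1})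
  have hA2 : IsClosed A2 :=
    ((isClosed_singleton.prod isClosed_closedBall).prod isClosed_Icc).union hends
  let a : ℝ → ℝ := fun t => min 1 (min (3 * t) (3 * (1 - t)))
  have ha : Continuous a := by fun_prop
  have ha1 : ∀ t, a t ≤ 1 := fun t => min_le_left _ _
  have ha0 : ∀ t ∈ I, 0 ≤ a t := by
    intro t ht
    simp only [hI, Set.mem_Icc] at ht
    exact le_min zero_le_one (le_min (by linarith) (by linarith))
  let b : ℝ → ℝ → ℝ := fun s t => min s (a t)
  let θ : ℝ → ℝ → ℝ := fun s t => max 0 (min 1 ((1 + 2 * s) * t - s))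
  have hθI : ∀ s t, θ s t ∈ I := fun s t =>
    ⟨le_max_left _ _, max_le zero_le_one (min_le_left _ _)⟩
  have hθ0 : ∀ s, 0 ≤ s → θ s 0 = 0 := by
    intro s hs
    simp only [θ, mul_zero, zero_sub]
    rw [min_eq_right (by linarith), max_eq_left (by linarith)]
  have hθ1 : ∀ s, 0 ≤ s → θ s 1 = 1 := by
    intro s hs
    simp only [θ]
    rw [min_eq_left (by linarith), max_eq_right (by linarith)]
  have ha_0 : a 0 = 0 := by norm_num [a]
  have ha_1 : a 1 = 0 := by norm_num [a]
  have hscale : ∀ u : F, ‖u‖ ≤ 1 → ∀ c ∈ I, ((0, (1 - c) • u) : ℝ × F) ∈ C := by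
    intro u hu c hc'
    apply hEC
    rw [norm_smul, Real.norm_eq_abs, abs_of_nonneg (by linarith [hc'.2])]
    exact mul_le_one₀ (by linarith [hc'.1]) (norm_nonneg _) hu
  have hb : ∀ s ∈ I, ∀ t ∈ I, b s t ∈ I := fun s hs t ht =>
    ⟨le_min hs.1 (ha0 t ht), (min_le_right _ _).trans (ha1 t)⟩
  have hA2S : A2 ⊆ C ×ˢ I := by
    rintro ⟨⟨x, u⟩, t⟩ (⟨⟨hx, hu⟩, ht⟩ | ⟨hw, ht⟩)
    · obtain rfl : x = 0 := hx
      exact ⟨hEC u (by simpa using hu), ht⟩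
    · exact ⟨hw, hendsI _ ht⟩
  have hmapb : ∀ w t, (w, t) ∈ A2 → ∀ s ∈ I, ((w.1, (1 - b s t) • w.2) : ℝ × F) ∈ C := by
    rintro ⟨x, u⟩ t (⟨⟨hx, hu⟩, ht⟩ | ⟨hw, ht⟩) s hs
    · obtain rfl : x = 0 := hx
      exact hscale u (by simpa using hu) _ (hb s hs t ht)
    · have : b s t = 0 := by
        have ht : t = 0 ∨ t = 1 := ht
        have := hs.1
        rcases ht with rfl | rfl <;> simp [b, ha_0, ha_1, this]
      simpa [this] using hw
  obtain ⟨K2, hK2c, hK2Y, hK2⟩ := Hot.extend (S := C ×ˢ I) hScpt hA2 hY (g := K1) (φ := K1)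
    (ψ := fun p => K1 ((p.1.1, (1 - b 1 p.2) • p.1.2), θ 1 p.2)) (by
      have hmaps : Set.MapsTo (fun q : ((ℝ × F) × ℝ) × ℝ =>
          (((q.1.1.1, (1 - b q.2 q.1.2) • q.1.1.2) : ℝ × F), θ q.2 q.1.2)) (A2 ×ˢ I) (C ×ˢ I) := by
        rintro ⟨⟨w, t⟩, s⟩ ⟨hwt, hs⟩
        exact ⟨hmapb w t hwt s hs, hθI _ _⟩
      refine ⟨_, hK1c.comp (f := fun q : ((ℝ × F) × ℝ) × ℝ =>
          (((q.1.1.1, (1 - b q.2 q.1.2) • q.1.1.2) : ℝ × F), θ q.2 q.1.2)) ?_ hmaps,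
          hK1Y.comp hmaps, ?_, ?_⟩
      · apply Continuous.continuousOn
        simp only [b, θ]
        fun_prop
      · rintro ⟨w, t⟩ hwt
        have ht : t ∈ I := (hA2S hwt).2
        have e1 : b 0 t = 0 := min_eq_left (ha0 t ht)
        have e2 : θ 0 t = t := by
          simp only [θ, mul_zero, add_zero, one_mul, sub_zero]
          rw [min_eq_right ht.2, max_eq_right ht.1]
        simp [e1, e2]
      · rintro ⟨w, t⟩ hwt; rfl) hK1c hK1Y (fun _ _ => rfl)
  have hb1 : ∀ t, b 1 t = a t := fun t => min_eq_right (ha1 t)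
  have hK2e : ∀ u : F, ‖u‖ ≤ 1 → ∀ t ∈ I, K2 ((0, u), t) = G (0, (1 - a t) • u) := by
    intro u hu t ht
    rw [hK2 (show (((0, u) : ℝ × F), t) ∈ A2 from Or.inl ⟨⟨rfl, by simpa using hu⟩, ht⟩)]
    simp only [hb1]
    have hsc := hscale u hu (a t) ⟨ha0 t ht, ha1 t⟩
    rcases le_total t (1 / 3) with h | h
    · have : θ 1 t = 0 := by
        simp only [θ]
        rw [min_eq_right (by linarith), max_eq_left (by linarith)]
      rw [this, hK10 _ hsc]
    rcases le_total t (2 / 3) with h' | h'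
    · have : a t = 1 := by
        simp only [a]
        rw [min_eq_left]
        exact le_min (by linarith) (by linarith)
      simpa [this] using hK1e _ (hθI 1 t)
    · have : θ 1 t = 1 := by
        simp only [θ]
        rw [min_eq_left (by linarith), max_eq_right (by linarith)]
      rw [this, hK11 _ hsc]
      simp [flip0]
  have hK20 : ∀ w ∈ C, K2 (w, 0) = G w := by
    intro w hw
    rw [hK2 (Or.inr ⟨hw, by simp⟩)]
    simp [hb1, ha_0, hθ0 1 zero_le_one, hK10 w hw]
  have hK21 : ∀ w ∈ C, K2 (w, 1) = G (flip0 w) := by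
    intro w hw
    rw [hK2 (Or.inr ⟨hw, by simp⟩)]
    simp [hb1, ha_1, hθ1 1 zero_le_one, hK11 w hw]
  clear hK2
  -- expand the disc again
  have hmapc : ∀ w t, (w, t) ∈ A2 → ∀ s ∈ I, ((w.1, (1 - (1 - s) * a t) • w.2) : ℝ × F) ∈ C := by
    rintro ⟨x, u⟩ t (⟨⟨hx, hu⟩, ht⟩ | ⟨hw, ht⟩) s hs
    · obtain rfl : x = 0 := hx
      refine hscale u (by simpa using hu) _ ⟨mul_nonneg (by linarith [hs.2]) (ha0 t ht), ?_⟩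
      exact mul_le_one₀ (by linarith [hs.1]) (ha0 t ht) (ha1 t)
    · have : a t = 0 := by
        have ht : t = 0 ∨ t = 1 := ht
        rcases ht with rfl | rfl <;> simp [ha_0, ha_1]
      simpa [this] using hw
  obtain ⟨K3, hK3c, hK3Y, hK3⟩ := Hot.extend (S := C ×ˢ I) hScpt hA2 hY (g := K2) (φ := K2)
    (ψ := fun p => K2 p + G p.1 - G (p.1.1, (1 - a p.2) • p.1.2)) (by
      refine ⟨fun q => K2 q.1 + G (q.1.1.1, (1 - (1 - q.2) * a q.1.2) • q.1.1.2)
        - G (q.1.1.1, (1 - a q.1.2) • q.1.1.2), ?_, ?_, ?_, ?_⟩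
      · refine ((hK2c.comp continuousOn_fst fun q hq => hA2S hq.1).add
          (hG.comp (by fun_prop) ?_)).sub (hG.comp (by fun_prop) ?_)
        · rintro ⟨⟨w, t⟩, s⟩ ⟨hwt, hs⟩
          exact hmapc w t hwt s hs
        · rintro ⟨⟨w, t⟩, s⟩ ⟨hwt, hs⟩
          simpa using hmapc w t hwt 0 I0
      · rintro ⟨⟨w, t⟩, s⟩ ⟨hwt, hs⟩
        have hin := hmapc w t hwt s hs
        rcases hwt with ⟨⟨hx, hu⟩, ht⟩ | ⟨hw, ht⟩
        · obtain ⟨x, u⟩ := w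
          obtain rfl : x = 0 := hx
          have := hK2e u (by simpa using hu) t ht
          simp only [this, add_sub_cancel_left]
          exact hGY hin
        · have hKY : K2 (w, t) ∈ Y := hK2Y ⟨hw, hendsI _ ht⟩
          have ht : t = 0 ∨ t = 1 := ht
          rcases ht with rfl | rfl
          · simpa [ha_0] using hKY
          · simpa [ha_1] using hKY
      · rintro ⟨w, t⟩ hwt; simp
      · rintro ⟨w, t⟩ hwt; simp) hK2c hK2Y (fun _ _ => rfl)
  refine ⟨K3, hK3c, hK3Y, ?_, ?_, ?_⟩
  · intro w hw
    rw [hK3 (Or.inr ⟨hw, by simp⟩)]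
    simp [ha_0, hK20 w hw]
  · intro w hw
    rw [hK3 (Or.inr ⟨hw, by simp⟩)]
    simp [ha_1, hK21 w hw]
  · intro u hu t ht
    rw [hK3 (show (((0, u) : ℝ × F), t) ∈ A2 from Or.inl ⟨⟨rfl, by simpa using hu⟩, ht⟩)]
    simp [hK2e u hu t ht]

/-- A map on the boundary of the box `[-2,2] × B` whose restrictions to the two half boxes
are reflections of each other up to homotopy extends over the box inside `Y`. -/
theorem extend_box {Y : Set E} (hY : IsOpen Y) (hSC : LoopsNull Y) {G : ℝ × F → E}
    {B : Set (ℝ × F)} (hB : B = {w | |w.1| ≤ 2 ∧ ‖w.2‖ ≤ 1})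
    {A : Set (ℝ × F)} (hA : A = {w | |w.1| ≤ 2 ∧ ‖w.2‖ ≤ 1 ∧ (|w.1| = 2 ∨ ‖w.2‖ = 1)})
    (hG : ContinuousOn G (sphere ((1, 0) : ℝ × F) 1))
    (hGY : Set.MapsTo G (sphere ((1, 0) : ℝ × F) 1) Y)
    (hK : Hot (sphere ((1, 0) : ℝ × F) 1) Y G (G ∘ flip0)) :
    ∃ G' : ℝ × F → E, ContinuousOn G' B ∧ Set.MapsTo G' B Y ∧ Set.EqOn G' G A := by
  obtain ⟨K, hKc, hKY, hK0, hK1, hKe⟩ := homotopy_stationary hY hSC hG hGY hK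
  set C := sphere ((1, 0) : ℝ × F) 1 with hC
  have hCmem : ∀ x : ℝ, ∀ u : F, 0 ≤ x → x ≤ 2 → ‖u‖ ≤ 1 → (x = 0 ∨ x = 2 ∨ ‖u‖ = 1) →
      ((x, u) : ℝ × F) ∈ C := by
    intro x u h0 h2 hu h
    have h1 : |x - 1| ≤ 1 := by rw [abs_le]; constructor <;> linarith
    simp only [hC, mem_sphere, Prod.dist_eq, Real.dist_eq, dist_zero_right]
    rcases h with rfl | rfl | h
    · simpa using hu
    · norm_num; exact hu
    · rw [h]; exact max_eq_right h1
  have hBc : IsCompact B := by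
    have : B = Set.Icc (-2) 2 ×ˢ closedBall (0 : F) 1 := by
      ext w; simp [hB, abs_le]
    rw [this]; exact isCompact_Icc.prod (isCompact_closedBall _ _)
  have hAc : IsClosed A := by
    rw [hA]
    apply IsClosed.and (isClosed_le (by fun_prop) (by fun_prop))
    apply IsClosed.and (isClosed_le (by fun_prop) (by fun_prop))
    exact (isClosed_eq (f := fun w : ℝ × F => |w.1|) (by fun_prop) continuous_const).union
      (isClosed_eq (f := fun w : ℝ × F => ‖w.2‖) (by fun_prop) continuous_const)
  -- the symmetrised map is null-homotopic
  have hot1 : Hot A Y (fun w : ℝ × F => G (2, w.2)) (fun w => G (|w.1|, w.2)) := by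
    have hmaps : Set.MapsTo (fun q : (ℝ × F) × ℝ =>
        ((max |q.1.1| (2 * (1 - q.2)), q.1.2) : ℝ × F)) (A ×ˢ Set.Icc 0 1) C := by
      rintro ⟨⟨x, u⟩, s⟩ ⟨hw, hs⟩
      rw [hA] at hw
      obtain ⟨h1, h2, h3⟩ := hw
      simp only at h1 h2 h3
      simp only [Set.mem_Icc] at hs
      refine hCmem _ _ ((abs_nonneg x).trans (le_max_left _ _)) (max_le h1 (by linarith)) h2 ?_
      rcases h3 with h3 | h3
      · right; left
        show max |x| (2 * (1 - s)) = 2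
        rw [h3]; exact max_eq_left (by linarith)
      · exact Or.inr (Or.inr h3)
    refine ⟨_, hG.comp (by fun_prop) hmaps, hGY.comp hmaps, ?_, ?_⟩
    · rintro ⟨x, u⟩ hw
      rw [hA] at hw
      have h1 : |x| ≤ 2 := hw.1
      simp [h1]
    · rintro ⟨x, u⟩ hw
      simp
  obtain ⟨g1, hg1c, hg1Y, hg1⟩ := hot1.extend hBc hAc hY (g := fun w : ℝ × F => G (2, w.2))
    (hG.comp (by fun_prop) (fun w hw => hCmem _ _ (by norm_num) le_rfl (by rw [hB] at hw; exact hw.2)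
      (by simp)))
    (fun w hw => hGY (hCmem _ _ (by norm_num) le_rfl (by rw [hB] at hw; exact hw.2)
      (by simp))) (fun _ _ => rfl)
  have hot2 : Hot A Y (fun w => G (|w.1|, w.2)) G := by
    have m1 : Set.MapsTo (fun q : (ℝ × F) × ℝ => ((max q.1.1 0, q.1.2) : ℝ × F))
        (A ×ˢ Set.Icc 0 1) C := by
      rintro ⟨⟨x, u⟩, s⟩ ⟨hw, hs⟩
      rw [hA] at hw
      obtain ⟨h1, h2, h3⟩ := hw
      simp only at h1 h2 h3
      refine hCmem _ _ (le_max_right _ _) (max_le (le_of_abs_le h1) (by norm_num)) h2 ?_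
      rcases h3 with h3 | h3
      · rcases le_total 0 x with hx | hx
        · right; left; rw [abs_of_nonneg hx] at h3; simpa [hx] using h3
        · left; simpa using hx
      · exact Or.inr (Or.inr h3)
    have m2 : Set.MapsTo (fun q : (ℝ × F) × ℝ => (((max (-q.1.1) 0, q.1.2) : ℝ × F), q.2))
        (A ×ˢ Set.Icc 0 1) (C ×ˢ Set.Icc 0 1) := by
      rintro ⟨⟨x, u⟩, s⟩ ⟨hw, hs⟩
      have := m1 (x := ((-x, u), s)) ⟨by rw [hA] at hw ⊢; simpa using hw, hs⟩
      exact ⟨this, hs⟩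
    have m3 : Set.MapsTo (fun q : (ℝ × F) × ℝ => ((0, q.1.2) : ℝ × F)) (A ×ˢ Set.Icc 0 1) C := by
      rintro ⟨⟨x, u⟩, s⟩ ⟨hw, hs⟩
      rw [hA] at hw
      exact hCmem _ _ le_rfl (by norm_num) hw.2.1 (Or.inl rfl)
    refine ⟨fun q => G (max q.1.1 0, q.1.2) + K ((max (-q.1.1) 0, q.1.2), q.2) - G (0, q.1.2),
      ((hG.comp (by fun_prop) m1).add (hKc.comp (by fun_prop) m2)).sub (hG.comp (by fun_prop) m3),
      ?_, ?_, ?_⟩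
    · rintro ⟨⟨x, u⟩, s⟩ hq
      have hu : ‖u‖ ≤ 1 := by have := hq.1; rw [hA] at this; exact this.2.1
      have M1 := hGY (m1 hq)
      have M2 := hKY (m2 hq)
      have hs : s ∈ Set.Icc (0:ℝ) 1 := hq.2
      simp only at M1 M2 ⊢
      rcases le_total 0 x with hx | hx
      · have e : max (-x) 0 = 0 := by simpa using hx
        rw [e, hKe u hu s hs, add_sub_cancel_right]; exact M1
      · have e : max x 0 = 0 := by simpa using hx
        rw [e, add_sub_cancel_left]; exact M2
    · rintro ⟨x, u⟩ hw
      have hw' : ((x, u), (0:ℝ)) ∈ A ×ˢ Set.Icc (0:ℝ) 1 := ⟨hw, by simp⟩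
      have hu : ‖u‖ ≤ 1 := by rw [hA] at hw; exact hw.2.1
      have M2 := (m2 hw').1
      simp only at M2 ⊢
      rw [hK0 _ M2]
      rcases le_total 0 x with hx | hx
      · have e : max (-x) 0 = 0 := by simpa using hx
        simp [e, max_eq_left hx, abs_of_nonneg hx]
      · have e : max (-x) 0 = -x := by simpa using hx
        simp [e, max_eq_right hx, abs_of_nonpos hx]
    · rintro ⟨x, u⟩ hw
      have hw' : ((x, u), (0:ℝ)) ∈ A ×ˢ Set.Icc (0:ℝ) 1 := ⟨hw, by simp⟩
      have M2 := (m2 hw').1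
      simp only at M2 ⊢
      rw [hK1 _ M2]
      rcases le_total 0 x with hx | hx
      · have e : max (-x) 0 = 0 := by simpa using hx
        simp [e, max_eq_left hx, flip0]
      · have e : max (-x) 0 = -x := by simpa using hx
        simp [e, max_eq_right hx, flip0]
  obtain ⟨g2, hg2c, hg2Y, hg2⟩ := hot2.extend hBc hAc hY hg1c hg1Y hg1
  exact ⟨g2, hg2c, hg2Y, hg2⟩

end

open Matrix in
theorem diag2n_eq_prod {ι : Type*} [Fintype ι] [DecidableEq ι] {i j : ι} (hij : i ≠ j) (a : ℝ)
    (ha : a ≠ 0) : SpecialLinearGroup.diag2n hij a ha =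
      SpecialLinearGroup.transvection hij a * SpecialLinearGroup.transvection hij.symm (-a⁻¹) *
      SpecialLinearGroup.transvection hij a * (SpecialLinearGroup.transvection hij (-1) *
      SpecialLinearGroup.transvection hij.symm 1 * SpecialLinearGroup.transvection hij (-1)) := by
  have key : ∀ b : ℝ, b ≠ 0 → (1 + single i j b) * (1 + single j i (-b⁻¹)) * (1 + single i j b) =
      (1 - single i i 1 - single j j 1 + single i j b - single j i b⁻¹ : Matrix ι ι ℝ) := by
    intro b hb
    simp only [add_mul, mul_add, one_mul, mul_one, single_mul_single_same,
      single_mul_single_of_ne _ _ _ _ hij.symm, mul_neg, neg_mul, mul_inv_cancel₀ hb, inv_mul_cancel₀ hb]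
    ext k l
    simp only [Matrix.add_apply, Matrix.sub_apply, single_apply, Matrix.zero_apply]
    split_ifs <;> ring
  have k2 := key (-1) (by norm_num)
  have k1 := key a ha
  have hcoe : ∀ A B C A' B' C' : SpecialLinearGroup ι ℝ,
      (A * B * C * (A' * B' * C')).1 = A.1 * B.1 * C.1 * (A'.1 * B'.1 * C'.1) :=
    fun _ _ _ _ _ _ => rfl
  refine Subtype.ext (Eq.trans ?_ (hcoe _ _ _ _ _ _).symm)
  simp only [SpecialLinearGroup.transvection_coe,
    SpecialLinearGroup.diag2n_coe]
  norm_num only at k2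
  rw [k1, k2]
  simp only [add_mul, mul_add, one_mul, mul_one, sub_mul, mul_sub, single_mul_single_same,
      single_mul_single_of_ne _ _ _ _ hij, single_mul_single_of_ne _ _ _ _ hij.symm]
  ext k l
  simp only [Matrix.add_apply, Matrix.sub_apply, single_apply, Matrix.zero_apply, diagonal_apply, Matrix.one_apply]
  by_cases h1 : k = l <;> by_cases h2 : i = k <;> by_cases h3 : j = k <;> by_cases h4 : i = l <;> by_cases h5 : j = l <;> simp_all <;> grind

open Matrix in
/-- The group of real matrices of positive determinant is connected. -/
theorem isPreconnected_det_pos {ι : Type*} [Fintype ι] [DecidableEq ι] [Nontrivial ι] :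
    IsPreconnected {A : Matrix ι ι ℝ | 0 < A.det} := by
  have hcl : ∀ A B : Matrix ι ι ℝ, JoinedIn {A : Matrix ι ι ℝ | 0 < A.det} 1 A →
      JoinedIn {A : Matrix ι ι ℝ | 0 < A.det} 1 B →
      JoinedIn {A : Matrix ι ι ℝ | 0 < A.det} 1 (A * B) := by
    intro A B hA hB
    refine hA.trans ?_
    have := hB.map (f := fun C => A * C) (by fun_prop)
    simp only [mul_one] at this
    refine this.mono ?_
    rintro _ ⟨C, hC, rfl⟩
    have h1 : 0 < A.det := hA.target_mem
    have h2 : 0 < C.det := hC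
    simp only [Set.mem_ofPred_eq, det_mul]
    positivity
  have htr : ∀ i j : ι, ∀ hij : i ≠ j, ∀ c : ℝ, JoinedIn {A : Matrix ι ι ℝ | 0 < A.det} 1
      (SpecialLinearGroup.transvection hij c).1 := by
    intro i j hij c
    refine JoinedIn.ofLine (f := fun t => (SpecialLinearGroup.transvection hij (t * c)).1) ?_
      (by simp) (by simp) ?_
    · simp only [SpecialLinearGroup.transvection_coe]
      apply Continuous.continuousOn
      refine continuous_const.add ?_
      refine continuous_matrix fun k l => ?_
      simp only [single_apply]
      split_ifs <;> fun_prop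
    · rintro _ ⟨t, _, rfl⟩
      simp [(SpecialLinearGroup.transvection hij (t * c)).2]
  have hSL : ∀ S : SpecialLinearGroup ι ℝ, JoinedIn {A : Matrix ι ι ℝ | 0 < A.det} 1 S.1 := by
    intro S
    refine SpecialLinearGroup.diagonal_transvection_induction'
      (fun S => JoinedIn {A : Matrix ι ι ℝ | 0 < A.det} 1 S.1) S ?_ htr ?_
    · intro i j hij c hc
      rw [diag2n_eq_prod]
      exact hcl _ _ (hcl _ _ (hcl _ _ (htr _ _ _ _) (htr _ _ _ _)) (htr _ _ _ _))
        (hcl _ _ (hcl _ _ (htr _ _ _ _) (htr _ _ _ _)) (htr _ _ _ _))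
    · intro A B hA hB
      exact hcl _ _ hA hB
  apply IsPathConnected.isConnected _ |>.isPreconnected
  refine ⟨1, by simp, ?_⟩
  intro A hA
  have hA : 0 < A.det := hA
  obtain ⟨i₀, -⟩ := exists_pair_ne ι
  let D : ℝ → Matrix ι ι ℝ := fun d => diagonal (Function.update (fun _ => 1) i₀ d)
  have hD : ∀ d, (D d).det = d := by
    intro d
    simp [D, det_diagonal, Finset.prod_update_of_mem]
  have hS : ((D A.det⁻¹) * A).det = 1 := by
    rw [det_mul, hD, inv_mul_cancel₀ hA.ne']
  have hAe : A = D A.det * (D A.det⁻¹ * A) := by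
    have : D A.det * D A.det⁻¹ = 1 := by
      simp only [D, diagonal_mul_diagonal, ← diagonal_one]
      congr 1; ext k
      by_cases h : k = i₀
      · subst h; simp [hA.ne']
      · simp [h]
    rw [← mul_assoc, this, one_mul]
  rw [hAe]
  refine hcl _ _ ?_ (hSL ⟨_, hS⟩)
  refine JoinedIn.ofLine (f := fun t => D (1 + t * (A.det - 1))) ?_ ?_ (by simp) ?_
  · apply Continuous.continuousOn
    apply Continuous.matrix_diagonal
    exact continuous_const.update _ (by fun_prop)
  · simp [D]
  · rintro _ ⟨t, ht, rfl⟩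
    simp only [Set.mem_ofPred_eq, hD]
    rcases ht.1.eq_or_lt with h | h
    · simp [← h]
    · nlinarith [mul_pos h hA, ht.2]

section Orientation
variable {V₁ V W : Type*} [NormedAddCommGroup V₁] [NormedSpace ℝ V₁] [FiniteDimensional ℝ V₁]
  [NormedAddCommGroup V] [NormedSpace ℝ V] [FiniteDimensional ℝ V]
  [NormedAddCommGroup W] [NormedSpace ℝ W]

/-- Signed size of the pair `(M, D)` of linear maps, with respect to a splitting `e` of `W`. -/
noncomputable def orn (e : (V₁ × V) ≃L[ℝ] W) (M : V₁ →L[ℝ] W) (D : V →L[ℝ] W) : ℝ :=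
  ((e.symm : W →L[ℝ] V₁ × V).comp (M.coprod D)).det

theorem continuous_orn (e : (V₁ × V) ≃L[ℝ] W) :
    Continuous fun p : (V₁ →L[ℝ] W) × (V →L[ℝ] W) => orn e p.1 p.2 := by
  unfold orn
  refine ContinuousLinearMap.continuous_det.comp ?_
  have : Continuous fun p : (V₁ →L[ℝ] W) × (V →L[ℝ] W) => p.1.coprod p.2 :=
    (ContinuousLinearMap.coprodEquivL (𝕜 := ℝ) (E := V₁) (F := V) (G := W) ℝ).continuous
  exact continuous_const.clm_comp this

theorem orn_antilipschitz {e : (V₁ × V) ≃L[ℝ] W} {M : V₁ →L[ℝ] W} {D : V →L[ℝ] W}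
    (h : orn e M D ≠ 0) : ∃ K > 0, ∀ u v, K * max ‖u‖ ‖v‖ ≤ ‖M u + D v‖ := by
  set T := (e.symm : W →L[ℝ] V₁ × V).comp (M.coprod D) with hT
  have hinj : Function.Injective (M.coprod D) := by
    have : Function.Injective T := by
      exact (LinearEquiv.injective (LinearMap.equivOfDetNeZero
        (T : (V₁ × V) →ₗ[ℝ] (V₁ × V)) h))
    exact fun a b hab => this (by simp [hT, ContinuousLinearMap.comp_apply, hab])
  obtain ⟨K, hK, hKl⟩ := (M.coprod D : (V₁ × V) →L[ℝ] W).toLinearMap.injective_iff_antilipschitz.1 hinj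
  refine ⟨(K : ℝ)⁻¹, by positivity, fun u v => ?_⟩
  have := hKl.le_mul_norm (f := M.coprod D) (map_zero _) (u, v)
  rw [Prod.norm_def] at this
  rw [inv_mul_le_iff₀ (by positivity)]
  simpa using this

theorem orn_comp_left (e : (V₁ × V) ≃L[ℝ] W) (M : V₁ →L[ℝ] W) (D : V →L[ℝ] W)
    (A : V₁ →L[ℝ] V₁) :
    orn e (M.comp A) D = orn e M D * A.det := by
  have : (e.symm : W →L[ℝ] V₁ × V).comp ((M.comp A).coprod D) =
      ((e.symm : W →L[ℝ] V₁ × V).comp (M.coprod D)).comp (A.prodMap (.id ℝ V)) := by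
    ext <;> simp
  unfold orn
  rw [this]
  simp only [ContinuousLinearMap.det, ContinuousLinearMap.toLinearMap_comp, LinearMap.det_comp,
    ContinuousLinearMap.coe_prodMap, LinearMap.det_prodMap]
  simp

theorem isPreconnected_clm_det_pos (hV : 2 ≤ Module.finrank ℝ V₁) :
    IsPreconnected {A : V₁ →L[ℝ] V₁ | 0 < A.det} := by
  have : Nontrivial (Fin (Module.finrank ℝ V₁)) := Fin.nontrivial_iff_two_le.2 hV
  let b := Module.finBasis ℝ V₁
  have hc : Continuous fun A : Matrix (Fin (Module.finrank ℝ V₁)) (Fin (Module.finrank ℝ V₁)) ℝ =>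
      LinearMap.toContinuousLinearMap (Matrix.toLin b b A) :=
    ((Matrix.toLin b b).trans LinearMap.toContinuousLinearMap).toLinearMap.continuous_of_finiteDimensional
  convert isPreconnected_det_pos.image _ hc.continuousOn
  ext A
  simp only [Set.mem_image, Set.mem_ofPred_eq]
  constructor
  · intro h
    refine ⟨LinearMap.toMatrix b b A, ?_, ?_⟩
    · rwa [LinearMap.det_toMatrix]
    · ext v; simp
  · rintro ⟨B, hB, rfl⟩
    rw [ContinuousLinearMap.det]
    simpa using hB

theorem orn_add_comp (e : (V₁ × V) ≃L[ℝ] W) (M : V₁ →L[ℝ] W) (D : V →L[ℝ] W)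
    (B : V₁ →L[ℝ] V) : ∃ c > 0, orn e (M + D.comp B) D = orn e M D * c := by
  have hcomp : ∀ (M : V₁ →L[ℝ] W) (B : V₁ →L[ℝ] V), orn e (M + D.comp B) D = orn e M D *
      ((ContinuousLinearMap.fst ℝ V₁ V).prod (B.coprod (.id ℝ V))).det := by
    intro M B
    have : (e.symm : W →L[ℝ] V₁ × V).comp ((M + D.comp B).coprod D) =
        ((e.symm : W →L[ℝ] V₁ × V).comp (M.coprod D)).comp
          ((ContinuousLinearMap.fst ℝ V₁ V).prod (B.coprod (.id ℝ V))) := by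
      ext <;> simp
    unfold orn
    rw [this]
    simp only [ContinuousLinearMap.det, ContinuousLinearMap.toLinearMap_comp, LinearMap.det_comp]
  have hmul : ∀ B B' : V₁ →L[ℝ] V, (((ContinuousLinearMap.fst ℝ V₁ V).prod ((B + B').coprod (.id ℝ V))).det : ℝ)
      = ((ContinuousLinearMap.fst ℝ V₁ V).prod (B.coprod (.id ℝ V))).det *
        ((ContinuousLinearMap.fst ℝ V₁ V).prod (B'.coprod (.id ℝ V))).det := by
    intro B B'
    have : (ContinuousLinearMap.fst ℝ V₁ V).prod ((B + B').coprod (.id ℝ V)) =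
        ((ContinuousLinearMap.fst ℝ V₁ V).prod (B.coprod (.id ℝ V))).comp
        ((ContinuousLinearMap.fst ℝ V₁ V).prod (B'.coprod (.id ℝ V))) := by
      ext <;> simp
    rw [this]
    simp only [ContinuousLinearMap.det, ContinuousLinearMap.toLinearMap_comp, LinearMap.det_comp]
  refine ⟨_, ?_, hcomp M B⟩
  have h0 : ((ContinuousLinearMap.fst ℝ V₁ V).prod ((0 : V₁ →L[ℝ] V).coprod (.id ℝ V))).det = 1 := by
    have : (ContinuousLinearMap.fst ℝ V₁ V).prod ((0 : V₁ →L[ℝ] V).coprod (.id ℝ V)) = .id ℝ _ := by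
      ext <;> simp
    rw [this]; simp [ContinuousLinearMap.det]
  have h1 := hmul B (-B)
  rw [add_neg_cancel, h0] at h1
  have h2 := hmul ((1/2 : ℝ) • B) ((1/2 : ℝ) • B)
  rw [← add_smul] at h2
  norm_num at h2
  rw [h2]
  refine mul_self_pos.2 fun h => ?_
  rw [h] at h2
  rw [h2] at h1
  simp at h1

/-- Complementary maps with a prescribed orientation form a connected set. -/
theorem isPreconnected_orn_pos (e : (V₁ × V) ≃L[ℝ] W) (hV : 2 ≤ Module.finrank ℝ V₁)
    (D : V →L[ℝ] W) (s : ℝ) : IsPreconnected {M : V₁ →L[ℝ] W | 0 < s * orn e M D} := by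
  rcases Set.eq_empty_or_nonempty {M : V₁ →L[ℝ] W | 0 < s * orn e M D} with h | ⟨M₀, h₀⟩
  · rw [h]; exact isPreconnected_empty
  have h₀ : 0 < s * orn e M₀ D := h₀
  have hne : orn e M₀ D ≠ 0 := fun h => by simp [h] at h₀
  have hc : Continuous fun p : (V₁ →L[ℝ] V₁) × (V₁ →L[ℝ] V) => M₀.comp p.1 + D.comp p.2 := by
    fun_prop
  convert ((isPreconnected_clm_det_pos hV).prod isPreconnected_univ).image _ hc.continuousOn
  have key : ∀ (A : V₁ →L[ℝ] V₁) (B : V₁ →L[ℝ] V), ∃ c > 0, s * orn e (M₀.comp A + D.comp B) D = s * orn e M₀ D * A.det * c := by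
    intro A B
    obtain ⟨c, hc, h⟩ := orn_add_comp e (M₀.comp A) D B
    exact ⟨c, hc, by rw [h, orn_comp_left]; ring⟩
  ext M
  simp only [Set.mem_image, Set.mem_ofPred_eq, Set.mem_prod, Set.mem_univ, and_true, Prod.exists]
  constructor
  · intro hM
    set T := (e.symm : W →L[ℝ] V₁ × V).comp (M₀.coprod D) with hT
    let T' := LinearMap.equivOfDetNeZero (T : (V₁ × V) →ₗ[ℝ] (V₁ × V)) hne
    let S : V₁ →L[ℝ] V₁ × V := LinearMap.toContinuousLinearMap
      (T'.symm.toLinearMap ∘ₗ (e.symm : W →L[ℝ] V₁ × V).toLinearMap ∘ₗ M.toLinearMap)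
    have hS : ∀ v, M₀ (S v).1 + D (S v).2 = M v := by
      intro v
      have : T (S v) = e.symm (M v) := by
        change T' (T'.symm (e.symm (M v))) = _
        simp
      simpa [hT] using congrArg e this
    have hMe : M₀.comp ((ContinuousLinearMap.fst ℝ V₁ V).comp S) +
        D.comp ((ContinuousLinearMap.snd ℝ V₁ V).comp S) = M := by
      ext v; simpa using hS v
    refine ⟨(ContinuousLinearMap.fst ℝ V₁ V).comp S, (ContinuousLinearMap.snd ℝ V₁ V).comp S, ?_, hMe⟩
    obtain ⟨c, hc, h⟩ := key ((ContinuousLinearMap.fst ℝ V₁ V).comp S)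
      ((ContinuousLinearMap.snd ℝ V₁ V).comp S)
    rw [hMe] at h
    rw [h] at hM
    have h1 := pos_of_mul_pos_left hM hc.le
    exact (pos_iff_pos_of_mul_pos h1).1 h₀
  · rintro ⟨A, B, hA, rfl⟩
    obtain ⟨c, hc, h⟩ := key A B
    rw [h]; positivity

end Orientation

section Meridian
variable {V₁ V W : Type*} [NormedAddCommGroup V₁] [NormedSpace ℝ V₁] [FiniteDimensional ℝ V₁]
  [NormedAddCommGroup V] [NormedSpace ℝ V] [FiniteDimensional ℝ V]
  [NormedAddCommGroup W] [NormedSpace ℝ W]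
  {e : (V₁ × V) ≃L[ℝ] W} {f : V → W} {Q : Set V} {P Y : Set W} {C₀ : Set V₁}

theorem meridian_mem (hQ : IsCompact Q) (hf : ContinuousOn f Q) (hinj : Set.InjOn f Q)
    (hP : IsClosed P) (hY : ∀ w, w ∉ P → w ∉ f '' Q → w ∈ Y) (hC : IsCompact C₀) (h0 : 0 ∉ C₀)
    {y : V} (hy : y ∈ interior Q) (hfy : f y ∉ P) {D : V →L[ℝ] W} (hD : HasStrictFDerivAt f D y)
    {M : V₁ →L[ℝ] W} (ho : orn e M D ≠ 0) :
    ∃ c > 0, ∃ δ > 0, ∀ y' ∈ ball y δ, ∀ ε ∈ Set.Ioo (0 : ℝ) δ, ∀ v ∈ C₀, ∀ ξ : W,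
      ‖ξ‖ ≤ c * ε → f y' + ε • M v + ξ ∈ Y := by
  obtain ⟨K, hK, hKl⟩ := orn_antilipschitz ho
  obtain ⟨d, hd, hdC⟩ : ∃ d > 0, ∀ v ∈ C₀, d ≤ ‖v‖ := by
    obtain ⟨d, hd, hdC⟩ := Metric.isOpen_iff.1 hC.isClosed.isOpen_compl 0 h0
    refine ⟨d, hd, fun v hv => ?_⟩
    by_contra! hlt
    exact hdC (by simpa using hlt) hv
  obtain ⟨R, hR⟩ := (hC.image M.continuous).isBounded.exists_norm_le
  have hstr : ∀ᶠ p : V × V in 𝓝 (y, y), ‖f p.1 - f p.2 - D (p.1 - p.2)‖ ≤ K / 2 * ‖p.1 - p.2‖ :=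
    hD.isLittleO.def (by positivity)
  obtain ⟨r₀, hr₀, hr₀s⟩ := Metric.eventually_nhds_iff_ball.1 hstr
  obtain ⟨r₁, hr₁, hr₁Q⟩ := Metric.isOpen_iff.1 isOpen_interior y hy
  have hstr' : ∀ a ∈ ball y (min r₀ r₁), ∀ b ∈ ball y (min r₀ r₁),
      ‖f a - f b - D (a - b)‖ ≤ K / 2 * ‖a - b‖ := fun a ha b hb =>
    hr₀s (a, b) (by
      rw [mem_ball, Prod.dist_eq]
      exact max_lt (lt_of_lt_of_le ha (min_le_left _ _)) (lt_of_lt_of_le hb (min_le_left _ _)))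
  have hrpos : 0 < min r₀ r₁ := lt_min hr₀ hr₁
  have hballQ : ball y (min r₀ r₁) ⊆ Q :=
    (ball_subset_ball (min_le_right _ _)).trans (hr₁Q.trans interior_subset)
  set r := min r₀ r₁
  obtain ⟨η₁, hη₁, hη₁P⟩ := Metric.isOpen_iff.1 hP.isOpen_compl (f y) hfy
  have hcl : IsClosed (f '' (Q \ ball y r)) :=
    ((hQ.diff isOpen_ball).image_of_continuousOn (hf.mono Set.sdiff_subset)).isClosed
  have hny : f y ∉ f '' (Q \ ball y r) := by
    rintro ⟨z, ⟨hz, hzb⟩, h⟩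
    have := hinj hz (interior_subset hy) h
    subst this
    exact hzb (mem_ball_self hrpos)
  obtain ⟨η₂, hη₂, hη₂f⟩ := Metric.isOpen_iff.1 hcl.isOpen_compl (f y) hny
  obtain ⟨δ₁, hδ₁, hδ₁f⟩ := Metric.continuousAt_iff.1 hD.hasFDerivAt.continuousAt
    (min η₁ η₂ / 2) (by positivity)
  have hR0 : 0 ≤ max R 0 := le_max_right _ _
  refine ⟨K * d / 4, by positivity, min (min r δ₁) (min η₁ η₂ / (4 * (max R 0 + K * d + 1))),
    by positivity, ?_⟩
  intro y' hy' ε hε v hv ξ hξ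
  have hy'r : y' ∈ ball y r := mem_ball.2 <| lt_of_lt_of_le (mem_ball.1 hy') ((min_le_left _ _).trans (min_le_left _ _))
  have hy'δ : dist y' y < δ₁ := lt_of_lt_of_le (mem_ball.1 hy') ((min_le_left _ _).trans (min_le_right _ _))
  have hε0 := hε.1
  have hεη : ε * (4 * (max R 0 + K * d + 1)) < min η₁ η₂ := by
    rw [← lt_div_iff₀ (by positivity)]
    exact lt_of_lt_of_le hε.2 (min_le_right _ _)
  have hMv : ‖M v‖ ≤ max R 0 := (hR _ ⟨v, hv, rfl⟩).trans (le_max_left _ _)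
  have hclose : dist (f y' + ε • M v + ξ) (f y) < min η₁ η₂ := by
    have h1 : dist (f y' + ε • M v + ξ) (f y') ≤ ε * max R 0 + K * d / 4 * ε := by
      rw [dist_eq_norm]
      calc ‖f y' + ε • M v + ξ - f y'‖ = ‖ε • M v + ξ‖ := by congr 1; abel
        _ ≤ ‖ε • M v‖ + ‖ξ‖ := norm_add_le _ _
        _ ≤ _ := by
          rw [norm_smul, Real.norm_of_nonneg hε0.le]
          gcongr
    have h2 := hδ₁f hy'δ
    have h3 := dist_triangle (f y' + ε • M v + ξ) (f y') (f y)
    have h4 : 0 < K * d * ε := by positivity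
    nlinarith
  apply hY
  · exact fun h => hη₁P (lt_of_lt_of_le hclose (min_le_left _ _)) h
  · rintro ⟨y'', hy'', he⟩
    have hb : y'' ∈ ball y r := by
      by_contra hb
      exact hη₂f (lt_of_lt_of_le hclose (min_le_right _ _)) ⟨y'', ⟨hy'', hb⟩, he⟩
    have h1 := hstr' y'' hb y' hy'r
    have h2 := hKl (ε • v) (-(y'' - y'))
    have h3 : M (ε • v) + D (-(y'' - y')) = (f y'' - f y' - D (y'' - y')) - ξ := by
      rw [he, map_smul, map_neg]; abel
    rw [h3, norm_neg, norm_smul, Real.norm_of_nonneg hε0.le] at h2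
    have h4 := norm_sub_le (f y'' - f y' - D (y'' - y')) ξ
    have h5 := hdC v hv
    have h6 : ε * d ≤ ε * ‖v‖ := by gcongr
    have h7 := le_max_left (ε * ‖v‖) ‖y'' - y'‖
    have h8 := le_max_right (ε * ‖v‖) ‖y'' - y'‖
    have h9 : K * (ε * d) > 0 := by positivity
    nlinarith

/-- Small meridians of the sheet `f` at two points are homotopic in `Y`. -/
def MerHot (f : V → W) (C₀ : Set V₁) (Y : Set W) (a b : V × (V₁ →L[ℝ] W)) : Prop :=
  ∃ δ > 0, ∀ ε ∈ Set.Ioo (0 : ℝ) δ, ∀ ε' ∈ Set.Ioo (0 : ℝ) δ,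
    Hot C₀ Y (fun v => f a.1 + ε • a.2 v) (fun v => f b.1 + ε' • b.2 v)

theorem MerHot.symm {a b : V × (V₁ →L[ℝ] W)} (h : MerHot f C₀ Y a b) : MerHot f C₀ Y b a := by
  obtain ⟨δ, hδ, h⟩ := h
  exact ⟨δ, hδ, fun ε hε ε' hε' => (h ε' hε' ε hε).symm⟩

theorem MerHot.trans {a b c : V × (V₁ →L[ℝ] W)} (h : MerHot f C₀ Y a b) (h' : MerHot f C₀ Y b c) :
    MerHot f C₀ Y a c := by
  obtain ⟨δ, hδ, h⟩ := h
  obtain ⟨δ', hδ', h'⟩ := h'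
  refine ⟨min δ δ', lt_min hδ hδ', fun ε hε ε' hε' => ?_⟩
  have hm : min δ δ' / 2 ∈ Set.Ioo 0 (min δ δ') := by
    have := lt_min hδ hδ'
    constructor <;> linarith
  exact (h ε ⟨hε.1, hε.2.trans_le (min_le_left _ _)⟩ _ ⟨hm.1, hm.2.trans_le (min_le_left _ _)⟩).trans
    (h' _ ⟨hm.1, hm.2.trans_le (min_le_right _ _)⟩ ε' ⟨hε'.1, hε'.2.trans_le (min_le_right _ _)⟩)

theorem merHot_eventually (hQ : IsCompact Q) (hf : ContinuousOn f Q) (hinj : Set.InjOn f Q)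
    (hP : IsClosed P) (hY : ∀ w, w ∉ P → w ∉ f '' Q → w ∈ Y) (hC : IsCompact C₀) (h0 : 0 ∉ C₀)
    {y : V} (hy : y ∈ interior Q) (hfy : f y ∉ P) {D : V →L[ℝ] W} (hD : HasStrictFDerivAt f D y)
    {M : V₁ →L[ℝ] W} (ho : orn e M D ≠ 0) :
    ∀ᶠ b in 𝓝 (y, M), MerHot f C₀ Y (y, M) b := by
  obtain ⟨c, hc, δ, hδ, h⟩ := meridian_mem hQ hf hinj hP hY hC h0 hy hfy hD ho
  obtain ⟨R, hR⟩ := hC.isBounded.exists_norm_le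
  obtain ⟨r₁, hr₁, hr₁Q⟩ := Metric.isOpen_iff.1 isOpen_interior y hy
  have hR0 : 0 ≤ max R 0 := le_max_right _ _
  refine Metric.eventually_nhds_iff_ball.2 ⟨min (min δ r₁) (c / (max R 0 + 1)), by positivity, ?_⟩
  rintro ⟨y', M'⟩ hb
  rw [mem_ball, Prod.dist_eq, max_lt_iff] at hb
  obtain ⟨hb1, hb2⟩ := hb
  have hb1δ := lt_of_lt_of_le hb1 ((min_le_left _ _).trans (min_le_left _ _))
  have hb1r := lt_of_lt_of_le hb1 ((min_le_left _ _).trans (min_le_right _ _))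
  have hMM : ‖M' - M‖ * (max R 0 + 1) ≤ c := by
    rw [← le_div_iff₀ (by positivity), ← dist_eq_norm]
    exact hb2.le.trans (min_le_right _ _)
  have hseg : ∀ t ∈ Set.Icc (0 : ℝ) 1, dist (y + t • (y' - y)) y ≤ dist y' y := by
    intro t ht
    rw [dist_eq_norm, add_sub_cancel_left, norm_smul, Real.norm_of_nonneg ht.1, dist_eq_norm]
    exact mul_le_of_le_one_left (norm_nonneg _) ht.2
  refine ⟨δ, hδ, fun ε hε ε' hε' => ⟨fun p => f (y + p.2 • (y' - y)) +
    ((1 - p.2) * ε + p.2 * ε') • (M + p.2 • (M' - M)) p.1, ?_, ?_, ?_, ?_⟩⟩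
  · refine ContinuousOn.add ?_ ?_
    · refine hf.comp (by fun_prop) ?_
      rintro ⟨v, t⟩ ⟨_, ht⟩
      exact interior_subset (hr₁Q ((hseg t ht).trans_lt hb1r))
    · apply Continuous.continuousOn
      fun_prop
  · rintro ⟨v, t⟩ ⟨hv, ht⟩
    have hεt : (1 - t) * ε + t * ε' ∈ Set.Ioo 0 δ := by
      obtain ⟨ht0, ht1⟩ := ht
      obtain ⟨h1, h2⟩ := hε
      obtain ⟨h3, h4⟩ := hε'
      constructor
      · rcases ht0.eq_or_lt with rfl | h
        · simpa
        · nlinarith [mul_pos h h3, mul_nonneg (sub_nonneg.2 ht1) h1.le]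
      · rcases ht0.eq_or_lt with rfl | h
        · simpa
        · nlinarith [mul_lt_mul_of_pos_left h4 h, mul_le_mul_of_nonneg_left h2.le (sub_nonneg.2 ht1)]
    have := h (y + t • (y' - y)) ((hseg t ht).trans_lt hb1δ) _ hεt v hv
      (((1 - t) * ε + t * ε') • t • (M' - M) v) ?_
    · convert this using 1
      simp only [add_apply, smul_apply, smul_add]
      abel
    · rw [norm_smul, norm_smul, Real.norm_of_nonneg hεt.1.le, Real.norm_of_nonneg ht.1, mul_comm c]
      gcongr
      · exact hεt.1.le
      · calc t * ‖(M' - M) v‖ ≤ 1 * (‖M' - M‖ * (max R 0 + 1)) := by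
              gcongr
              · exact ht.2
              · refine ((M' - M).le_opNorm v).trans ?_
                gcongr
                exact (hR v hv).trans ((le_max_left _ _).trans (by linarith))
          _ ≤ c := by linarith
  · intro v hv; simp
  · intro v hv; simp

/-- Meridians of equal sign over a preconnected set of good points are homotopic. -/
theorem merHot_of_isPreconnected (hV : 2 ≤ Module.finrank ℝ V₁) (hQ : IsCompact Q)
    (hf : ContinuousOn f Q) (hinj : Set.InjOn f Q)
    (hP : IsClosed P) (hY : ∀ w, w ∉ P → w ∉ f '' Q → w ∈ Y) (hC : IsCompact C₀) (h0 : 0 ∉ C₀)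
    {G : Set V} (hG : IsPreconnected G) (hGQ : G ⊆ interior Q) (hGP : ∀ y ∈ G, f y ∉ P)
    {D : V → V →L[ℝ] W} (hD : ∀ y ∈ G, HasStrictFDerivAt f (D y) y) (hDc : ContinuousOn D G)
    (s : ℝ) (hs : ∀ y ∈ G, ∃ M : V₁ →L[ℝ] W, 0 < s * orn e M (D y)) {y y' : V} (hy : y ∈ G)
    (hy' : y' ∈ G) {M M' : V₁ →L[ℝ] W} (hM : 0 < s * orn e M (D y))
    (hM' : 0 < s * orn e M' (D y')) : MerHot f C₀ Y (y, M) (y', M') := by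
  have hne : ∀ {M D}, 0 < s * orn e M D → orn e M D ≠ 0 := fun h h' => by simp [h'] at h
  have hfib : ∀ y ∈ G, ∀ M M', 0 < s * orn e M (D y) → 0 < s * orn e M' (D y) →
      MerHot f C₀ Y (y, M) (y, M') := by
    intro y hy M M' hM hM'
    refine (isPreconnected_orn_pos e hV (D y) s).induction₂
      (fun M M' => MerHot f C₀ Y (y, M) (y, M')) ?_ (fun _ _ _ _ _ _ => MerHot.trans)
      (fun _ _ _ _ => MerHot.symm) hM hM'
    intro N hN
    have h1 := merHot_eventually hQ hf hinj hP hY hC h0 (hGQ hy) (hGP y hy) (hD y hy) (hne hN)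
    have h2 : Filter.Tendsto (fun N' : V₁ →L[ℝ] W => (y, N')) (𝓝 N) (𝓝 (y, N)) :=
      (Continuous.prodMk_right y).continuousAt
    exact (h2.eventually h1).filter_mono nhdsWithin_le_nhds
  refine hG.induction₂ (fun y y' => ∀ M M', 0 < s * orn e M (D y) → 0 < s * orn e M' (D y') →
      MerHot f C₀ Y (y, M) (y', M')) ?_ ?_ ?_ hy hy' M M' hM hM'
  · intro z hz
    obtain ⟨N, hN⟩ := hs z hz
    have h1 := merHot_eventually hQ hf hinj hP hY hC h0 (hGQ hz) (hGP z hz) (hD z hz) (hne hN)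
    have h2 : Filter.Tendsto (fun z' : V => (z', N)) (𝓝[G] z) (𝓝 (z, N)) :=
      (Continuous.prodMk_left N).continuousAt.mono_left nhdsWithin_le_nhds
    have h3 : ∀ᶠ z' in 𝓝[G] z, 0 < s * orn e N (D z') := by
      have : ContinuousWithinAt (fun z' => s * orn e N (D z')) G z :=
        ((continuous_orn e).continuousAt.comp_continuousWithinAt
          (continuousWithinAt_const.prodMk (hDc z hz))).const_mul s |> fun h => h
      exact this.eventually (lt_mem_nhds hN)
    filter_upwards [h2.eventually h1, h3, self_mem_nhdsWithin] with z' h4 h5 h6 M M' hM hM'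
    exact ((hfib z hz M N hM hN).trans h4).trans (hfib z' h6 N M' h5 hM')
  · intro a b c ha hb hc h1 h2 M M' hM hM'
    obtain ⟨N, hN⟩ := hs b hb
    exact (h1 M N hM hN).trans (h2 N M' hN hM')
  · intro a b _ _ h M M' hM hM'
    exact (h M' M hM' hM).symm

/-- Near a transverse crossing, a small link sphere is a meridian. -/
theorem hot_meridian (hQ : IsCompact Q) (hf : ContinuousOn f Q) (hinj : Set.InjOn f Q)
    (hP : IsClosed P) (hY : ∀ w, w ∉ P → w ∉ f '' Q → w ∈ Y)
    {y : V} (hy : y ∈ interior Q) (hfy : f y ∉ P) {D : V →L[ℝ] W} (hD : HasStrictFDerivAt f D y)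
    {M : V₁ →L[ℝ] W} (ho : orn e M D ≠ 0) {φ : V₁ → W} {p : V₁}
    (hφ : ContinuousOn φ (closedBall p 1)) (hφY : ∀ w ∈ closedBall p 1, w ≠ p → φ w ∈ Y)
    (hφp : φ p = f y) (hφD : HasFDerivAt φ M p) :
    ∃ δ > 0, ∀ ε ∈ Set.Ioo (0 : ℝ) δ,
      Hot (sphere 0 1) Y (fun v => φ (p + v)) (fun v => f y + ε • M v) := by
  obtain ⟨c, hc, δ, hδ, h⟩ := meridian_mem hQ hf hinj hP hY (isCompact_sphere (0 : V₁) 1)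
    (by simp) hy hfy hD ho
  obtain ⟨r, hr, hrs⟩ := Metric.eventually_nhds_iff_ball.1 (hφD.isLittleO.def hc)
  refine ⟨min (min δ r) 1, by positivity, fun ε hε => ?_⟩
  obtain ⟨hε0, hε1⟩ := hε
  have hεδ := hε1.trans_le ((min_le_left _ _).trans (min_le_left _ _))
  have hεr := hε1.trans_le ((min_le_left _ _).trans (min_le_right _ _))
  have hε1 := hε1.trans_le (min_le_right _ _)
  have hA : Hot (sphere (0 : V₁) 1) Y (fun v => φ (p + v)) (fun v => φ (p + ε • v)) := by
    refine ⟨fun q => φ (p + (1 - q.2 * (1 - ε)) • q.1), ?_, ?_, ?_, ?_⟩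
    · refine hφ.comp (by fun_prop) ?_
      rintro ⟨v, t⟩ ⟨hv, ht⟩
      have hv : ‖v‖ = 1 := by simpa using hv
      have h0 : 0 ≤ 1 - t * (1 - ε) := by nlinarith [ht.1, ht.2]
      simp only [mem_closedBall, dist_self_add_left, norm_smul, hv, Real.norm_of_nonneg h0]
      nlinarith [ht.1, ht.2]
    · rintro ⟨v, t⟩ ⟨hv, ht⟩
      have hv : ‖v‖ = 1 := by simpa using hv
      have h0 : 0 < 1 - t * (1 - ε) := by nlinarith [ht.1, ht.2]
      refine hφY _ ?_ ?_
      · simp only [mem_closedBall, dist_self_add_left, norm_smul, hv, Real.norm_of_nonneg h0.le]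
        nlinarith [ht.1, ht.2]
      · have : v ≠ 0 := fun h => by simp [h] at hv
        simpa [h0.ne'] using this
    · intro v hv; simp
    · intro v hv; simp
  refine hA.trans ⟨fun q => (1 - q.2) • φ (p + ε • q.1) + q.2 • (f y + ε • M q.1), ?_, ?_, ?_, ?_⟩
  · refine ContinuousOn.add (ContinuousOn.smul (by fun_prop) ?_) (by fun_prop)
    refine hφ.comp (by fun_prop) ?_
    rintro ⟨v, t⟩ ⟨hv, ht⟩
    have hv : ‖v‖ = 1 := by simpa using hv
    simp only [mem_closedBall, dist_self_add_left, norm_smul, hv, Real.norm_of_nonneg hε0.le]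
    linarith
  · rintro ⟨v, t⟩ ⟨hv, ht⟩
    have hv' : ‖v‖ = 1 := by simpa using hv
    have h1 := hrs (p + ε • v) (by
      simpa [norm_smul, hv', Real.norm_of_nonneg hε0.le] using hεr)
    simp only [add_sub_cancel_left, norm_smul, hv', Real.norm_of_nonneg hε0.le, mul_one] at h1
    have h2 := h y (mem_ball_self hδ) ε ⟨hε0, hεδ⟩ v hv
      ((1 - t) • (φ (p + ε • v) - φ p - M (ε • v))) (by
        rw [norm_smul, Real.norm_of_nonneg (sub_nonneg.2 ht.2)]
        exact (mul_le_of_le_one_left (norm_nonneg _) (by linarith [ht.1])).trans h1)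
    convert h2 using 1
    rw [hφp, map_smul]
    module
  · intro v hv; simp
  · intro v hv; simp

end Meridian

theorem exists_orn_ne_zero {V₁ V W : Type*} [NormedAddCommGroup V₁] [NormedSpace ℝ V₁]
    [FiniteDimensional ℝ V₁] [NormedAddCommGroup V] [NormedSpace ℝ V] [FiniteDimensional ℝ V]
    [NormedAddCommGroup W] [NormedSpace ℝ W] (e : (V₁ × V) ≃L[ℝ] W) {D : V →L[ℝ] W}
    (hD : Function.Injective D) : ∃ M : V₁ →L[ℝ] W, orn e M D ≠ 0 := by
  have hfd : FiniteDimensional ℝ W := e.toLinearEquiv.finiteDimensional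
  obtain ⟨C, hC⟩ := Submodule.exists_isCompl (LinearMap.range D.toLinearMap)
  have h1 := Submodule.finrank_add_eq_of_isCompl hC
  have h2 : Module.finrank ℝ (LinearMap.range D.toLinearMap) = Module.finrank ℝ V :=
    LinearMap.finrank_range_of_inj hD
  have h3 := e.toLinearEquiv.finrank_eq
  rw [Module.finrank_prod] at h3
  have h4 : Module.finrank ℝ V₁ = Module.finrank ℝ C := by omega
  let i := LinearEquiv.ofFinrankEq V₁ C h4
  let j := LinearEquiv.ofInjective D.toLinearMap hD
  let k := (i.prodCongr j).trans ((Submodule.prodEquivOfIsCompl C _ hC.symm).trans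
    e.symm.toLinearEquiv)
  refine ⟨LinearMap.toContinuousLinearMap (C.subtype ∘ₗ i.toLinearMap), ?_⟩
  have : ((e.symm : W →L[ℝ] V₁ × V).comp ((LinearMap.toContinuousLinearMap
      (C.subtype ∘ₗ i.toLinearMap)).coprod D)).toLinearMap = k.toLinearMap := by
    ext v <;> simp [k, i, j]
  unfold orn ContinuousLinearMap.det
  rw [this]
  exact k.isUnit_det'.ne_zero

section Box
variable {F V W : Type*} [NormedAddCommGroup F] [NormedSpace ℝ F] [FiniteDimensional ℝ F]
  [NormedAddCommGroup V] [NormedSpace ℝ V] [FiniteDimensional ℝ V]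
  [NormedAddCommGroup W] [NormedSpace ℝ W] [FiniteDimensional ℝ W]
  {e : ((ℝ × F) × V) ≃L[ℝ] W} {f : V → W} {Q : Set V} {P Y : Set W}

/-- The reflection in the first coordinate. -/
noncomputable def flipL (F : Type*) [NormedAddCommGroup F] [NormedSpace ℝ F] :
    (ℝ × F) →L[ℝ] (ℝ × F) := (-ContinuousLinearMap.id ℝ ℝ).prodMap (.id ℝ F)

theorem det_flipL : (flipL F).det = -1 := by
  simp only [flipL, ContinuousLinearMap.det, ContinuousLinearMap.coe_prodMap, LinearMap.det_prodMap]
  simp [LinearMap.det_ring]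

theorem exists_orn_pos (e : ((ℝ × F) × V) ≃L[ℝ] W) {D : V →L[ℝ] W} (hD : Function.Injective D)
    {s : ℝ} (hs : s ≠ 0) : ∃ M : (ℝ × F) →L[ℝ] W, 0 < s * orn e M D := by
  obtain ⟨M, hM⟩ := exists_orn_ne_zero e hD
  rcases (mul_ne_zero hs hM).lt_or_gt with h | h
  · refine ⟨M.comp (flipL F), ?_⟩
    rw [orn_comp_left, det_flipL]; linarith
  · exact ⟨M, h⟩

/-- Two crossings of opposite sign with the same sheet can be removed in a model box. -/
theorem cancel_box [Nontrivial F] (hYo : IsOpen Y) (hSC : LoopsNull Y) (hQ : IsCompact Q)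
    (hf : ContinuousOn f Q) (hinj : Set.InjOn f Q)
    (hP : IsClosed P) (hY : ∀ w, w ∉ P → w ∉ f '' Q → w ∈ Y)
    {G₀ : Set V} (hG₀ : IsPreconnected G₀) (hGQ : G₀ ⊆ interior Q) (hGP : ∀ y ∈ G₀, f y ∉ P)
    {D : V → V →L[ℝ] W} (hD : ∀ y ∈ G₀, HasStrictFDerivAt f (D y) y) (hDc : ContinuousOn D G₀)
    (hDi : ∀ y ∈ G₀, Function.Injective (D y)) {y₁ y₂ : V} (hy₁ : y₁ ∈ G₀) (hy₂ : y₂ ∈ G₀)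
    {M₁ M₂ : (ℝ × F) →L[ℝ] W} (ho : orn e M₁ (D y₁) * orn e M₂ (D y₂) < 0)
    {B A : Set (ℝ × F)} (hB : B = {w | |w.1| ≤ 2 ∧ ‖w.2‖ ≤ 1})
    (hA : A = {w | |w.1| ≤ 2 ∧ ‖w.2‖ ≤ 1 ∧ (|w.1| = 2 ∨ ‖w.2‖ = 1)})
    {G : ℝ × F → W} (hG : ContinuousOn G B)
    (hGY : ∀ w ∈ B, w ≠ (1, 0) → w ≠ (-1, 0) → G w ∈ Y) (hG₁ : G (-1, 0) = f y₁)
    (hG₂ : G (1, 0) = f y₂) (hM₁ : HasFDerivAt G M₁ (-1, 0)) (hM₂ : HasFDerivAt G M₂ (1, 0)) :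
    ∃ G', ContinuousOn G' B ∧ Set.MapsTo G' B Y ∧ Set.EqOn G' G A := by
  have hn₁ : orn e M₁ (D y₁) ≠ 0 := fun h => by simp [h] at ho
  have hn₂ : orn e M₂ (D y₂) ≠ 0 := fun h => by simp [h] at ho
  have hmem : ∀ w : ℝ × F, ∀ p : ℝ × F, w ∈ closedBall p 1 ↔ |w.1 - p.1| ≤ 1 ∧ ‖w.2 - p.2‖ ≤ 1 := by
    intro w p
    rw [mem_closedBall, Prod.dist_eq, max_le_iff, Real.dist_eq, dist_eq_norm]
  have hsub₂ : closedBall ((1 : ℝ), (0 : F)) 1 ⊆ B := by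
    intro w hw
    rw [hmem, abs_le] at hw
    rw [hB]
    exact ⟨abs_le.2 ⟨by linarith [hw.1.1], by linarith [hw.1.2]⟩, by simpa using hw.2⟩
  have hsub₁ : closedBall ((-1 : ℝ), (0 : F)) 1 ⊆ B := by
    intro w hw
    rw [hmem, abs_le] at hw
    rw [hB]
    exact ⟨abs_le.2 ⟨by linarith [hw.1.1], by linarith [hw.1.2]⟩, by simpa using hw.2⟩
  have hYb₂ : ∀ w ∈ closedBall ((1 : ℝ), (0 : F)) 1, w ≠ (1, 0) → G w ∈ Y := by
    intro w hw hne
    refine hGY w (hsub₂ hw) hne ?_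
    rintro rfl
    rw [hmem] at hw
    norm_num at hw
  have hYb₁ : ∀ w ∈ closedBall ((-1 : ℝ), (0 : F)) 1, w ≠ (-1, 0) → G w ∈ Y := by
    intro w hw hne
    refine hGY w (hsub₁ hw) ?_ hne
    rintro rfl
    rw [hmem] at hw
    norm_num at hw
  have hV : 2 ≤ Module.finrank ℝ (ℝ × F) := by
    rw [Module.finrank_prod, Module.finrank_self]
    have : 0 < Module.finrank ℝ F := Module.finrank_pos
    omega
  obtain ⟨δ₁, hδ₁, h₁⟩ := hot_meridian hQ hf hinj hP hY (hGQ hy₁) (hGP _ hy₁) (hD _ hy₁) hn₁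
    (hG.mono hsub₁) hYb₁ hG₁ hM₁
  obtain ⟨δ₂, hδ₂, h₂⟩ := hot_meridian hQ hf hinj hP hY (hGQ hy₂) (hGP _ hy₂) (hD _ hy₂) hn₂
    (hG.mono hsub₂) hYb₂ hG₂ hM₂
  obtain ⟨δ, hδ, h⟩ := merHot_of_isPreconnected (C₀ := sphere 0 1) hV hQ hf hinj hP hY
    (isCompact_sphere _ _) (by simp)
    hG₀ hGQ hGP hD hDc (orn e M₂ (D y₂)) (fun y hy => exists_orn_pos e (hDi y hy) hn₂) hy₂ hy₁
    (M := M₂) (M' := M₁.comp (flipL F)) (mul_self_pos.2 hn₂)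
    (by rw [orn_comp_left, det_flipL]; linarith)
  set ε := min (min δ₁ δ₂) δ / 2 with hε
  have hpos : 0 < min (min δ₁ δ₂) δ := by positivity
  have hε0 : 0 < ε := by positivity
  have hεm : ε < min (min δ₁ δ₂) δ := by linarith
  have hεδ₁ : ε < δ₁ := hεm.trans_le ((min_le_left _ _).trans (min_le_left _ _))
  have hεδ₂ : ε < δ₂ := hεm.trans_le ((min_le_left _ _).trans (min_le_right _ _))
  have hεδ : ε < δ := hεm.trans_le (min_le_right _ _)
  have hflipS : Set.MapsTo (flipL F) (sphere 0 1) (sphere 0 1) := by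
    intro w hw
    simpa [flipL, Prod.norm_def] using hw
  have k₁ := (h₁ ε ⟨hε0, hεδ₁⟩).symm.comp (flipL F).continuous.continuousOn hflipS
  have k := ((h₂ ε ⟨hε0, hεδ₂⟩).trans (h ε ⟨hε0, hεδ⟩ ε ⟨hε0, hεδ⟩)).trans k₁
  have k' := k.comp (θ := fun w => w - (1, 0)) (C' := sphere ((1 : ℝ), (0 : F)) 1)
    (by fun_prop) (fun w hw => by simpa [dist_eq_norm] using hw)
  have hS : sphere ((1 : ℝ), (0 : F)) 1 ⊆ closedBall (1, 0) 1 := sphere_subset_closedBall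
  refine extend_box hYo hSC hB hA (hG.mono (hS.trans hsub₂)) ?_ (k'.congr ?_ ?_)
  · intro w hw
    refine hYb₂ w (hS hw) ?_
    rintro rfl
    simp at hw
  · intro w hw
    simp
  · intro w hw
    change G ((-1, 0) + flipL F (w - (1, 0))) = G (flip0 w)
    congr 1
    ext
    · simp only [flip0, flipL]; simp; try ring
    · simp [flip0, flipL]

end Box

theorem isPreconnected_ball_diff_countable {V : Type*} [NormedAddCommGroup V] [NormedSpace ℝ V]
    (hV : 1 < Module.rank ℝ V) (c : V) {r : ℝ} (hr : 0 < r) {S : Set V} (hS : S.Countable) :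
    IsPreconnected (ball c r \ S) := by
  set φ := OpenPartialHomeomorph.univBall c r
  have hinj : Function.Injective φ := by
    have := φ.injOn
    rwa [OpenPartialHomeomorph.univBall_source, Set.injOn_univ] at this
  have h := ((hS.preimage hinj).isConnected_compl_of_one_lt_rank hV).isPreconnected.image φ
    (OpenPartialHomeomorph.continuous_univBall c r).continuousOn
  convert h
  rw [← Set.preimage_compl, Set.image_preimage_eq_inter_range, ← Set.image_univ,
    ← OpenPartialHomeomorph.univBall_source c r, φ.image_source_eq_target,
    OpenPartialHomeomorph.univBall_target c hr, Set.sdiff_eq, Set.inter_comm]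

section Drag
variable {V : Type*} [NormedAddCommGroup V] [NormedSpace ℝ V] [FiniteDimensional ℝ V]

/-- `b` is reached from `a` by a homeomorphism supported in a compact part of `O`, which is a
translation near `a`. -/
def Drag (O : Set V) (a b : V) : Prop :=
  ∃ (h : V ≃ₜ V) (K : Set V), IsCompact K ∧ K ⊆ O ∧ (∀ x ∉ K, h x = x) ∧
    ∀ᶠ x in 𝓝 a, h x = x + (b - a)

theorem Drag.symm {O : Set V} {a b : V} (h : Drag O a b) : Drag O b a := by
  obtain ⟨h, K, hK, hKO, hid, ht⟩ := h
  refine ⟨h.symm, K, hK, hKO, fun x hx => ?_, ?_⟩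
  · rw [h.symm_apply_eq, hid x hx]
  · have hc : Filter.Tendsto (fun x => x + (a - b)) (𝓝 b) (𝓝 a) := by
      have : ContinuousAt (fun x => x + (a - b)) b := by fun_prop
      simpa [ContinuousAt] using this
    filter_upwards [hc.eventually ht] with x hx
    rw [h.symm_apply_eq, hx]; abel

theorem Drag.trans {O : Set V} {a b c : V} (h : Drag O a b) (h' : Drag O b c) : Drag O a c := by
  obtain ⟨h, K, hK, hKO, hid, ht⟩ := h
  obtain ⟨h', K', hK', hKO', hid', ht'⟩ := h'
  refine ⟨h.trans h', K ∪ K', hK.union hK', Set.union_subset hKO hKO', fun x hx => ?_, ?_⟩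
  · rw [Set.mem_union, not_or] at hx
    simp [hid x hx.1, hid' x hx.2]
  · have hc : Filter.Tendsto h (𝓝 a) (𝓝 b) := by
      have h1 : h a = b := by simpa using ht.self_of_nhds
      rw [← h1]; exact h.continuous.continuousAt
    filter_upwards [ht, hc.eventually ht'] with x hx hx'
    rw [Homeomorph.trans_apply, hx', hx]; abel

theorem drag_eventually {O : Set V} (hO : IsOpen O) {a : V} (ha : a ∈ O) :
    ∀ᶠ b in 𝓝 a, Drag O a b := by
  obtain ⟨r, hr, hrO⟩ := Metric.isOpen_iff.1 hO a ha
  refine Metric.eventually_nhds_iff_ball.2 ⟨r / 8, by positivity, fun b hb => ?_⟩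
  rw [mem_ball, dist_eq_norm] at hb
  set ρ : V → ℝ := fun x => max 0 (min 1 (2 - ‖x - a‖ * (4 / r))) with hρ
  have hρL : ∀ x y, |ρ x - ρ y| ≤ 4 / r * ‖x - y‖ := by
    intro x y
    have h1 : |ρ x - ρ y| ≤ |(2 - ‖x - a‖ * (4 / r)) - (2 - ‖y - a‖ * (4 / r))| := by
      refine (abs_max_sub_max_le_max _ _ _ _).trans ?_
      rw [sub_self, abs_zero, max_eq_right (abs_nonneg _)]
      refine (abs_min_sub_min_le_max _ _ _ _).trans ?_
      rw [sub_self, abs_zero, max_eq_right (abs_nonneg _)]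
    refine h1.trans ?_
    have h2 : (2 - ‖x - a‖ * (4 / r)) - (2 - ‖y - a‖ * (4 / r)) = 4 / r * (‖y - a‖ - ‖x - a‖) := by ring
    rw [h2, abs_mul, abs_of_pos (by positivity)]
    gcongr
    have := abs_norm_sub_norm_le (y - a) (x - a)
    rwa [sub_sub_sub_cancel_right, ← norm_sub_rev x y] at this
  have happ : ApproximatesLinearOn (fun x => x + ρ x • (b - a))
      ((ContinuousLinearEquiv.refl ℝ V : V ≃L[ℝ] V) : V →L[ℝ] V) Set.univ (1 / 2) := by
    intro x _ y _
    have : x + ρ x • (b - a) - (y + ρ y • (b - a)) - (x - y) = (ρ x - ρ y) • (b - a) := by module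
    simp only [ContinuousLinearEquiv.coe_refl, ContinuousLinearMap.id_apply]
    rw [this, norm_smul, Real.norm_eq_abs]
    calc |ρ x - ρ y| * ‖b - a‖ ≤ (4 / r * ‖x - y‖) * (r / 8) := by
          gcongr
          exact hρL x y
      _ = _ := by push_cast; field_simp; ring
  have hc : Subsingleton V ∨ ((1 / 2 : NNReal)) <
      ‖((ContinuousLinearEquiv.refl ℝ V).symm : V →L[ℝ] V)‖₊⁻¹ := by
    rcases subsingleton_or_nontrivial V with h | h
    · exact Or.inl h
    · right
      have : ‖((ContinuousLinearEquiv.refl ℝ V).symm : V →L[ℝ] V)‖₊ = 1 := by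
        rw [ContinuousLinearEquiv.refl_symm, ContinuousLinearEquiv.coe_refl]
        exact NNReal.eq ContinuousLinearMap.norm_id
      rw [this, inv_one]
      exact NNReal.half_lt_self one_ne_zero
  refine ⟨happ.toHomeomorph _ hc, closedBall a (r / 2), isCompact_closedBall _ _,
    (closedBall_subset_ball (by linarith)).trans hrO, fun x hx => ?_, ?_⟩
  · change x + ρ x • (b - a) = x
    have : ρ x = 0 := by
      rw [mem_closedBall, not_le, dist_eq_norm] at hx
      apply max_eq_left
      refine (min_le_right _ _).trans ?_
      rw [sub_nonpos, ← div_le_iff₀ (by positivity)]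
      convert hx.le using 1
      field_simp; try norm_num
    rw [this]; simp
  · filter_upwards [Metric.ball_mem_nhds a (show 0 < r / 4 by positivity)] with x hx
    change x + ρ x • (b - a) = _
    have : ρ x = 1 := by
      rw [mem_ball, dist_eq_norm] at hx
      have : ‖x - a‖ * (4 / r) ≤ 1 := by
        rw [← le_div_iff₀ (by positivity)]
        convert hx.le using 1
        field_simp
      simp only [hρ]
      rw [min_eq_left (by linarith), max_eq_right zero_le_one]
    rw [this, one_smul]

theorem drag_of_isPreconnected {O : Set V} (hO : IsOpen O) (hc : IsPreconnected O) {a b : V}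
    (ha : a ∈ O) (hb : b ∈ O) : Drag O a b :=
  hc.induction₂ (Drag O) (fun _ hx => (drag_eventually hO hx).filter_mono nhdsWithin_le_nhds)
    (fun _ _ _ _ _ _ => Drag.trans) (fun _ _ _ _ => Drag.symm) ha hb

end Drag

section
variable {F V W : Type*} [NormedAddCommGroup F] [NormedSpace ℝ F] [FiniteDimensional ℝ F]
  [NormedAddCommGroup V] [NormedSpace ℝ V] [FiniteDimensional ℝ V]
  [NormedAddCommGroup W] [NormedSpace ℝ W] [FiniteDimensional ℝ W]
  {e : (V × V) ≃L[ℝ] W} {f : V → W} {Q : Set V} {P Y : Set W}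

theorem orn_trans (e : (V × V) ≃L[ℝ] W) (A : F ≃L[ℝ] V) (M : V →L[ℝ] W) (D : V →L[ℝ] W) :
    orn ((A.prodCongr (.refl ℝ V)).trans e) (M.comp (A : F →L[ℝ] V)) D = orn e M D := by
  unfold orn ContinuousLinearMap.det
  rw [← LinearMap.det_conj _ (A.prodCongr (.refl ℝ V)).symm.toLinearEquiv]
  congr 1

theorem exists_thin_equiv (i : (ℝ × F) ≃L[ℝ] V) {v : V} (hv : v ≠ 0) {η : ℝ} (hη : 0 < η) :
    ∃ A : (ℝ × F) ≃L[ℝ] V, A (1, 0) = v ∧ ∀ u : F, ‖A (0, u)‖ ≤ η * ‖u‖ := by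
  have h0 : i (1, 0) ≠ 0 := by simp
  obtain ⟨B, hB⟩ := SeparatingDual.exists_continuousLinearEquiv_apply_eq (R := ℝ) h0 hv
  let T : (ℝ × F) →L[ℝ] V := (i.trans B : (ℝ × F) →L[ℝ] V)
  have hc : 0 < η / (‖T‖ + 1) := by positivity
  let S : (ℝ × F) ≃L[ℝ] (ℝ × F) := (ContinuousLinearEquiv.refl ℝ ℝ).prodCongr
    (ContinuousLinearEquiv.smulLeft (Units.mk0 _ hc.ne'))
  refine ⟨S.trans (i.trans B), ?_, fun u => ?_⟩
  · simp [S, hB]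
  · have : (S.trans (i.trans B)) (0, u) = (η / (‖T‖ + 1)) • T (0, u) := by
      simp [S, T, ← map_smul, Units.smul_def]
    rw [this, norm_smul, Real.norm_of_nonneg hc.le, div_mul_eq_mul_div, div_le_iff₀ (by positivity)]
    have h1 := T.le_opNorm (0, u)
    have h2 : ‖((0 : ℝ), u)‖ = ‖u‖ := by simp [Prod.norm_def]
    rw [h2] at h1
    nlinarith [norm_nonneg u]

/-- Two crossings of opposite sign of `g` with the sheet `f` can be removed by modifying `g` on a
compact set away from the other crossings. -/
theorem cancel_pair [Nontrivial F] (i : (ℝ × F) ≃L[ℝ] V) (hYo : IsOpen Y) (hSC : LoopsNull Y)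
    (hQ : IsCompact Q)
    (hf : ContinuousOn f Q) (hinj : Set.InjOn f Q)
    (hP : IsClosed P) (hY : ∀ w, w ∉ P → w ∉ f '' Q → w ∈ Y)
    {G₀ : Set V} (hG₀ : IsPreconnected G₀) (hGQ : G₀ ⊆ interior Q) (hGP : ∀ y ∈ G₀, f y ∉ P)
    {D : V → V →L[ℝ] W} (hD : ∀ y ∈ G₀, HasStrictFDerivAt f (D y) y) (hDc : ContinuousOn D G₀)
    (hDi : ∀ y ∈ G₀, Function.Injective (D y)) {y₁ y₂ : V} (hy₁ : y₁ ∈ G₀) (hy₂ : y₂ ∈ G₀)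
    {c : V} {r : ℝ} (hcQ : ball c r ⊆ Q) {Z : Set V} (hZ : Z.Finite) (hZU : Z ⊆ ball c r)
    {x₁ x₂ : V} (hx₁ : x₁ ∈ Z) (hx₂ : x₂ ∈ Z) (hne : x₁ ≠ x₂) {g : V → W}
    (hg : ContinuousOn g Q) (hgY : ∀ x ∈ Q, x ∉ Z → g x ∈ Y) (hg₁ : g x₁ = f y₁)
    (hg₂ : g x₂ = f y₂) {N₁ N₂ : V →L[ℝ] W} (hN₁ : HasFDerivAt g N₁ x₁)
    (hN₂ : HasFDerivAt g N₂ x₂) (ho : orn e N₁ (D y₁) * orn e N₂ (D y₂) < 0) :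
    ∃ (g' : V → W) (C : Set V), ContinuousOn g' Q ∧ IsCompact C ∧ C ⊆ ball c r ∧
      (∀ x ∉ C, g' x = g x) ∧ (∀ z ∈ Z, z ≠ x₁ → z ≠ x₂ → z ∉ C) ∧
      ∀ x ∈ Q, (x ∈ Z → x = x₁ ∨ x = x₂) → g' x ∈ Y := by
  have hr : 0 < r := by
    by_contra h
    have := hZU hx₁
    rw [ball_eq_empty.2 (not_lt.1 h)] at this
    exact this
  have hrank : 1 < Module.rank ℝ V := by
    rw [← Module.finrank_eq_rank, ← i.toLinearEquiv.finrank_eq, Module.finrank_prod,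
      Module.finrank_self]
    have : 0 < Module.finrank ℝ F := Module.finrank_pos
    exact_mod_cast (by omega : 1 < 1 + Module.finrank ℝ F)
  set O := ball c r \ (Z \ {x₁}) with hOdef
  have hO : IsOpen O := isOpen_ball.sdiff (hZ.subset Set.sdiff_subset).isClosed
  have hOc : IsPreconnected O :=
    isPreconnected_ball_diff_countable hrank c hr (hZ.subset Set.sdiff_subset).countable
  have hx₁O : x₁ ∈ O := ⟨hZU hx₁, fun h => h.2 rfl⟩
  obtain ⟨ρ, hρ, hρO⟩ := Metric.isOpen_iff.1
    (isOpen_ball.sdiff (hZ.subset (Set.sdiff_subset (t := {x₂}))).isClosed : IsOpen (ball c r \ (Z \ {x₂})))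
    x₂ ⟨hZU hx₂, fun h => h.2 rfl⟩
  have hVn : Nontrivial V := ⟨⟨x₁, x₂, hne⟩⟩
  obtain ⟨u, hu, hu0⟩ : ∃ u : V, ‖u‖ < ρ / 4 ∧ u ≠ 0 := by
    obtain ⟨u, hu⟩ := exists_ne (0 : V)
    have hn : 0 < ‖u‖ := norm_pos_iff.2 hu
    refine ⟨(ρ / 8 / ‖u‖) • u, ?_, smul_ne_zero (by positivity) hu⟩
    rw [norm_smul, Real.norm_of_nonneg (by positivity), div_mul_cancel₀ _ hn.ne']
    linarith
  set x₁' := x₂ - u with hx₁'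
  have hx₁'b : x₁' ∈ ball x₂ ρ := by
    rw [mem_ball, dist_eq_norm]; simp only [hx₁', sub_sub_cancel_left, norm_neg]; linarith
  have hx₁'Z : x₁' ∉ Z := fun h => (hρO hx₁'b).2 ⟨h, fun h' => hu0 (by
    have h'' : x₂ - u = x₂ := h'
    simpa using h'')⟩ 
  have hx₁'O : x₁' ∈ O := ⟨(hρO hx₁'b).1, fun h => hx₁'Z h.1⟩
  obtain ⟨h, K, hK, hKO, hid, htr⟩ := drag_of_isPreconnected hO hOc hx₁O hx₁'O
  have hidO : ∀ x ∉ O, h x = x := fun x hx => hid x fun hxK => hx (hKO hxK)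
  have hhx₁ : h x₁ = x₁' := by simpa using htr.self_of_nhds
  obtain ⟨A, hA1, hA2⟩ := exists_thin_equiv i (v := (1 / 2 : ℝ) • u) (by simpa using hu0)
    (show 0 < ρ / 4 by positivity)
  -- the affine chart sending `(-1, 0)` to `x₁'` and `(1, 0)` to `x₂`
  set β : (ℝ × F) ≃ₜ V := A.toHomeomorph.trans (Homeomorph.addLeft (x₂ - (1 / 2 : ℝ) • u)) with hβ
  have hβv : ∀ w, β w = x₂ - (1 / 2 : ℝ) • u + A w := fun w => rfl
  have hAw : ∀ w : ℝ × F, A w = w.1 • (1 / 2 : ℝ) • u + A (0, w.2) := by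
    intro w
    rw [← hA1, ← map_smul, ← map_add]
    simp
  have hβ2 : β (1, 0) = x₂ := by rw [hβv, hA1]; abel
  have hβ1 : β (-1, 0) = x₁' := by
    have : ((-1 : ℝ), (0 : F)) = -(1, 0) := by simp
    rw [hβv, this, map_neg, hA1, hx₁']; module
  set B : Set (ℝ × F) := {w | |w.1| ≤ 2 ∧ ‖w.2‖ ≤ 1} with hB
  have hβB : ∀ w ∈ B, β w ∈ ball x₂ ρ := by
    rintro w ⟨hw1, hw2⟩
    have h1 : β w - x₂ = (w.1 - 1) • (1 / 2 : ℝ) • u + A (0, w.2) := by rw [hβv, hAw]; module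
    rw [mem_ball, dist_eq_norm, h1]
    have h2 := hA2 w.2
    have h3 : |w.1 - 1| ≤ 3 := by rw [abs_le] at hw1 ⊢; constructor <;> linarith [hw1.1, hw1.2]
    have h4 : ‖(w.1 - 1) • (1 / 2 : ℝ) • u‖ ≤ 3 * (1 / 2 * ‖u‖) := by
      rw [norm_smul, norm_smul, Real.norm_eq_abs, Real.norm_of_nonneg (by norm_num : (0:ℝ) ≤ 1 / 2)]
      gcongr
    have h5 := norm_add_le ((w.1 - 1) • (1 / 2 : ℝ) • u) (A (0, w.2))
    nlinarith [norm_nonneg w.2]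
  set T : V ≃ₜ (ℝ × F) := h.trans β.symm with hT
  have hTs : ∀ w, T.symm w = h.symm (β w) := fun w => rfl
  have hx₂O : x₂ ∉ O := fun hx => hx.2 ⟨hx₂, fun h' => hne h'.symm⟩
  have hT2 : T.symm (1, 0) = x₂ := by rw [hTs, hβ2, h.symm_apply_eq, hidO x₂ hx₂O]
  have hT1 : T.symm (-1, 0) = x₁ := by rw [hTs, hβ1, h.symm_apply_eq, hhx₁]
  have hTU : ∀ w ∈ B, T.symm w ∈ ball c r := by
    intro w hw
    by_contra hn
    have h1 : T.symm w ∉ O := fun h' => hn h'.1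
    have h2 := hidO _ h1
    rw [hTs, h.apply_symm_apply] at h2
    rw [hTs, ← h2] at hn
    exact hn (hρO (hβB w hw)).1
  have hTZ : ∀ w ∈ B, T.symm w ∈ Z → w = (1, 0) ∨ w = (-1, 0) := by
    intro w hw hz
    by_cases h1 : T.symm w = x₁
    · right; apply T.symm.injective; rw [h1, hT1]
    · left
      have h2 : T.symm w ∉ O := fun h' => h'.2 ⟨hz, h1⟩
      have h3 := hidO _ h2
      rw [hTs, h.apply_symm_apply] at h3
      by_contra hne'
      refine (hρO (hβB w hw)).2 ⟨by rw [h3]; exact hz, fun h4 => hne' (β.injective ?_)⟩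
      rw [hβ2]; exact h4
  have hAd : ∀ p, HasFDerivAt β (A : (ℝ × F) →L[ℝ] V) p := fun p =>
    (A.hasFDerivAt (x := p)).const_add (x₂ - (1 / 2 : ℝ) • u)
  have hTd2 : HasFDerivAt T.symm (A : (ℝ × F) →L[ℝ] V) (1, 0) := by
    refine (hAd _).congr_of_eventuallyEq ?_
    have hKn : ∀ᶠ x in 𝓝 (β (1, 0)), x ∉ K :=
      hK.isClosed.isOpen_compl.mem_nhds (by rw [hβ2]; exact fun h' => hx₂O (hKO h'))
    filter_upwards [β.continuous.continuousAt.eventually hKn] with w hw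
    rw [hTs, h.symm_apply_eq, hid _ hw]
  have hTd1 : HasFDerivAt T.symm (A : (ℝ × F) →L[ℝ] V) (-1, 0) := by
    refine ((hAd (-1, 0)).add_const (x₁ - x₁')).congr_of_eventuallyEq ?_
    have hc : Filter.Tendsto (fun w => β w + (x₁ - x₁')) (𝓝 (-1, 0)) (𝓝 x₁) := by
      have : ContinuousAt (fun w => β w + (x₁ - x₁')) (-1, 0) :=
        (β.continuous.add continuous_const).continuousAt
      simpa [ContinuousAt, hβ1] using this
    filter_upwards [hc.eventually htr] with w hw
    rw [hTs, h.symm_apply_eq, hw]; abel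
  obtain ⟨G', hG'c, hG'Y, hG'e⟩ := cancel_box (F := F) (e := (A.prodCongr (.refl ℝ V)).trans e)
    hYo hSC hQ hf hinj hP hY hG₀ hGQ hGP hD hDc hDi hy₁ hy₂
    (M₁ := N₁.comp (A : (ℝ × F) →L[ℝ] V)) (M₂ := N₂.comp (A : (ℝ × F) →L[ℝ] V))
    (by rwa [orn_trans, orn_trans]) hB rfl (G := g ∘ T.symm)
    (hg.comp T.symm.continuous.continuousOn fun w hw => hcQ (hTU w hw))
    (fun w hw hw1 hw2 => hgY _ (hcQ (hTU w hw)) fun hz => by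
      rcases hTZ w hw hz with h' | h'
      exacts [hw1 h', hw2 h'])
    (by simp only [Function.comp_apply, hT1, hg₁]) (by simp only [Function.comp_apply, hT2, hg₂])
    (HasFDerivAt.comp _ (by rwa [hT1]) hTd1) (HasFDerivAt.comp _ (by rwa [hT2]) hTd2)
  have hBc : IsClosed B := by
    rw [hB]
    exact (isClosed_le (continuous_fst.abs) continuous_const).inter
      (isClosed_le (continuous_snd.norm) continuous_const)
  have hBK : IsCompact B := by
    have : B = closedBall 0 2 ×ˢ closedBall 0 1 := by
      ext w; simp [hB]
    rw [this]
    exact (isCompact_closedBall _ _).prod (isCompact_closedBall _ _)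
  classical
  refine ⟨fun x => if T x ∈ B then G' (T x) else g x, T ⁻¹' B, ?_, ?_, ?_, ?_, ?_, ?_⟩
  · have hcl : IsClosed {w : ℝ × F | 2 ≤ |w.1| ∨ 1 ≤ ‖w.2‖} := by
      exact (isClosed_le continuous_const (continuous_fst.abs)).union
        (isClosed_le continuous_const (continuous_snd.norm))
    have h1 : ContinuousOn (fun x => if T x ∈ B then G' (T x) else g x) (Q ∩ T ⁻¹' B) :=
      ((hG'c.comp T.continuous.continuousOn fun x hx => hx).mono Set.inter_subset_right).congr
        fun x hx => if_pos hx.2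
    have h2 : ContinuousOn (fun x => if T x ∈ B then G' (T x) else g x)
        (Q ∩ T ⁻¹' {w : ℝ × F | 2 ≤ |w.1| ∨ 1 ≤ ‖w.2‖}) := by
      refine (hg.mono Set.inter_subset_left).congr fun x hx => ?_
      by_cases hxB : T x ∈ B
      · simp only [hxB, if_true]
        rw [hG'e ⟨hxB.1, hxB.2, hx.2.imp (fun h' => le_antisymm hxB.1 h')
          (fun h' => le_antisymm hxB.2 h')⟩]
        simp
      · simp [hxB]
    have h3 := h1.union_of_isClosed h2 (hQ.isClosed.inter (hBc.preimage T.continuous))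
      (hQ.isClosed.inter (hcl.preimage T.continuous))
    refine h3.mono fun x hx => ?_
    by_cases hxB : T x ∈ B
    · exact Or.inl ⟨hx, hxB⟩
    · refine Or.inr ⟨hx, ?_⟩
      by_contra hn
      simp only [Set.mem_preimage, Set.mem_ofPred_eq, not_or, not_le] at hn
      exact hxB ⟨hn.1.le, hn.2.le⟩
  · have := hBK.image T.symm.continuous
    rwa [T.symm.image_eq_preimage_symm] at this
  · intro x hx
    have := hTU (T x) hx
    rwa [T.symm_apply_apply] at this
  · intro x hx
    exact if_neg hx
  · intro z hz h1 h2 hzB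
    rcases hTZ (T z) hzB (by rwa [T.symm_apply_apply]) with h' | h'
    · exact h2 (by rw [← hT2, ← h', T.symm_apply_apply])
    · exact h1 (by rw [← hT1, ← h', T.symm_apply_apply])
  · intro x hx hxZ
    by_cases hxB : T x ∈ B
    · simp only [hxB, if_true]
      exact hG'Y hxB
    · simp only [hxB, if_false]
      refine hgY x hx fun hz => hxB ?_
      rcases hxZ hz with rfl | rfl
      · rw [← hT1, T.apply_symm_apply]; norm_num [hB]
      · rw [← hT2, T.apply_symm_apply]; norm_num [hB]

end

section
variable {F V W J : Type*} [NormedAddCommGroup F] [NormedSpace ℝ F] [FiniteDimensional ℝ F]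
  [NormedAddCommGroup V] [NormedSpace ℝ V] [FiniteDimensional ℝ V]
  [NormedAddCommGroup W] [NormedSpace ℝ W] [FiniteDimensional ℝ W]
  {e : (V × V) ≃L[ℝ] W} {f : J → V → W} {Q : Set V} {P Y : Set W}

theorem exists_opposite_sign {α : Type*} {s : Finset α} {a : α → ℝ} (h0 : ∀ x ∈ s, a x ≠ 0)
    (hs : ∑ x ∈ s, (SignType.sign (a x) : ℤ) = 0) {x : α} (hx : x ∈ s) :
    ∃ y ∈ s, a x * a y < 0 := by
  by_contra! hn
  have h1 : ∑ y ∈ s, (SignType.sign (a x) : ℤ) * (SignType.sign (a y) : ℤ) = 0 := by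
    rw [← Finset.mul_sum, hs, mul_zero]
  have h2 : ∀ y ∈ s, (SignType.sign (a x) : ℤ) * (SignType.sign (a y) : ℤ) = 1 := by
    intro y hy
    have h3 : 0 < a x * a y := lt_of_le_of_ne (hn y hy) (mul_ne_zero (h0 x hx) (h0 y hy)).symm
    have := sign_pos h3
    rw [sign_mul] at this
    rw [← SignType.coe_mul, this]; rfl
  rw [Finset.sum_congr rfl h2] at h1
  simp only [Finset.sum_const, nsmul_eq_mul, mul_one, Nat.cast_eq_zero, Finset.card_eq_zero] at h1
  simp [h1] at hx

theorem cancel_all [Nontrivial F] [Finite J] [DecidableEq J] (i : (ℝ × F) ≃L[ℝ] V) (hYo : IsOpen Y)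
    (hSC : LoopsNull Y) (hQ : IsCompact Q) (hf : ∀ j, ContinuousOn (f j) Q)
    (hinj : ∀ j, Set.InjOn (f j) Q) (hP : IsClosed P)
    (hY : ∀ w, w ∉ P → (∀ j, w ∉ f j '' Q) → w ∈ Y) {G : J → Set V}
    (hG : ∀ j, IsPreconnected (G j)) (hGQ : ∀ j, G j ⊆ interior Q)
    (hGP : ∀ j, ∀ y ∈ G j, f j y ∉ P ∧ ∀ j', j' ≠ j → f j y ∉ f j' '' Q)
    {D : J → V → V →L[ℝ] W} (hD : ∀ j, ∀ y ∈ G j, HasStrictFDerivAt (f j) (D j y) y)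
    (hDc : ∀ j, ContinuousOn (D j) (G j)) (hDi : ∀ j, ∀ y ∈ G j, Function.Injective (D j y))
    {c : V} {r : ℝ} (hcQ : ball c r ⊆ Q) {l : V → J} {y : V → V} {N : V → V →L[ℝ] W} :
    ∀ (Z : Finset V) (g : V → W), (↑Z ⊆ ball c r) → ContinuousOn g Q →
    (∀ x ∈ Q, x ∉ Z → g x ∈ Y) → (∀ x ∈ Z, y x ∈ G (l x) ∧ g x = f (l x) (y x) ∧
      HasFDerivAt g (N x) x ∧ orn e (N x) (D (l x) (y x)) ≠ 0) →
    (∀ j, ∑ x ∈ Z with l x = j, (SignType.sign (orn e (N x) (D (l x) (y x))) : ℤ) = 0) →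
    ∃ (g' : V → W) (C : Set V), ContinuousOn g' Q ∧ IsCompact C ∧ C ⊆ ball c r ∧
      (∀ x ∉ C, g' x = g x) ∧ Set.MapsTo g' Q Y := by
  classical
  intro Z
  induction Z using Finset.strongInduction with
  | H Z ih =>
  intro g hZU hg hgY hZ hs
  rcases Z.eq_empty_or_nonempty with rfl | ⟨x₁, hx₁⟩
  · exact ⟨g, ∅, hg, isCompact_empty, Set.empty_subset _, fun _ _ => rfl,
      fun x hx => hgY x hx (Finset.notMem_empty x)⟩
  obtain ⟨x₂, hx₂, ho⟩ := exists_opposite_sign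
    (s := {x ∈ Z | l x = l x₁}) (a := fun x => orn e (N x) (D (l x) (y x)))
    (fun x hx => (hZ x (Finset.mem_filter.1 hx).1).2.2.2) (hs (l x₁))
    (Finset.mem_filter.2 ⟨hx₁, rfl⟩)
  obtain ⟨hx₂, hl⟩ := Finset.mem_filter.1 hx₂
  have hne : x₁ ≠ x₂ := by
    rintro rfl
    exact absurd ho (not_lt.2 (mul_self_nonneg _))
  obtain ⟨hy₁, hg₁, hN₁, -⟩ := hZ x₁ hx₁
  obtain ⟨hy₂, hg₂, hN₂, -⟩ := hZ x₂ hx₂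
  simp only [hl] at hy₂ hg₂ ho
  obtain ⟨g₁, C₁, hg₁c, hC₁, hC₁U, he₁, hz₁, hY₁⟩ := cancel_pair (e := e) i hYo hSC hQ
    (hf (l x₁)) (hinj (l x₁))
    (P := P ∪ ⋃ j : {j // j ≠ l x₁}, f j '' Q)
    (hP.union (isClosed_iUnion_of_finite fun j => (hQ.image_of_continuousOn (hf j)).isClosed))
    (fun w hw hw' => hY w (fun h => hw (Or.inl h)) fun j => by
      by_cases hj : j = l x₁
      · rwa [hj]
      · exact fun h => hw (Or.inr (Set.mem_iUnion.2 ⟨⟨j, hj⟩, h⟩)))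
    (hG (l x₁)) (hGQ _) (fun y hy h => by
      rcases h with h | h
      · exact (hGP _ y hy).1 h
      · obtain ⟨j, hj⟩ := Set.mem_iUnion.1 h
        exact (hGP _ y hy).2 j j.2 hj)
    (hD _) (hDc _) (hDi _) hy₁ hy₂ hcQ Z.finite_toSet hZU hx₁ hx₂ hne hg hgY hg₁ hg₂ hN₁ hN₂ ho
  have hsub : Z \ {x₁, x₂} ⊂ Z := Finset.ssubset_iff_subset_ne.2
    ⟨Finset.sdiff_subset, fun h => by
      have := h ▸ hx₁
      simp at this⟩
  have hmem : ∀ x ∈ Z \ {x₁, x₂}, x ∈ Z ∧ x ∉ C₁ := by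
    intro x hx
    simp only [Finset.mem_sdiff, Finset.mem_insert, Finset.mem_singleton, not_or] at hx
    exact ⟨hx.1, hz₁ x hx.1 hx.2.1 hx.2.2⟩
  obtain ⟨g', C', hg'c, hC', hC'U, he', hY'⟩ := ih _ hsub g₁
    (fun x hx => hZU (hmem x hx).1) hg₁c
    (fun x hx hxn => hY₁ x hx fun hxZ => by
      by_contra! h
      exact hxn (by simp [h.1, h.2, Finset.mem_coe.1 hxZ]))
    (fun x hx => by
      obtain ⟨hxZ, hxC⟩ := hmem x hx
      obtain ⟨h1, h2, h3, h4⟩ := hZ x hxZ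
      refine ⟨h1, by rw [he₁ x hxC, h2], h3.congr_of_eventuallyEq ?_, h4⟩
      filter_upwards [hC₁.isClosed.isOpen_compl.mem_nhds hxC] with w hw using he₁ w hw)
    (fun j => by
      have h1 := hs j
      by_cases hj : j = l x₁
      · subst hj
        have hf1 : ({x ∈ Z \ {x₁, x₂} | l x = l x₁} : Finset V) =
            ({x ∈ Z | l x = l x₁} : Finset V) \ {x₁, x₂} := by
          ext x; simp; tauto
        have hsb : ({x₁, x₂} : Finset V) ⊆ ({x ∈ Z | l x = l x₁} : Finset V) := by
          intro x hx
          simp only [Finset.mem_insert, Finset.mem_singleton] at hx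
          rcases hx with rfl | rfl <;> simp [hx₁, hx₂, hl]
        rw [← Finset.sum_sdiff hsb, Finset.sum_pair hne] at h1
        rw [hf1]
        have h2 : (SignType.sign (orn e (N x₁) (D (l x₁) (y x₁))) : ℤ) +
            (SignType.sign (orn e (N x₂) (D (l x₂) (y x₂))) : ℤ) = 0 := by
          rw [hl]
          rcases mul_neg_iff.1 ho with ⟨ha, hb⟩ | ⟨ha, hb⟩
          · rw [sign_pos ha, sign_neg hb]; rfl
          · rw [sign_neg ha, sign_pos hb]; rfl
        linarith
      · have : ({x ∈ Z \ {x₁, x₂} | l x = j} : Finset V) = {x ∈ Z | l x = j} := by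
          ext x
          simp only [Finset.mem_filter, Finset.mem_sdiff, Finset.mem_insert,
            Finset.mem_singleton, not_or]
          constructor
          · rintro ⟨⟨h, -⟩, h'⟩
            exact ⟨h, h'⟩
          · rintro ⟨h, rfl⟩
            refine ⟨⟨h, ?_, ?_⟩, rfl⟩
            · rintro rfl; exact hj rfl
            · rintro rfl; exact hj hl
        rw [this]; exact h1)
  refine ⟨g', C₁ ∪ C', hg'c, hC₁.union hC', Set.union_subset hC₁U hC'U, fun x hx => ?_, hY'⟩
  rw [he' x fun h => hx (Or.inr h), he₁ x fun h => hx (Or.inl h)]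

end

section
variable {V W ι : Type*} [NormedAddCommGroup V] [NormedSpace ℝ V] [FiniteDimensional ℝ V]
  [NormedAddCommGroup W] [NormedSpace ℝ W] [FiniteDimensional ℝ W]

theorem dense_compl_iUnion_range [Countable ι] {f : ι → V → W} (hf : ∀ i, ContDiff ℝ 1 (f i))
    (h : Module.finrank ℝ V < Module.finrank ℝ W) : Dense (⋃ i, Set.range (f i))ᶜ := by
  refine _root_.dense_compl_of_dimH_lt_finrank ?_
  rw [dimH_iUnion]
  exact (iSup_le fun i => (hf i).dimH_range_le).trans_lt (by exact_mod_cast h)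

/-- The four sides of the unit square. -/
def side (k : Bool × Bool) (t : ℝ) : ℝ × ℝ :=
  if k.1 then (t, if k.2 then 1 else 0) else (if k.2 then 1 else 0, t)

theorem contDiff_side (k : Bool × Bool) : ContDiff ℝ 1 (side k) := by
  rcases k with ⟨(_ | _), (_ | _)⟩ <;> unfold side <;> dsimp only <;> (try simp only [if_true, Bool.false_eq_true, if_false]) <;> fun_prop

theorem exists_thickening_subset {X : Type*} [TopologicalSpace X] {A : Set X} {φ : X → W}
    {Y : Set W} (hA : IsCompact A) (hφ : ContinuousOn φ A) (hY : IsOpen Y)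
    (hφY : Set.MapsTo φ A Y) : ∃ δ > 0, ∀ x ∈ A, ball (φ x) δ ⊆ Y := by
  obtain ⟨δ, hδ, h⟩ := (hA.image_of_continuousOn hφ).exists_thickening_subset_open hY
    hφY.image_subset
  refine ⟨δ, hδ, fun x hx => (ball_subset_thickening (Set.mem_image_of_mem φ hx) δ).trans h⟩

theorem loopsNull_of_compl_subset [Countable ι] {Y : Set W} (hY : IsOpen Y) {f : ι → V → W}
    (hf : ∀ i, ContDiff ℝ 1 (f i)) (hd : Module.finrank ℝ V + 2 < Module.finrank ℝ W)
    (hc : ∀ w, (∀ i y, f i y ≠ w) → w ∈ Y) : LoopsNull Y := by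
  intro γ hγ hγY h01
  set S : Set (ℝ × ℝ) := Set.Icc 0 1 ×ˢ Set.Icc 0 1 with hS
  have hSK : IsCompact S := isCompact_Icc.prod isCompact_Icc
  set A : Set (ℝ × ℝ) := S ∩ {p | p.1 = 0 ∨ p.1 = 1 ∨ p.2 = 0 ∨ p.2 = 1} with hA
  have hAc : IsClosed A := by
    refine hSK.isClosed.inter ?_
    exact (isClosed_eq continuous_fst continuous_const).union
      ((isClosed_eq continuous_fst continuous_const).union
      ((isClosed_eq continuous_snd continuous_const).union
      (isClosed_eq continuous_snd continuous_const)))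
  have hAK : IsCompact A := hSK.of_isClosed_subset hAc Set.inter_subset_left
  let γ' : ℝ → W := Set.IccExtend (zero_le_one (α := ℝ)) ((Set.Icc (0:ℝ) 1).domRestrict γ)
  have hγ' : Continuous γ' := (hγ.domRestrict).Icc_extend'
  have hγe : ∀ t ∈ Set.Icc (0:ℝ) 1, γ' t = γ t := fun t ht => by
    simp [γ', Set.IccExtend_of_mem _ _ ht]
  let Γ₀ : ℝ × ℝ → W := fun p => γ 0 + (1 - p.2) • (γ' p.1 - γ 0)
  have hΓ₀ : Continuous Γ₀ := by fun_prop
  have hb0 : ∀ t ∈ Set.Icc (0:ℝ) 1, Γ₀ (t, 0) = γ t := fun t ht => by simp [Γ₀, hγe t ht]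
  have hb1 : ∀ t, Γ₀ (t, 1) = γ 0 := fun t => by simp [Γ₀]
  have hb2 : ∀ t, Γ₀ (0, t) = γ 0 := fun t => by simp [Γ₀, hγe 0 (by simp)]
  have hb3 : ∀ t, Γ₀ (1, t) = γ 0 := fun t => by simp [Γ₀, hγe 1 (by simp), h01]
  have hΓY : Set.MapsTo Γ₀ A Y := by
    rintro ⟨s, t⟩ ⟨⟨hs, ht⟩, h⟩
    have hY0 : γ 0 ∈ Y := hγY (by simp)
    rcases h with h | h | h | h <;> simp only at h <;> subst h
    · rwa [hb2]
    · rwa [hb3]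
    · rw [hb0 _ hs]; exact hγY hs
    · rwa [hb1]
  obtain ⟨δ, hδ, hδY⟩ := exists_thickening_subset hAK hΓ₀.continuousOn hY hΓY
  obtain ⟨φ, hφ, hφd, -⟩ := hΓ₀.exists_contDiff_approx 1 (ε := fun _ => δ) continuous_const
    fun _ => hδ
  let Ψ : ι × (Bool × Bool) → V × ℝ × ℝ → W := fun k q =>
    q.2.1 • f k.1 q.1 + (1 - q.2.1) • φ (side k.2 q.2.2)
  have hΨ : ∀ k, ContDiff ℝ 1 (Ψ k) := by
    intro k
    have h1 := hf k.1
    have h2 : ContDiff ℝ 1 (fun t => φ (side k.2 t)) := hφ.comp (contDiff_side _)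
    have h3 : ContDiff ℝ 1 (fun q : V × ℝ × ℝ => φ (side k.2 q.2.2)) :=
      h2.comp (contDiff_snd.comp contDiff_snd)
    have h4 : ContDiff ℝ 1 (fun q : V × ℝ × ℝ => f k.1 q.1) := h1.comp contDiff_fst
    have h5 : ContDiff ℝ 1 (fun q : V × ℝ × ℝ => q.2.1) := contDiff_fst.comp contDiff_snd
    exact (h5.smul h4).add ((contDiff_const.sub h5).smul h3)
  obtain ⟨a, ha⟩ := (dense_compl_iUnion_range hΨ
    (by simpa [Module.finrank_prod] using hd)).nonempty
  have ha' : ∀ i y, ∀ p ∈ A, ∀ t ∈ Set.Ico (0:ℝ) 1, f i y ≠ (1 - t) • a + t • φ p := by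
    intro i y p hp t ht he
    apply ha
    obtain ⟨k, s, hk⟩ : ∃ k s, side k s = p := by
      obtain ⟨p1, p2⟩ := p
      rcases hp.2 with h | h | h | h <;> simp only at h <;> subst h
      exacts [⟨(false, false), p2, by simp [side]⟩, ⟨(false, true), p2, by simp [side]⟩,
        ⟨(true, false), p1, by simp [side]⟩, ⟨(true, true), p1, by simp [side]⟩]
    refine Set.mem_iUnion.2 ⟨(i, k), (y, (1 - t)⁻¹, s), ?_⟩
    have h1 : (1 - t) ≠ 0 := by linarith [ht.2]
    simp only [Ψ, hk, he, smul_add, smul_smul, inv_mul_cancel₀ h1, one_smul]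
    rw [add_assoc, ← add_smul]
    have : (1 - t)⁻¹ * t + (1 - (1 - t)⁻¹) = 0 := by field_simp; ring
    rw [this, zero_smul, add_zero]
  have hAne : ((0, 0) : ℝ × ℝ) ∈ A := by simp [hA, hS]
  have hK1 : Hot A Y (fun _ => a) φ := by
    refine ⟨fun q => (1 - q.2) • a + q.2 • φ q.1, ?_, ?_, fun w _ => by simp, fun w _ => by simp⟩
    · have := hφ.continuous
      exact Continuous.continuousOn (by fun_prop)
    · rintro ⟨p, t⟩ ⟨hp, ht⟩
      rcases ht.2.lt_or_eq with h | h
      · exact hc _ fun i y => ha' i y p hp t ⟨ht.1, h⟩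
      · simp only at h
        subst h
        have := hδY p hp (mem_ball.2 (hφd p))
        simpa using this
  have hK2 : Hot A Y φ Γ₀ := by
    refine ⟨fun q => (1 - q.2) • φ q.1 + q.2 • Γ₀ q.1, ?_, ?_, fun w _ => by simp,
      fun w _ => by simp⟩
    · have := hφ.continuous
      exact Continuous.continuousOn (by fun_prop)
    · rintro ⟨p, t⟩ ⟨hp, ht⟩
      exact hδY p hp ((convex_ball (Γ₀ p) δ) (mem_ball.2 (hφd p)) (mem_ball_self hδ)
        (by linarith [ht.2]) ht.1 (by simp))
  have haY : a ∈ Y := hc _ fun i y => by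
    have := ha' i y _ hAne 0 (by simp)
    simpa using this
  obtain ⟨Γ, hΓc, hΓY', hΓe⟩ := (hK1.trans hK2).extend hSK hAc hY
    (continuousOn_const (c := a)) (fun _ _ => haY) (fun _ _ => rfl)
  refine ⟨Γ, hΓc, hΓY', fun t ht => ?_, fun t ht => ⟨?_, ?_, ?_⟩⟩
  · rw [hΓe ⟨⟨ht, by simp⟩, by simp⟩, hb0 t ht]
  · rw [hΓe ⟨⟨ht, by simp⟩, by simp⟩, hb1]
  · rw [hΓe ⟨⟨by simp, ht⟩, by simp⟩, hb2]
  · rw [hΓe ⟨⟨by simp, ht⟩, by simp⟩, hb3]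

end

section
variable {V W ι : Type*} [NormedAddCommGroup V] [NormedSpace ℝ V] [FiniteDimensional ℝ V]
  [NormedAddCommGroup W] [NormedSpace ℝ W] [FiniteDimensional ℝ W]
  {e : (V × V) ≃L[ℝ] W}

theorem orn_ne_zero_iff {M D : V →L[ℝ] W} :
    orn e M D ≠ 0 ↔ ∀ u v, M u + D v = 0 → u = 0 ∧ v = 0 := by
  unfold orn ContinuousLinearMap.det
  rw [Ne, LinearMap.det_eq_zero_iff_ker_ne_bot, not_not, LinearMap.ker_eq_bot']
  constructor
  · intro h u v huv
    have := h (u, v) (by simp [huv])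
    simpa using this
  · rintro h ⟨u, v⟩ huv
    simp only [ContinuousLinearMap.coe_coe, ContinuousLinearMap.comp_apply,
      ContinuousLinearEquiv.coe_coe, ContinuousLinearMap.coprod_apply] at huv
    obtain ⟨rfl, rfl⟩ := h u v (e.symm.injective (by simpa using huv))
    rfl

theorem coincidence_isolated {f g : V → W} {M D : V →L[ℝ] W} {x y : V} (hf : HasFDerivAt f M x)
    (hg : HasFDerivAt g D y) (ho : orn e M D ≠ 0) :
    ∀ᶠ p in 𝓝[≠] (x, y), f p.1 ≠ g p.2 := by
  have h1 : HasFDerivAt (fun p : V × V => f p.1 - g p.2)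
      (M.comp (.fst ℝ V V) - D.comp (.snd ℝ V V)) (x, y) :=
    (HasFDerivAt.comp (x, y) hf hasFDerivAt_fst).sub (HasFDerivAt.comp (x, y) hg hasFDerivAt_snd)
  have h2 : LinearMap.ker ((M.comp (.fst ℝ V V) - D.comp (.snd ℝ V V) : (V × V) →L[ℝ] W) :
      (V × V) →ₗ[ℝ] W) = ⊥ := by
    rw [LinearMap.ker_eq_bot']
    rintro ⟨u, v⟩ h
    have h3 : M u + D (-v) = 0 := by simpa [sub_eq_add_neg] using h
    obtain ⟨rfl, hv⟩ := orn_ne_zero_iff.1 ho _ _ h3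
    simpa using hv
  obtain ⟨K, -, hK⟩ := LinearMap.exists_antilipschitzWith _ h2
  filter_upwards [h1.eventually_ne (c := 0) ⟨K, hK⟩] with p hp h
  exact hp (sub_eq_zero.2 h)

theorem discreteTopology_coincidences {f g : V → W} {M D : V → V →L[ℝ] W} {S : Set (V × V)}
    (hf : ∀ p ∈ S, HasFDerivAt f (M p.1) p.1) (hg : ∀ p ∈ S, HasFDerivAt g (D p.2) p.2)
    (ho : ∀ p ∈ S, f p.1 = g p.2 → orn e (M p.1) (D p.2) ≠ 0) :
    DiscreteTopology {p ∈ S | f p.1 = g p.2} := by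
  rw [discreteTopology_subtype_iff]
  rintro p ⟨hp, he⟩
  refine Disjoint.eq_bot (Filter.disjoint_principal_right.2 ?_)
  filter_upwards [coincidence_isolated (hf p hp) (hg p hp) (ho p hp he)] with q hq h
  exact hq h.2

theorem countable_coincidences {f g : V → W} {M D : V → V →L[ℝ] W} {S : Set (V × V)}
    (hf : ∀ p ∈ S, HasFDerivAt f (M p.1) p.1) (hg : ∀ p ∈ S, HasFDerivAt g (D p.2) p.2)
    (ho : ∀ p ∈ S, f p.1 = g p.2 → orn e (M p.1) (D p.2) ≠ 0) :
    {p ∈ S | f p.1 = g p.2}.Countable :=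
  have := discreteTopology_coincidences hf hg ho
  (HereditarilyLindelofSpace.isLindelof _).countable this

/-- Sard: a small multiple of a bump function moves `f` so that it meets countably many given
maps transversally. -/
theorem exists_transverse [Countable ι] {f : V → W} {g : ι → V → W} {χ : V → ℝ} {U : Set V}
    (hU : IsOpen U) (hχ : ContDiff ℝ 1 χ) (hχU : ∀ x ∈ U, χ x ≠ 0) (hf : ContDiff ℝ 1 f)
    (hg : ∀ i, ContDiff ℝ 1 (g i)) {δ : ℝ} (hδ : 0 < δ) :
    ∃ v : W, ‖v‖ < δ ∧ ∀ i, ∀ x ∈ U, ∀ y, f x + χ x • v = g i y →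
      orn e (fderiv ℝ (fun x => f x + χ x • v) x) (fderiv ℝ (g i) y) ≠ 0 := by
  let Θ : ι → W → W := fun i w =>
    (χ (e.symm w).1)⁻¹ • (g i (e.symm w).2 - f (e.symm w).1)
  let O : Set W := {w | (e.symm w).1 ∈ U}
  have hΘ : ∀ i, ∀ w ∈ O, DifferentiableAt ℝ (Θ i) w := by
    intro i w hw
    have h1 : DifferentiableAt ℝ (fun w : W => (e.symm w).1) w := by fun_prop
    have h2 : DifferentiableAt ℝ (fun w : W => (e.symm w).2) w := by fun_prop
    have h3 : DifferentiableAt ℝ (fun w : W => χ (e.symm w).1) w :=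
      (hχ.differentiable (by simp) _).comp w h1
    exact (h3.inv (hχU _ hw)).smul (((hg i).differentiable (by simp) _).comp w h2 |>.sub
      ((hf.differentiable (by simp) _).comp w h1))
  let _ : MeasurableSpace W := borel W
  have _ : BorelSpace W := ⟨rfl⟩
  let μ : MeasureTheory.Measure W := MeasureTheory.Measure.addHaar
  have hnull : ∀ i, μ (Θ i '' {w ∈ O | (fderiv ℝ (Θ i) w).det = 0}) = 0 := fun i =>
    MeasureTheory.addHaar_image_eq_zero_of_det_fderivWithin_eq_zero μ
      (fun w hw => (hΘ i w hw.1).hasFDerivAt.hasFDerivWithinAt) (fun w hw => hw.2)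
  have hd : Dense {v : W | v ∉ ⋃ i, Θ i '' {w ∈ O | (fderiv ℝ (Θ i) w).det = 0}} := by
    refine MeasureTheory.Measure.dense_of_ae (μ := μ) ?_
    exact MeasureTheory.measure_eq_zero_iff_ae_notMem.1 (MeasureTheory.measure_iUnion_null hnull)
  obtain ⟨v, hv, hvδ⟩ := hd.exists_dist_lt 0 hδ
  refine ⟨v, by simpa using hvδ, fun i x hx y hxy => ?_⟩
  have hw : e (x, y) ∈ O := by simpa [O] using hx
  have hΘv : Θ i (e (x, y)) = v := by
    simp only [Θ, e.symm_apply_apply, ← hxy, add_sub_cancel_left, smul_smul]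
    rw [inv_mul_cancel₀ (hχU x hx), one_smul]
  have hdet : (fderiv ℝ (Θ i) (e (x, y))).det ≠ 0 := fun h0 =>
    hv (Set.mem_iUnion.2 ⟨i, e (x, y), ⟨hw, h0⟩, hΘv⟩)
  have hinj : ∀ w, fderiv ℝ (Θ i) (e (x, y)) w = 0 → w = 0 := by
    unfold ContinuousLinearMap.det at hdet
    rw [Ne, LinearMap.det_eq_zero_iff_ker_ne_bot, not_not, LinearMap.ker_eq_bot'] at hdet
    exact hdet
  have hfx := hf.differentiable (by simp) x
  have hχx := hχ.differentiable (by simp) x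
  have hgy := (hg i).differentiable (by simp) y
  have hOo : O ∈ 𝓝 (e (x, y)) :=
    (hU.preimage (continuous_fst.comp e.symm.continuous)).mem_nhds hw
  have hA : HasFDerivAt (fun w : W => χ (e.symm w).1 • Θ i w)
      (χ x • fderiv ℝ (Θ i) (e (x, y)) +
        ((fderiv ℝ χ x).comp ((ContinuousLinearMap.fst ℝ V V).comp
          (e.symm : W →L[ℝ] V × V))).smulRight v) (e (x, y)) := by
    have h1 : HasFDerivAt (fun w : W => χ (e.symm w).1)
        ((fderiv ℝ χ x).comp ((ContinuousLinearMap.fst ℝ V V).comp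
          (e.symm : W →L[ℝ] V × V))) (e (x, y)) := by
      refine HasFDerivAt.comp (e (x, y)) (g := χ) (f := fun w => (e.symm w).1) ?_
        (((ContinuousLinearMap.fst ℝ V V).comp (e.symm : W →L[ℝ] V × V)).hasFDerivAt)
      simpa using hχx.hasFDerivAt
    have := h1.fun_smul (hΘ i _ hw).hasFDerivAt
    simpa only [e.symm_apply_apply, hΘv] using this
  have hB : HasFDerivAt (fun w : W => g i (e.symm w).2 - f (e.symm w).1)
      ((fderiv ℝ (g i) y).comp ((ContinuousLinearMap.snd ℝ V V).comp
          (e.symm : W →L[ℝ] V × V)) - (fderiv ℝ f x).comp ((ContinuousLinearMap.fst ℝ V V).comp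
          (e.symm : W →L[ℝ] V × V))) (e (x, y)) := by
    refine HasFDerivAt.sub ?_ ?_
    · refine HasFDerivAt.comp (e (x, y)) (g := g i) (f := fun w => (e.symm w).2) ?_
        (((ContinuousLinearMap.snd ℝ V V).comp (e.symm : W →L[ℝ] V × V)).hasFDerivAt)
      simpa using hgy.hasFDerivAt
    · refine HasFDerivAt.comp (e (x, y)) (g := f) (f := fun w => (e.symm w).1) ?_
        (((ContinuousLinearMap.fst ℝ V V).comp (e.symm : W →L[ℝ] V × V)).hasFDerivAt)
      simpa using hfx.hasFDerivAt
  have heq : (fun w : W => g i (e.symm w).2 - f (e.symm w).1) =ᶠ[𝓝 (e (x, y))]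
      fun w : W => χ (e.symm w).1 • Θ i w := by
    filter_upwards [hOo] with w hw
    simp only [Θ, smul_smul]
    rw [mul_inv_cancel₀ (hχU _ hw), one_smul]
  have hAB := (hA.congr_of_eventuallyEq heq).unique hB
  have hf' : fderiv ℝ (fun x => f x + χ x • v) x = fderiv ℝ f x + (fderiv ℝ χ x).smulRight v :=
    (hfx.hasFDerivAt.add (hχx.hasFDerivAt.smul_const v)).fderiv
  rw [orn_ne_zero_iff, hf']
  intro u u' huu
  have h1 := DFunLike.congr_fun hAB (e (u, -u'))
  simp only [add_apply, smul_apply, ContinuousLinearMap.smulRight_apply,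
    ContinuousLinearMap.comp_apply, ContinuousLinearEquiv.coe_coe, e.symm_apply_apply,
    ContinuousLinearMap.coe_fst', ContinuousLinearMap.coe_snd', sub_apply, map_neg] at h1 huu
  have h2 : χ x • fderiv ℝ (Θ i) (e (x, y)) (e (u, -u')) = 0 := by
    rw [eq_sub_of_add_eq h1, ← neg_zero, ← huu]
    abel
  have h3 := hinj _ ((smul_eq_zero.1 h2).resolve_left (hχU x hx))
  simpa using h3

end

section
variable {F V W T κ : Type*} [NormedAddCommGroup F] [NormedSpace ℝ F] [FiniteDimensional ℝ F]
  [NormedAddCommGroup V] [NormedSpace ℝ V] [FiniteDimensional ℝ V]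
  [NormedAddCommGroup W] [NormedSpace ℝ W] [FiniteDimensional ℝ W]

/-- Approximation by a transverse smooth map, relative to the boundary of a ball. -/
theorem exists_smooth_transverse {e : (V × V) ≃L[ℝ] W} {ι : Type*} [Countable ι] {c : V} {r : ℝ}
    {χ : V → ℝ} (hχ : ContDiff ℝ 1 χ) (hχU : ∀ x ∈ ball c r, χ x ≠ 0)
    (hχ0 : ∀ x ∈ sphere c r, χ x = 0) {f g' : V → W} (hf : ContDiff ℝ 1 f) {C : Set V}
    (hC : IsCompact C) (hCU : C ⊆ ball c r) (hg' : ContinuousOn g' (closedBall c r))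
    (hgf : ∀ x ∉ C, g' x = f x) {g : ι → V → W} (hg : ∀ i, ContDiff ℝ 1 (g i))
    {Y : Set W} (hY : IsOpen Y) (hgY : Set.MapsTo g' (closedBall c r) Y) :
    ∃ h : V → W, ContDiff ℝ 1 h ∧ Set.EqOn h f (sphere c r) ∧ Set.MapsTo h (closedBall c r) Y ∧
      ∀ i, ∀ x ∈ ball c r, ∀ y, h x = g i y → orn e (fderiv ℝ h x) (fderiv ℝ (g i) y) ≠ 0 := by
  have hK : IsCompact (closedBall c r) := isCompact_closedBall c r
  obtain ⟨δ, hδ, hδY⟩ := exists_thickening_subset hK hg' hY hgY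
  have hcont : Continuous (fun x => g' x - f x) := by
    rw [continuous_iff_continuousAt]
    intro x
    by_cases hx : x ∈ C
    · exact (hg'.continuousAt (Filter.mem_of_superset (isOpen_ball.mem_nhds (hCU hx))
        ball_subset_closedBall)).sub hf.continuous.continuousAt
    · refine (continuousAt_const (y := (0 : W))).congr ?_
      filter_upwards [hC.isClosed.isOpen_compl.mem_nhds hx] with y hy
      rw [hgf y hy, sub_self]
  obtain ⟨q, hq, hqd, hqs⟩ := hcont.exists_contDiff_approx 1 (ε := fun _ => δ / 2)
    continuous_const fun _ => half_pos hδ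
  obtain ⟨M, hM⟩ := hK.exists_bound_of_continuousOn hχ.continuous.continuousOn
  have hM1 : 0 < |M| + 1 := by positivity
  obtain ⟨v, hv, htr⟩ := exists_transverse (e := e) (f := fun x => f x + q x) isOpen_ball hχ hχU
    (hf.add hq) hg (div_pos (half_pos hδ) hM1)
  refine ⟨fun x => f x + q x + χ x • v, (hf.add hq).add (hχ.smul contDiff_const), ?_, ?_, htr⟩
  · intro x hx
    have h1 : q x = 0 := by
      by_contra h
      have h2 : x ∉ C := fun h' => by
        have := hCU h'
        rw [mem_ball] at this
        rw [mem_sphere] at hx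
        linarith
      exact hqs h (by show g' x - f x = 0; rw [hgf x h2, sub_self])
    simp [h1, hχ0 x hx]
  · intro x hx
    refine hδY x hx (mem_ball.2 ?_)
    have h1 : ‖χ x • v‖ < δ / 2 := by
      rw [norm_smul]
      calc ‖χ x‖ * ‖v‖ ≤ (|M| + 1) * ‖v‖ := by
            gcongr
            exact (hM x hx).trans ((le_abs_self M).trans (by linarith))
        _ < (|M| + 1) * (δ / 2 / (|M| + 1)) := by gcongr
        _ = δ / 2 := by field_simp
    have h2 := hqd x
    rw [dist_eq_norm] at h2 ⊢
    calc ‖f x + q x + χ x • v - g' x‖ = ‖(q x - (g' x - f x)) + χ x • v‖ := by congr 1; abel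
      _ ≤ ‖q x - (g' x - f x)‖ + ‖χ x • v‖ := norm_add_le _ _
      _ < δ := by linarith

theorem whitney [Nontrivial F] [Finite T] [Finite κ] (i : (ℝ × F) ≃L[ℝ] V)
    {e : (V × V) ≃L[ℝ] W} (hd : Module.finrank ℝ V + 2 < Module.finrank ℝ W) {c : V} {r : ℝ}
    (hr : 0 < r) {χ : V → ℝ} (hχ : ContDiff ℝ 1 χ) (hχU : ∀ x ∈ ball c r, χ x ≠ 0)
    (hχ0 : ∀ x ∈ sphere c r, χ x = 0) {far : T → T → Prop} (hsymm : ∀ s t, far s t → far t s)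
    (hirr : ∀ s, ¬ far s s) {farL : T → κ → Prop} {f : T → V → W}
    (hf : ∀ t, ContDiff ℝ 1 (f t)) {l : κ → V → W} (hl : ∀ k, ContDiff ℝ 1 (l k))
    (hdeg : ∀ k y, ∃ u ≠ 0, fderiv ℝ (l k) y u = 0)
    (hb : ∀ t, ∀ x ∈ sphere c r, ∃ k, ∃ y ∈ closedBall c r, l k y = f t x)
    (hL : ∀ t, ∀ x ∈ ball c r, ∀ k, ∀ y ∈ closedBall c r, f t x ≠ l k y)
    (hB : ∀ t k, farL t k → ∀ x ∈ sphere c r, ∀ y ∈ closedBall c r, f t x ≠ l k y)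
    (hfb : ∀ s t, far s t → ∀ x ∈ sphere c r, ∃ k, farL s k ∧ ∃ y ∈ closedBall c r, l k y = f t x)
    (hinj : ∀ t, Set.InjOn (f t) (closedBall c r))
    (himm : ∀ t, ∀ x ∈ ball c r, Function.Injective (fderiv ℝ (f t) x))
    (htr : ∀ s t, s ≠ t → ∀ x ∈ ball c r, ∀ y ∈ ball c r, f s x = f t y →
      orn e (fderiv ℝ (f s) x) (fderiv ℝ (f t) y) ≠ 0)
    (htrip : ∀ s t t', s ≠ t → s ≠ t' → t ≠ t' → ∀ x ∈ ball c r, ∀ y ∈ ball c r, ∀ z ∈ ball c r,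
      f s x = f t y → f s x ≠ f t' z)
    (hcount : ∀ s t, far s t → ∑ᶠ p ∈ {p ∈ ball c r ×ˢ ball c r | f s p.1 = f t p.2},
      (SignType.sign (orn e (fderiv ℝ (f s) p.1) (fderiv ℝ (f t) p.2)) : ℤ) = 0) :
    ∃ g : T → V → W, (∀ t, Continuous (g t)) ∧ (∀ t, Set.EqOn (g t) (f t) (sphere c r)) ∧
      (∀ s t, far s t → ∀ x ∈ closedBall c r, ∀ y ∈ closedBall c r, g s x ≠ g t y) ∧
      ∀ t k, farL t k → ∀ x ∈ closedBall c r, ∀ y ∈ closedBall c r, g t x ≠ l k y := by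
  classical
  have hK : IsCompact (closedBall c r) := isCompact_closedBall c r
  have hQi : interior (closedBall c r) = ball c r := interior_closedBall c hr.ne'
  have hcase : ∀ x ∈ closedBall c r, x ∈ ball c r ∨ x ∈ sphere c r := fun x hx => by
    rw [← ball_union_sphere] at hx; exact hx
  have hbs : ∀ x ∈ ball c r, x ∈ closedBall c r := fun x hx => ball_subset_closedBall hx
  have hzero : ∀ s t, far s t → ∀ x ∈ closedBall c r, ∀ y ∈ closedBall c r, f s x = f t y →
      x ∈ ball c r ∧ y ∈ ball c r := by
    intro s t hst x hx y hy h
    rcases hcase y hy with hy' | hy'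
    · rcases hcase x hx with hx' | hx'
      · exact ⟨hx', hy'⟩
      · obtain ⟨k, z, hz, hk⟩ := hb s x hx'
        exact absurd (h.symm.trans hk.symm) (hL t y hy' k z hz)
    · obtain ⟨k, hfk, z, hz, hk⟩ := hfb s t hst y hy'
      rcases hcase x hx with hx' | hx'
      · exact absurd (h.trans hk.symm) (hL s x hx' k z hz)
      · exact absurd (h.trans hk.symm) (hB s k hfk x hx' z hz)
  have hfin : ∀ s t, far s t → {p ∈ ball c r ×ˢ ball c r | f s p.1 = f t p.2}.Finite := by
    intro s t hst
    have h1 : {p ∈ ball c r ×ˢ ball c r | f s p.1 = f t p.2} =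
        {p ∈ closedBall c r ×ˢ closedBall c r | f s p.1 = f t p.2} := by
      ext p
      constructor
      · rintro ⟨hp, h⟩; exact ⟨⟨hbs _ hp.1, hbs _ hp.2⟩, h⟩
      · rintro ⟨hp, h⟩; exact ⟨hzero s t hst _ hp.1 _ hp.2 h, h⟩
    have h2 : IsCompact {p ∈ closedBall c r ×ˢ closedBall c r | f s p.1 = f t p.2} :=
      (hK.prod hK).inter_right (isClosed_eq ((hf s).continuous.comp continuous_fst)
        ((hf t).continuous.comp continuous_snd))
    rw [← h1] at h2
    have hst' : s ≠ t := fun h => hirr s (h ▸ hst)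
    have := discreteTopology_coincidences (e := e) (S := ball c r ×ˢ ball c r)
      (M := fderiv ℝ (f s)) (D := fderiv ℝ (f t))
      (fun p _ => ((hf s).differentiable (by simp) p.1).hasFDerivAt)
      (fun p _ => ((hf t).differentiable (by simp) p.2).hasFDerivAt)
      (fun p hp h => htr s t hst' _ hp.1 _ hp.2 h)
    exact h2.finite ⟨this⟩
  suffices H : ∀ S : Finset T, ∃ g : T → V → W, (∀ t, ContDiff ℝ 1 (g t)) ∧
      (∀ t, Set.EqOn (g t) (f t) (sphere c r)) ∧
      (∀ t, ∀ x ∈ ball c r, ∀ k, ∀ y ∈ closedBall c r, g t x ≠ l k y) ∧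
      (∀ s t, s ≠ t → {p ∈ ball c r ×ˢ ball c r | g s p.1 = g t p.2}.Countable) ∧
      (∀ t ∉ S, g t = f t) ∧
      ∀ s ∈ S, ∀ t, far s t → ∀ x ∈ closedBall c r, ∀ y ∈ closedBall c r, g s x ≠ g t y by
    have := Fintype.ofFinite T
    obtain ⟨g, h1, h2, h3, -, -, h6⟩ := H Finset.univ
    refine ⟨g, fun t => (h1 t).continuous, h2, fun s t => h6 s (Finset.mem_univ s) t, ?_⟩
    intro t k hk x hx y hy
    rcases hcase x hx with hx' | hx'
    · exact h3 t x hx' k y hy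
    · rw [h2 t hx']; exact hB t k hk x hx' y hy
  intro S
  induction S using Finset.induction_on with
  | empty =>
    refine ⟨f, hf, fun t => Set.eqOn_refl _ _, hL, fun s t hst => ?_, fun _ _ => rfl, by simp⟩
    exact countable_coincidences (e := e) (M := fderiv ℝ (f s)) (D := fderiv ℝ (f t))
      (fun p _ => ((hf s).differentiable (by simp) p.1).hasFDerivAt)
      (fun p _ => ((hf t).differentiable (by simp) p.2).hasFDerivAt)
      (fun p hp h => htr s t hst _ hp.1 _ hp.2 h)
  | insert s S hs ih =>
  obtain ⟨g, hg, hgb, hgL, hgc, hgf, hgd⟩ := ih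
  let J := {t : T // far s t ∧ t ∉ S}
  have hgJ : ∀ j : J, g j = f j := fun j => hgf j j.2.2
  let P : Set W := (⋃ k : {k // farL s k}, l k '' closedBall c r) ∪
    ⋃ t : {t // far s t ∧ t ∈ S}, g t '' closedBall c r
  have hPc : IsClosed P := by
    apply IsClosed.union
    · exact isClosed_iUnion_of_finite fun k => (hK.image (hl k.1).continuous).isClosed
    · exact isClosed_iUnion_of_finite fun t => (hK.image (hg t.1).continuous).isClosed
  let Y : Set W := (P ∪ ⋃ j : J, f j '' closedBall c r)ᶜ
  have hYo : IsOpen Y := by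
    refine IsClosed.isOpen_compl (self := IsClosed.union hPc ?_)
    exact isClosed_iUnion_of_finite fun j => (hK.image (hf j.1).continuous).isClosed
  have hY : ∀ w, w ∉ P → (∀ j : J, w ∉ f j '' closedBall c r) → w ∈ Y := by
    intro w h1 h2 h3
    rcases h3 with h3 | h3
    · exact h1 h3
    · obtain ⟨j, hj⟩ := Set.mem_iUnion.1 h3
      exact h2 j hj
  have hSC : LoopsNull Y := by
    refine loopsNull_of_compl_subset hYo (f := Sum.elim l (Sum.elim g f))
      (by rintro (k | t | t); exacts [hl k, hg t, hf t]) hd fun w hw => hY w ?_ ?_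
    · rintro (h | h)
      · obtain ⟨k, y, -, hy⟩ := Set.mem_iUnion.1 h
        exact hw (.inl k) y hy
      · obtain ⟨t, y, -, hy⟩ := Set.mem_iUnion.1 h
        exact hw (.inr (.inl t)) y hy
    · rintro j ⟨y, -, hy⟩
      exact hw (.inr (.inr j)) y hy
  obtain ⟨g', C, hg'c, hC, hCU, hg'e, hg'Y⟩ : ∃ (g' : V → W) (C : Set V),
      ContinuousOn g' (closedBall c r) ∧ IsCompact C ∧ C ⊆ ball c r ∧
      (∀ x ∉ C, g' x = f s x) ∧ Set.MapsTo g' (closedBall c r) Y := by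
    have hfP : ∀ x ∈ closedBall c r, f s x ∉ P := by
      rintro x hx (h | h)
      · obtain ⟨⟨k, hk⟩, y, hy, h⟩ := Set.mem_iUnion.1 h
        rcases hcase x hx with hx' | hx'
        · exact hL s x hx' k y hy h.symm
        · exact hB s k hk x hx' y hy h.symm
      · obtain ⟨⟨t, hst, ht⟩, y, hy, h⟩ := Set.mem_iUnion.1 h
        refine hgd t ht s (hsymm _ _ hst) y hy x hx ?_
        rw [hgf s hs]; exact h
    rcases isEmpty_or_nonempty J with hJ | hJ
    · exact ⟨f s, ∅, (hf s).continuous.continuousOn, isCompact_empty, Set.empty_subset _,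
        fun _ _ => rfl, fun x hx => hY _ (hfP x hx) fun j => hJ.elim j⟩
    have hJne : ∀ j : J, s ≠ j := fun j h => hirr s (by have := j.2.1; rwa [← h] at this)
    have hZfin : {x : V | ∃ j : J, ∃ y, x ∈ ball c r ∧ y ∈ ball c r ∧ f s x = f j y}.Finite := by
      refine (Set.finite_iUnion fun j : J => (hfin s j j.2.1).image Prod.fst).subset ?_
      rintro x ⟨j, y, hx, hy, h⟩
      exact Set.mem_iUnion.2 ⟨j, (x, y), ⟨⟨hx, hy⟩, h⟩, rfl⟩
    have hex : ∀ x, ∃ (j : J) (y : V), x ∈ hZfin.toFinset →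
        x ∈ ball c r ∧ y ∈ ball c r ∧ f s x = f j y := by
      intro x
      by_cases hx : x ∈ hZfin.toFinset
      · obtain ⟨j, y, h⟩ := hZfin.mem_toFinset.1 hx
        exact ⟨j, y, fun _ => h⟩
      · exact ⟨Classical.arbitrary J, x, fun h => absurd h hx⟩
    choose lab y hlab using hex
    have huniq : ∀ x ∈ ball c r, ∀ j : J, ∀ z ∈ ball c r, f s x = f j z →
        x ∈ hZfin.toFinset ∧ lab x = j ∧ y x = z := by
      intro x hx j z hz h
      have hxZ : x ∈ hZfin.toFinset := hZfin.mem_toFinset.2 ⟨j, z, hx, hz, h⟩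
      obtain ⟨-, hy, he⟩ := hlab x hxZ
      have hj : lab x = j := by
        by_contra hne
        exact htrip s (lab x) j (hJne _) (hJne _) (fun h' => hne (Subtype.ext h')) x hx _ hy z hz
          he h
      refine ⟨hxZ, hj, ?_⟩
      rw [hj] at he
      exact hinj j (hbs _ hy) (hbs _ hz) (he.symm.trans h)
    let Bd : J → Set V := fun j => ⋃ t : {t : T // t ≠ j ∧ far s t},
      Prod.fst '' {p ∈ ball c r ×ˢ ball c r | g j p.1 = g t p.2}
    have hBd : ∀ j, (Bd j).Countable := fun j =>
      Set.countable_iUnion fun t => (hgc j t t.2.1.symm).image _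
    have hmemBd : ∀ j : J, ∀ w ∈ ball c r, ∀ t : T, t ≠ j → far s t →
        ∀ z ∈ closedBall c r, f j w = g t z → w ∈ Bd j := by
      intro j w hw t ht hst z hz h
      refine Set.mem_iUnion.2 ⟨⟨t, ht, hst⟩, (w, z), ⟨⟨hw, ?_⟩, by rw [hgJ]; exact h⟩, rfl⟩
      rcases hcase z hz with hz' | hz'
      · exact hz'
      · rw [hgb t hz'] at h
        obtain ⟨k, z', hz', hk⟩ := hb t z hz'
        exact absurd (h.trans hk.symm) (hL j w hw k z' hz')
    have hVr : 1 < Module.rank ℝ V := by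
      have h1 : Module.finrank ℝ V = 1 + Module.finrank ℝ F := by
        rw [← i.toLinearEquiv.finrank_eq, Module.finrank_prod, Module.finrank_self]
      have h2 : 0 < Module.finrank ℝ F := Module.finrank_pos
      rw [← Module.finrank_eq_rank]
      exact_mod_cast (by omega : 1 < Module.finrank ℝ V)
    refine cancel_all (e := e) i hYo hSC hK (f := fun j : J => f j)
      (fun j => (hf j).continuous.continuousOn) (fun j => hinj j) hPc hY
      (G := fun j => ball c r \ Bd j) (fun j => isPreconnected_ball_diff_countable hVr c hr (hBd j))
      (fun j => by rw [hQi]; exact Set.sdiff_subset) ?_ (D := fun j => fderiv ℝ (f j))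
      (fun j w _ => ((hf j).contDiffAt).hasStrictFDerivAt (by simp))
      (fun j => ((hf j).continuous_fderiv (by simp)).continuousOn)
      (fun j w hw => himm j w hw.1) ball_subset_closedBall (l := lab) (y := y)
      (N := fderiv ℝ (f s)) hZfin.toFinset (f s) (fun x hx => (hlab x hx).1)
      (hf s).continuous.continuousOn ?_ ?_ ?_
    · rintro j w ⟨hw, hwB⟩
      refine ⟨?_, ?_⟩
      · rintro (h | h)
        · obtain ⟨⟨k, hk⟩, z, hz, h⟩ := Set.mem_iUnion.1 h
          exact hL j w hw k z hz h.symm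
        · obtain ⟨⟨t, hst, ht⟩, z, hz, h⟩ := Set.mem_iUnion.1 h
          exact hwB (hmemBd j w hw t (fun h => j.2.2 (h ▸ ht)) hst z hz h.symm)
      · rintro j' hj' ⟨z, hz, h⟩
        refine hwB (hmemBd j w hw j' (fun h => hj' (Subtype.ext h)) j'.2.1 z hz ?_)
        rw [hgJ]; exact h.symm
    · intro x hx hxZ
      refine hY _ (hfP x hx) ?_
      rintro j ⟨z, hz, h⟩
      obtain ⟨h1, h2⟩ := hzero s j j.2.1 x hx z hz h.symm
      exact hxZ (huniq x h1 j z h2 h.symm).1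
    · intro x hx
      obtain ⟨h1, h2, h3⟩ := hlab x hx
      refine ⟨⟨h2, fun hbad => ?_⟩, h3, ((hf s).differentiable (by simp) x).hasFDerivAt,
        htr _ _ (hJne _) x h1 _ h2 h3⟩
      obtain ⟨⟨t, ht, hst⟩, ⟨w, z⟩, ⟨⟨hw, hz⟩, he⟩, hwy⟩ := Set.mem_iUnion.1 hbad
      simp only at hw hz he hwy
      subst hwy
      rw [hgJ] at he
      by_cases hts : t ∈ S
      · refine hgd t hts s (hsymm _ _ hst) z (hbs _ hz) x (hbs _ h1) ?_
        rw [hgf s hs]; exact (h3.trans he).symm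
      · rw [hgf t hts] at he
        exact htrip s (lab x) t (hJne _) (hJne ⟨t, hst, hts⟩) ht.symm x h1 _ h2 z hz h3
          (h3.trans he)
    · intro j
      rw [← hcount s j j.2.1, finsum_mem_eq_finite_toFinset_sum _ (hfin s j j.2.1)]
      symm
      refine Finset.sum_bij (fun p _ => p.1) ?_ ?_ ?_ ?_
      · intro p hp
        obtain ⟨hp, h⟩ := (hfin s j j.2.1).mem_toFinset.1 hp
        have := huniq _ hp.1 j _ hp.2 h
        exact Finset.mem_filter.2 ⟨this.1, this.2.1⟩
      · intro p hp q hq h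
        obtain ⟨hp, hp'⟩ := (hfin s j j.2.1).mem_toFinset.1 hp
        obtain ⟨hq, hq'⟩ := (hfin s j j.2.1).mem_toFinset.1 hq
        refine Prod.ext h ?_
        rw [← (huniq _ hp.1 j _ hp.2 hp').2.2, ← (huniq _ hq.1 j _ hq.2 hq').2.2, h]
      · intro x hx
        obtain ⟨hx, hxj⟩ := Finset.mem_filter.1 hx
        obtain ⟨h1, h2, h3⟩ := hlab x hx
        rw [hxj] at h3
        exact ⟨(x, y x), (hfin s j j.2.1).mem_toFinset.2 ⟨⟨h1, h2⟩, h3⟩, rfl⟩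
      · intro p hp
        obtain ⟨hp, h⟩ := (hfin s j j.2.1).mem_toFinset.1 hp
        obtain ⟨-, h1, h2⟩ := huniq _ hp.1 j _ hp.2 h
        rw [h1, h2]
  obtain ⟨h, hh, hhb, hhY, hhtr⟩ := exists_smooth_transverse (e := e) hχ hχU hχ0 (hf s) hC hCU
    hg'c hg'e (g := Sum.elim l g) (by rintro (k | t); exacts [hl k, hg t]) hYo hg'Y
  have hhs : ∀ t, t ≠ s → {p ∈ ball c r ×ˢ ball c r | h p.1 = g t p.2}.Countable := fun t _ =>
    countable_coincidences (e := e) (M := fderiv ℝ h) (D := fderiv ℝ (g t))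
      (fun p _ => (hh.differentiable (by simp) p.1).hasFDerivAt)
      (fun p _ => ((hg t).differentiable (by simp) p.2).hasFDerivAt)
      (fun p hp he => hhtr (.inr t) _ hp.1 _ he)
  have hhfar : ∀ t, far s t → ∀ x ∈ closedBall c r, ∀ y ∈ closedBall c r, h x ≠ g t y := by
    intro t hst x hx y hy he
    by_cases htS : t ∈ S
    · exact hhY hx (.inl (.inr (Set.mem_iUnion.2 ⟨⟨t, hst, htS⟩, y, hy, he.symm⟩)))
    · refine hhY hx (.inr (Set.mem_iUnion.2 ⟨⟨t, hst, htS⟩, y, hy, ?_⟩))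
      rw [he, hgf t htS]
  refine ⟨Function.update g s h, ?_, ?_, ?_, ?_, ?_, ?_⟩
  · intro t
    rcases eq_or_ne t s with rfl | ht
    · simpa using hh
    · simpa [ht] using hg t
  · intro t
    rcases eq_or_ne t s with rfl | ht
    · simpa using hhb
    · simpa [ht] using hgb t
  · intro t
    rcases eq_or_ne t s with rfl | ht
    · intro x hx k y hy he
      rw [Function.update_self] at he
      obtain ⟨u, hu, hu0⟩ := hdeg k y
      exact hu (orn_ne_zero_iff.1 (hhtr (.inl k) x hx y he) 0 u (by simp [hu0])).2
    · simpa [ht] using hgL t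
  · intro t t' htt'
    rcases eq_or_ne t s with rfl | ht
    · rw [Function.update_self, Function.update_of_ne htt'.symm]
      exact hhs t' htt'.symm
    · rcases eq_or_ne t' s with rfl | ht'
      · rw [Function.update_self, Function.update_of_ne ht]
        refine ((hhs t ht).image Prod.swap).mono ?_
        rintro ⟨p, q⟩ ⟨⟨hp, hq⟩, he⟩
        exact ⟨(q, p), ⟨⟨hq, hp⟩, he.symm⟩, rfl⟩
      · rw [Function.update_of_ne ht, Function.update_of_ne ht']
        exact hgc t t' htt'
  · intro t ht
    rw [Finset.mem_insert, not_or] at ht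
    rw [Function.update_of_ne ht.1, hgf t ht.2]
  · intro s' hs' t hst x hx y hy
    rcases eq_or_ne s' s with rfl | hs1
    · rw [Function.update_self, Function.update_of_ne (fun h => hirr s' (by rwa [h] at hst))]
      exact hhfar t hst x hx y hy
    · have hs2 := Finset.mem_of_mem_insert_of_ne hs' hs1
      rw [Function.update_of_ne hs1]
      rcases eq_or_ne t s with rfl | ht
      · rw [Function.update_self]
        exact (hhfar s' (hsymm _ _ hst) y hy x hx).symm
      · rw [Function.update_of_ne ht]
        exact hgd s' hs2 t hst x hx y hy

end

section degree
open MeasureTheory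

/-- A smooth even bump function of integral one supported in the open unit ball. -/
noncomputable def density (m : ℕ) : (Fin m → ℝ) → ℝ :=
  (⟨1 / 2, 1, by norm_num, by norm_num⟩ : ContDiffBump (0 : Fin m → ℝ)).normed volume

theorem contDiff_density (m : ℕ) : ContDiff ℝ 2 (density m) := ContDiffBump.contDiff_normed _

theorem density_neg (m : ℕ) (x : Fin m → ℝ) : density m (-x) = density m x :=
  ContDiffBump.normed_neg _ _

theorem support_density (m : ℕ) : Function.support (density m) = ball 0 1 :=
  ContDiffBump.support_normed_eq _

theorem integral_density (m : ℕ) : ∫ x, density m x = 1 := ContDiffBump.integral_normed _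

theorem density_eq_zero {m : ℕ} {x : Fin m → ℝ} (hx : 1 ≤ ‖x‖) : density m x = 0 := by
  by_contra h
  have : x ∈ Function.support (density m) := h
  rw [support_density, mem_ball_zero_iff] at this
  linarith

/-- The integral of the pullback of the density form over the unit cube. -/
noncomputable def degInt {m : ℕ} (f : (Fin m → ℝ) → Fin m → ℝ) : ℝ :=
  ∫ x in Set.Icc (0 : Fin m → ℝ) 1, density m (f x) * (fderiv ℝ f x).det

/-- The determinant as a continuous alternating map. -/
noncomputable def detForm (m : ℕ) : (Fin m → ℝ) [⋀^Fin m]→L[ℝ] ℝ :=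
  { Matrix.detRowAlternating (n := Fin m) (R := ℝ) with
    cont := by
      show Continuous fun v : Fin m → Fin m → ℝ => Matrix.det (v : Matrix (Fin m) (Fin m) ℝ)
      exact Continuous.matrix_det continuous_id }

theorem detForm_apply {m : ℕ} (v : Fin m → Fin m → ℝ) : detForm m v = Matrix.det (Matrix.of v) :=
  rfl

theorem detForm_clm {m : ℕ} (A : (Fin m → ℝ) →L[ℝ] Fin m → ℝ) :
    detForm m (fun j => A (Pi.single j 1)) = A.det := by
  rw [detForm_apply, ContinuousLinearMap.det, ← LinearMap.det_toMatrix', ← Matrix.det_transpose]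
  rfl

/-- Insertion of a zero coordinate, as a continuous linear map. -/
noncomputable def insertL {m : ℕ} (i : Fin (m + 1)) : (Fin m → ℝ) →L[ℝ] Fin (m + 1) → ℝ :=
  LinearMap.toContinuousLinearMap
    { toFun := fun x => i.insertNth (0 : ℝ) x
      map_add' := fun x y => by
        ext k
        refine Fin.succAboveCases i ?_ (fun j => ?_) k <;> simp
      map_smul' := fun c x => by
        ext k
        refine Fin.succAboveCases i ?_ (fun j => ?_) k <;> simp }

theorem insertNth_eq {m : ℕ} (i : Fin (m + 1)) (c : ℝ) (x : Fin m → ℝ) :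
    i.insertNth (α := fun _ => ℝ) c x = insertL i x + Pi.single i c := by
  ext k
  refine Fin.succAboveCases i ?_ (fun j => ?_) k <;> simp [insertL]

theorem insertL_single {m : ℕ} (i : Fin (m + 1)) (j : Fin m) (c : ℝ) :
    insertL i (Pi.single j c) = Pi.single (i.succAbove j) c := by
  ext k
  refine Fin.succAboveCases i ?_ (fun l => ?_) k
  · simp [insertL, Fin.ne_succAbove]
  · by_cases h : l = j
    · subst h; simp [insertL]
    · simp [insertL, h]

theorem contDiff_insertNth {m : ℕ} {k : WithTop ℕ∞} (i : Fin (m + 1)) (c : ℝ) :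
    ContDiff ℝ k (fun x : Fin m → ℝ => i.insertNth (α := fun _ => ℝ) c x) := by
  simp only [insertNth_eq]
  exact (insertL i).contDiff.add contDiff_const

theorem fderiv_comp_insertNth {m : ℕ} {W : Type*} [NormedAddCommGroup W] [NormedSpace ℝ W]
    {g : (Fin (m + 1) → ℝ) → W} (i : Fin (m + 1)) (c : ℝ) (x : Fin m → ℝ)
    (hg : DifferentiableAt ℝ g (i.insertNth (α := fun _ => ℝ) c x)) :
    fderiv ℝ (fun y : Fin m → ℝ => g (i.insertNth (α := fun _ => ℝ) c y)) x =
      fderiv ℝ g (i.insertNth (α := fun _ => ℝ) c x) ∘L insertL i := by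
  have h1 : HasFDerivAt (fun y : Fin m → ℝ => i.insertNth (α := fun _ => ℝ) c y) (insertL i) x := by
    simp only [insertNth_eq]
    exact (insertL i).hasFDerivAt.add_const _
  exact (hg.hasFDerivAt.comp x h1).fderiv

theorem contDiff_det {m : ℕ} {V : Type*} [NormedAddCommGroup V] [NormedSpace ℝ V]
    {k : WithTop ℕ∞} {A : V → Fin m → Fin m → ℝ} (hA : ContDiff ℝ k A) :
    ContDiff ℝ k fun x => Matrix.det (Matrix.of (A x)) := by
  simp only [Matrix.det_apply, Matrix.of_apply]
  refine ContDiff.sum fun σ _ => ContDiff.const_smul _ (contDiff_prod fun i _ => ?_)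
  exact contDiff_pi.1 (contDiff_pi.1 hA _) _

theorem sum_degInt_faces {m : ℕ} {g : (Fin (m + 1) → ℝ) → Fin m → ℝ} (hg : ContDiff ℝ 2 g) :
    ∑ i : Fin (m + 1), (-1 : ℝ) ^ (i : ℕ) * (degInt (fun x => g (i.insertNth (1 : ℝ) x)) -
      degInt (fun x => g (i.insertNth (0 : ℝ) x))) = 0 := by
  let ω : (Fin m → ℝ) → (Fin m → ℝ) [⋀^Fin m]→L[ℝ] ℝ := fun y => density m y • detForm m
  have hω : ContDiff ℝ 2 ω := (contDiff_density m).smul contDiff_const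
  let η : (Fin (m + 1) → ℝ) → (Fin (m + 1) → ℝ) [⋀^Fin m]→L[ℝ] ℝ := fun x =>
    (ω (g x)).compContinuousLinearMap (fderiv ℝ g x)
  let b : Fin (m + 1) → Fin (m + 1) → ℝ := fun i => Pi.single i 1
  let F : Fin (m + 1) → (Fin (m + 1) → ℝ) → ℝ := fun i x =>
    (-1 : ℝ) ^ (i : ℕ) * η x (i.removeNth b)
  have hη : ∀ x (v : Fin m → Fin (m + 1) → ℝ), η x v =
      density m (g x) * Matrix.det (Matrix.of fun j => fderiv ℝ g x (v j)) := fun x v => rfl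
  have hdg : ContDiff ℝ 1 (fderiv ℝ g) := hg.fderiv_right (by norm_num)
  have hηc : Differentiable ℝ η := fun x =>
    ((hω.comp hg).differentiable (by norm_num) x).continuousAlternatingMapCompContinuousLinearMap
      (hdg.differentiable (by simp) x)
  have hG : ∀ i : Fin (m + 1), ContDiff ℝ 1 (fun x => η x (i.removeNth b)) := by
    intro i
    simp only [hη]
    refine (((contDiff_density m).comp hg).of_le (by norm_num)).mul (contDiff_det ?_)
    exact contDiff_pi.2 fun j => hdg.clm_apply contDiff_const
  have hF : ∀ i, ContDiff ℝ 1 (F i) := fun i => contDiff_const.mul (hG i)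
  have hdiv := integral_divergence_of_hasFDerivAt_off_countable' (0 : Fin (m + 1) → ℝ) 1
    zero_le_one F (fun i x => fderiv ℝ (F i) x) ∅ Set.countable_empty
    (fun i => (hF i).continuous.continuousOn)
    (fun x _ i => ((hF i).differentiable (by simp) x).hasFDerivAt) (by
      refine ContinuousOn.integrableOn_compact isCompact_Icc (Continuous.continuousOn ?_)
      exact continuous_finsetSum _ fun i _ =>
        ((hF i).continuous_fderiv (by simp)).clm_apply continuous_const)
  have hz : ∀ x, ∑ i, fderiv ℝ (F i) x (Pi.single i 1) = 0 := by
    intro x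
    have h1 := extDeriv_pullback (𝕜 := ℝ) (x := x) (ω := ω) (f := g) (r := 2)
      (hω.differentiable (by norm_num) _) hg.contDiffAt (by simp)
    have h2 := DFunLike.congr_fun h1 b
    rw [extDeriv_apply (hηc x)] at h2
    have h3 : ∀ i, fderiv ℝ (F i) x (Pi.single i 1) =
        (-1 : ℤ) ^ (i : ℕ) • fderiv ℝ (fun y => η y (i.removeNth b)) x (b i) := by
      intro i
      have : fderiv ℝ (F i) x = (-1 : ℝ) ^ (i : ℕ) • fderiv ℝ (fun y => η y (i.removeNth b)) x :=
        fderiv_const_mul ((hG i).differentiable (by simp) x) _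
      rw [this, zsmul_eq_mul]
      push_cast
      rfl
    rw [Finset.sum_congr rfl fun i _ => h3 i]
    refine h2.trans ?_
    have hli : ¬ LinearIndependent ℝ fun i => fderiv ℝ g x (b i) := by
      intro h
      have := h.fintype_card_le_finrank
      simp at this
    exact AlternatingMap.map_linearDependent (extDeriv ω (g x)).toAlternatingMap _ hli
  simp only [hz, integral_zero] at hdiv
  rw [eq_comm] at hdiv
  have hface : ∀ (i : Fin (m + 1)) (c : ℝ), ∫ x in Set.Icc ((0 : Fin (m + 1) → ℝ) ∘ i.succAbove)
      ((1 : Fin (m + 1) → ℝ) ∘ i.succAbove), F i (i.insertNth c x) =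
      (-1) ^ (i : ℕ) * degInt (fun x => g (i.insertNth c x)) := by
    intro i c
    rw [degInt, ← integral_const_mul]
    have h0 : ((0 : Fin (m + 1) → ℝ) ∘ i.succAbove) = 0 := rfl
    have h1 : ((1 : Fin (m + 1) → ℝ) ∘ i.succAbove) = 1 := rfl
    rw [h0, h1]
    refine integral_congr_ae (Filter.Eventually.of_forall fun x => ?_)
    show (-1 : ℝ) ^ (i : ℕ) * η _ _ = _
    dsimp only
    rw [hη, fderiv_comp_insertNth i c x (hg.differentiable (by norm_num) _), ← detForm_clm,
      detForm_apply]
    simp only [ContinuousLinearMap.comp_apply, insertL_single]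
    rfl
  refine Eq.trans ?_ hdiv
  refine Finset.sum_congr rfl fun i _ => ?_
  rw [mul_sub, ← hface, ← hface]
  rfl

end degree

section degree
open MeasureTheory

variable {m : ℕ}

/-- The degree at the origin of a map of the unit cube. -/
def HasDeg (f : (Fin m → ℝ) → Fin m → ℝ) (d : ℤ) : Prop :=
  ∃ Λ : ℝ, ∀ l ≥ Λ, degInt (fun x => l • f x) = d

theorem HasDeg.unique {f : (Fin m → ℝ) → Fin m → ℝ} {d d' : ℤ} (h : HasDeg f d)
    (h' : HasDeg f d') : d = d' := by
  obtain ⟨a, ha⟩ := h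
  obtain ⟨b, hb⟩ := h'
  exact_mod_cast (ha _ (le_max_left a b)).symm.trans (hb _ (le_max_right a b))

theorem sum_hasDeg_faces {g : (Fin (m + 1) → ℝ) → Fin m → ℝ} (hg : ContDiff ℝ 2 g)
    {d₀ d₁ : Fin (m + 1) → ℤ}
    (h₀ : ∀ i, HasDeg (fun x => g (i.insertNth (α := fun _ => ℝ) 0 x)) (d₀ i))
    (h₁ : ∀ i, HasDeg (fun x => g (i.insertNth (α := fun _ => ℝ) 1 x)) (d₁ i)) :
    ∑ i : Fin (m + 1), (-1) ^ (i : ℕ) * (d₁ i - d₀ i) = 0 := by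
  choose a ha using h₀
  choose b hb using h₁
  obtain ⟨l, hl⟩ := (Set.finite_range fun i => max (a i) (b i)).bddAbove
  have h := sum_degInt_faces (g := fun x => l • g x) (contDiff_const.fun_smul hg)
  have hl' : ∀ i, max (a i) (b i) ≤ l := fun i => hl ⟨i, rfl⟩
  simp only [ha _ l ((le_max_left _ _).trans (hl' _)),
    hb _ l ((le_max_right _ _).trans (hl' _))] at h
  exact_mod_cast h

theorem hasDeg_zero_of_ne_zero {f : (Fin m → ℝ) → Fin m → ℝ} (hf : Continuous f)
    (h : ∀ x ∈ Set.Icc (0 : Fin m → ℝ) 1, f x ≠ 0) : HasDeg f 0 := by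
  obtain ⟨δ, hδ, hd⟩ := isCompact_Icc.exists_forall_le' (s := Set.Icc (0 : Fin m → ℝ) 1)
    hf.norm.continuousOn (a := 0) fun x hx => norm_pos_iff.2 (h x hx)
  refine ⟨1 / δ, fun l hl => ?_⟩
  rw [degInt, Int.cast_zero]
  refine setIntegral_eq_zero_of_forall_eq_zero fun x hx => ?_
  have hl0 : 0 < l := lt_of_lt_of_le (by positivity) hl
  rw [density_eq_zero, zero_mul]
  rw [norm_smul, Real.norm_of_nonneg hl0.le]
  calc (1 : ℝ) = 1 / δ * δ := by field_simp
    _ ≤ l * ‖f x‖ := by gcongr; exact hd x hx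

theorem HasDeg.homotopy {H : ℝ × (Fin m → ℝ) → Fin m → ℝ} (hH : ContDiff ℝ 2 H)
    (h : ∀ t ∈ Set.Icc (0 : ℝ) 1, ∀ x ∈ Set.Icc (0 : Fin m → ℝ) 1, (∃ i, x i = 0 ∨ x i = 1) →
      H (t, x) ≠ 0) {d : ℤ} (hd : HasDeg (fun x => H (0, x)) d) : HasDeg (fun x => H (1, x)) d := by
  obtain ⟨Λ, hΛ⟩ := hd
  let g : (Fin (m + 1) → ℝ) → Fin m → ℝ := fun z => H (z 0, fun i => z i.succ)
  have hg : ContDiff ℝ 2 g := hH.comp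
    ((contDiff_apply ℝ ℝ _).prodMk (contDiff_pi.2 fun i => contDiff_apply ℝ ℝ _))
  have hside : ∀ (i : Fin m) (c : ℝ), c = 0 ∨ c = 1 →
      HasDeg (fun x => g (i.succ.insertNth (α := fun _ => ℝ) c x)) 0 := by
    intro i c hc
    refine hasDeg_zero_of_ne_zero (hg.continuous.comp
      (contDiff_insertNth (k := 1) _ _).continuous) fun x hx => ?_
    have hI : ∀ k, (i.succ.insertNth (α := fun _ => ℝ) c x) k ∈ Set.Icc (0 : ℝ) 1 := by
      intro k
      refine Fin.succAboveCases i.succ ?_ (fun j => ?_) k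
      · rcases hc with rfl | rfl <;> simp
      · simpa using ⟨hx.1 j, hx.2 j⟩
    exact h _ (hI 0) _ ⟨fun j => (hI _).1, fun j => (hI _).2⟩ ⟨i, by simpa using hc⟩
  choose a ha using fun i => hside i 0 (.inl rfl)
  choose b hb using fun i => hside i 1 (.inr rfl)
  obtain ⟨l₀, hl₀⟩ := (Set.finite_range fun i => max (a i) (b i)).bddAbove
  refine ⟨max Λ l₀, fun l hl => ?_⟩
  have hl' : ∀ i, max (a i) (b i) ≤ l := fun i => (hl₀ ⟨i, rfl⟩).trans ((le_max_right _ _).trans hl)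
  have hs := sum_degInt_faces (g := fun x => l • g x) (contDiff_const.fun_smul hg)
  rw [Fin.sum_univ_succ] at hs
  simp only [ha _ l ((le_max_left _ _).trans (hl' _)), hb _ l ((le_max_right _ _).trans (hl' _))]
    at hs
  simp only [Fin.insertNth_zero', sub_self, mul_zero, Finset.sum_const_zero, add_zero,
    Fin.val_zero, pow_zero, one_mul, g, Fin.cons_zero, Fin.cons_succ] at hs
  rw [← hΛ l ((le_max_left _ _).trans hl)]
  exact sub_eq_zero.1 hs

theorem hasDeg_of_nondegenerate {f : (Fin m → ℝ) → Fin m → ℝ} (hf : ContDiff ℝ 1 f)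
    (hb : ∀ x ∈ Set.Icc (0 : Fin m → ℝ) 1, (∃ i, x i = 0 ∨ x i = 1) → f x ≠ 0)
    (hd : ∀ x ∈ Set.Icc (0 : Fin m → ℝ) 1, f x = 0 → (fderiv ℝ f x).det ≠ 0) :
    {x ∈ Set.Icc (0 : Fin m → ℝ) 1 | f x = 0}.Finite ∧
      HasDeg f (∑ᶠ x ∈ {x ∈ Set.Icc (0 : Fin m → ℝ) 1 | f x = 0},
        (SignType.sign (fderiv ℝ f x).det : ℤ)) := by
  classical
  set Z := {x ∈ Set.Icc (0 : Fin m → ℝ) 1 | f x = 0} with hZ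
  let O : Set (Fin m → ℝ) := Set.pi Set.univ fun _ => Set.Ioo 0 1
  have hO : IsOpen O := isOpen_set_pi Set.finite_univ fun _ _ => isOpen_Ioo
  have hOI : O ⊆ Set.Icc 0 1 := fun x hx =>
    ⟨fun i => (hx i trivial).1.le, fun i => (hx i trivial).2.le⟩
  have hZO : Z ⊆ O := by
    intro x hx i _
    refine ⟨lt_of_le_of_ne (hx.1.1 i) fun h => ?_, lt_of_le_of_ne (hx.1.2 i) fun h => ?_⟩
    · exact hb x hx.1 ⟨i, .inl h.symm⟩ hx.2
    · exact hb x hx.1 ⟨i, .inr h⟩ hx.2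
  have hdet : Continuous fun x => (fderiv ℝ f x).det :=
    ContinuousLinearMap.continuous_det.comp (hf.continuous_fderiv (by simp))
  have hloc : ∀ z ∈ Z, ∃ U : Set (Fin m → ℝ), IsOpen U ∧ z ∈ U ∧ U ⊆ O ∧ Set.InjOn f U ∧
      (∀ x ∈ U, SignType.sign (fderiv ℝ f x).det = SignType.sign (fderiv ℝ f z).det) ∧
      ∀ U' ⊆ U, IsOpen U' → IsOpen (f '' U') := by
    intro z hz
    have hs : HasStrictFDerivAt f
        (((fderiv ℝ f z).toContinuousLinearEquivOfDetNeZero (hd z hz.1 hz.2) :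
          (Fin m → ℝ) ≃L[ℝ] (Fin m → ℝ)) : (Fin m → ℝ) →L[ℝ] (Fin m → ℝ)) z := by
      rw [ContinuousLinearMap.coe_toContinuousLinearEquivOfDetNeZero]
      exact hf.contDiffAt.hasStrictFDerivAt (by simp)
    let e := hs.toOpenPartialHomeomorph f
    refine ⟨e.source ∩ O ∩ {x | 0 < (fderiv ℝ f x).det * (fderiv ℝ f z).det},
      (e.open_source.inter hO).inter (isOpen_lt continuous_const (hdet.mul continuous_const)),
      ⟨⟨hs.mem_toOpenPartialHomeomorph_source, hZO hz⟩, mul_self_pos.2 (hd z hz.1 hz.2)⟩,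
      fun x hx => hx.1.2, fun x hx y hy h => e.injOn hx.1.1 hy.1.1 h, ?_,
      fun U' hU hU' => e.isOpen_image_of_subset_source hU' fun x hx => (hU hx).1.1⟩
    rintro x ⟨-, hx⟩
    have hx' : 0 < (fderiv ℝ f x).det * (fderiv ℝ f z).det := by simpa only [Set.mem_ofPred_eq] using hx
    rcases mul_pos_iff.1 hx' with ⟨h1, h2⟩ | ⟨h1, h2⟩
    · rw [sign_pos h1, sign_pos h2]
    · rw [sign_neg h1, sign_neg h2]
  have hZf : Z.Finite := by
    have hZc : IsCompact Z := isCompact_Icc.inter_right (isClosed_eq hf.continuous continuous_const)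
    refine hZc.finite ⟨discreteTopology_subtype_iff'.2 fun z hz => ?_⟩
    obtain ⟨U, hU, hzU, -, hinj, -⟩ := hloc z hz
    exact ⟨U, hU, Set.Subset.antisymm (fun x hx => hinj hx.1 hzU (hx.2.2.trans hz.2.symm))
      (Set.singleton_subset_iff.2 ⟨hzU, hz⟩)⟩
  refine ⟨hZf, ?_⟩
  obtain ⟨T, hT, hTd⟩ := hZf.t2_separation
  choose! U hU hzU hUO hinj hsign hopen using hloc
  let N : (Fin m → ℝ) → Set (Fin m → ℝ) := fun z => U z ∩ T z
  have hN : ∀ z ∈ Z, IsOpen (N z) := fun z hz => (hU z hz).inter (hT z).2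
  have hNm : ∀ z ∈ Z, z ∈ N z := fun z hz => ⟨hzU z hz, (hT z).1⟩
  have hball : ∃ δ > 0, (∀ z ∈ Z, ball 0 δ ⊆ f '' N z) ∧
      ∀ x ∈ Set.Icc (0 : Fin m → ℝ) 1, (∀ z ∈ Z, x ∉ N z) → δ ≤ ‖f x‖ := by
    have h1 : ∀ᶠ δ in 𝓝[>] (0 : ℝ), ∀ z ∈ Z, ball 0 δ ⊆ f '' N z := by
      rw [hZf.eventually_all]
      intro z hz
      have : f '' N z ∈ 𝓝 (0 : Fin m → ℝ) :=
        (hopen z hz _ Set.inter_subset_left (hN z hz)).mem_nhds ⟨z, hNm z hz, hz.2⟩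
      obtain ⟨δ, hδ, h⟩ := Metric.mem_nhds_iff.1 this
      filter_upwards [Ioo_mem_nhdsGT hδ] with t ht using (ball_subset_ball ht.2.le).trans h
    have hcK : IsCompact (Set.Icc (0 : Fin m → ℝ) 1 ∩ (⋃ z ∈ Z, N z)ᶜ) :=
      isCompact_Icc.inter_right (isOpen_biUnion hN).isClosed_compl
    obtain ⟨δ, hδ, h2⟩ := hcK.exists_forall_le' hf.continuous.norm.continuousOn (a := 0)
      fun x hx => norm_pos_iff.2 fun h => hx.2 (Set.mem_biUnion ⟨hx.1, h⟩ (hNm x ⟨hx.1, h⟩))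
    obtain ⟨t, ht1, ht2⟩ := (h1.and (Ioo_mem_nhdsGT hδ)).exists
    refine ⟨t, ht2.1, ht1, fun x hx hxN => ht2.2.le.trans (h2 x ⟨hx, ?_⟩)⟩
    simpa using hxN
  obtain ⟨δ, hδ, hδ1, hδ2⟩ := hball
  refine ⟨1 / δ, fun l hl => ?_⟩
  have hl0 : 0 < l := lt_of_lt_of_le (by positivity) hl
  have hlδ : 1 ≤ l * δ := by
    calc (1 : ℝ) = 1 / δ * δ := by field_simp
      _ ≤ l * δ := by gcongr
  have hcont : Continuous fun x => density m (l • f x) * (fderiv ℝ (fun x => l • f x) x).det := by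
    refine ((contDiff_density m).continuous.comp (hf.continuous.const_smul l)).mul ?_
    exact ContinuousLinearMap.continuous_det.comp
      ((contDiff_const.fun_smul hf).continuous_fderiv (by simp))
  have hfd : ∀ x, fderiv ℝ (fun x => l • f x) x = l • fderiv ℝ f x := fun x =>
    fderiv_fun_const_smul (hf.differentiable (by simp) x) l
  have hsub : (⋃ z ∈ hZf.toFinset, N z) ⊆ Set.Icc (0 : Fin m → ℝ) 1 :=
    Set.iUnion₂_subset fun z hz => Set.inter_subset_left.trans
      ((hUO z (hZf.mem_toFinset.1 hz)).trans hOI)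
  rw [degInt, setIntegral_eq_of_subset_of_forall_sdiff_eq_zero measurableSet_Icc hsub,
    integral_biUnion_finset, finsum_mem_eq_finite_toFinset_sum _ hZf]
  · push_cast
    refine Finset.sum_congr rfl fun z hz => ?_
    have hzZ := hZf.mem_toFinset.1 hz
    have hNU : ∀ x ∈ N z, x ∈ U z := fun x hx => hx.1
    have hpt : ∀ x ∈ N z, density m (l • f x) * (fderiv ℝ (fun x => l • f x) x).det =
        ((SignType.sign (fderiv ℝ f z).det : ℤ) : ℝ) *
          (|(l • fderiv ℝ f x).det| • density m (l • f x)) := by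
      intro x hx
      rw [hfd, smul_eq_mul, ← hsign z hzZ x (hNU x hx)]
      have hdl : (l • fderiv ℝ f x).det = l ^ m * (fderiv ℝ f x).det := by
        rw [ContinuousLinearMap.det, ContinuousLinearMap.toLinearMap_smul, LinearMap.det_smul]
        simp [ContinuousLinearMap.det]
      rw [hdl, abs_mul, abs_of_pos (pow_pos hl0 m)]
      have := sign_mul_abs (fderiv ℝ f x).det
      rw [SignType.intCast_cast]
      calc _ = density m (l • f x) * (l ^ m * (SignType.sign (fderiv ℝ f x).det *
            |(fderiv ℝ f x).det|)) := by rw [this]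
        _ = _ := by ring
    rw [setIntegral_congr_fun (hN z hzZ).measurableSet hpt, integral_const_mul,
      ← integral_image_eq_integral_abs_det_fderiv_smul volume (hN z hzZ).measurableSet
        (f := fun x => l • f x) (f' := fun x => l • fderiv ℝ f x)
        (fun x _ => ((hf.differentiable (by simp) x).hasFDerivAt.const_smul l).hasFDerivWithinAt)
        (fun x hx y hy h => hinj z hzZ (hNU x hx) (hNU y hy) (smul_right_injective _ hl0.ne' h))
        (density m)]
    rw [setIntegral_eq_integral_of_forall_compl_eq_zero, integral_density, mul_one]
    · simp
    intro y hy
    refine density_eq_zero (not_lt.1 fun h => hy ?_)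
    obtain ⟨x, hx, he⟩ := hδ1 z hzZ (show l⁻¹ • y ∈ ball 0 δ by
      rw [mem_ball_zero_iff, norm_smul, Real.norm_of_nonneg (inv_nonneg.2 hl0.le), inv_mul_lt_iff₀ hl0]
      linarith)
    exact ⟨x, hx, by simp [he, hl0.ne']⟩
  · exact fun z hz => (hN z (hZf.mem_toFinset.1 hz)).measurableSet
  · intro z hz w hw hzw
    exact (hTd (hZf.mem_toFinset.1 hz) (hZf.mem_toFinset.1 hw) hzw).mono Set.inter_subset_right
      Set.inter_subset_right
  · intro z hz
    refine (hcont.continuousOn.integrableOn_compact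
      (isCompact_Icc (a := (0 : Fin m → ℝ)) (b := 1))).mono_set ?_
    exact Set.inter_subset_left.trans ((hUO z (hZf.mem_toFinset.1 hz)).trans hOI)
  · intro x hx
    rw [density_eq_zero, zero_mul]
    rw [norm_smul, Real.norm_of_nonneg hl0.le]
    refine hlδ.trans ?_
    gcongr
    refine hδ2 x hx.1 fun z hz hxz => hx.2 ?_
    exact Set.mem_biUnion (hZf.mem_toFinset.2 hz) hxz

theorem exists_hasDeg {f : (Fin m → ℝ) → Fin m → ℝ} (hf : ContDiff ℝ 2 f)
    (hb : ∀ x ∈ Set.Icc (0 : Fin m → ℝ) 1, (∃ i, x i = 0 ∨ x i = 1) → f x ≠ 0) :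
    ∃ d, HasDeg f d := by
  have hf1 : ContDiff ℝ 1 f := hf.of_le (by norm_num)
  have hK : IsCompact {x ∈ Set.Icc (0 : Fin m → ℝ) 1 | ∃ i, x i = 0 ∨ x i = 1} := by
    have h : IsClosed (⋃ i : Fin m, {x : Fin m → ℝ | x i = 0} ∪ {x | x i = 1}) := by
      refine isClosed_iUnion_of_finite fun i => ?_
      exact (isClosed_eq (continuous_apply i) continuous_const).union
        (isClosed_eq (continuous_apply i) continuous_const)
    convert (isCompact_Icc (a := (0 : Fin m → ℝ)) (b := 1)).inter_right h using 1
    ext x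
    simp
  obtain ⟨δ, hδ, hd⟩ := hK.exists_forall_le' hf.continuous.norm.continuousOn (a := 0)
    fun x hx => norm_pos_iff.2 (hb x hx.1 hx.2)
  set C := {x | (fderiv ℝ f x).det = 0} with hC
  have h0 : volume (f '' C) = 0 := by
    refine addHaar_image_eq_zero_of_det_fderivWithin_eq_zero volume
      (fun x _ => (hf.differentiable (by simp) x).hasFDerivAt.hasFDerivWithinAt) fun x hx => ?_
    simpa [hC] using hx
  have hv : ∃ v ∈ ball (0 : Fin m → ℝ) δ, v ∉ f '' C := by
    by_contra! h
    exact (measure_ball_pos volume (0 : Fin m → ℝ) hδ).ne' (measure_mono_null h h0)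
  obtain ⟨v, hv, hvC⟩ := hv
  rw [mem_ball_zero_iff] at hv
  have hne : ∀ t ∈ Set.Icc (0 : ℝ) 1, ∀ x ∈ Set.Icc (0 : Fin m → ℝ) 1,
      (∃ i, x i = 0 ∨ x i = 1) → f x - t • v ≠ 0 := by
    intro t ht x hx hi h
    have h1 := hd x ⟨hx, hi⟩
    rw [sub_eq_zero.1 h, norm_smul, Real.norm_of_nonneg ht.1] at h1
    nlinarith [ht.2, norm_nonneg v]
  have hfd : ∀ x, fderiv ℝ (fun x => f x - v) x = fderiv ℝ f x := fun x => by
    rw [fderiv_sub_const]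
  obtain ⟨-, hdeg⟩ := hasDeg_of_nondegenerate (f := fun x => f x - v) (hf1.sub contDiff_const)
    (fun x hx hi => by simpa using hne 1 (by simp) x hx hi) fun x hx h => by
      rw [hfd]
      exact fun h0 => hvC ⟨x, by simpa [hC] using h0, sub_eq_zero.1 h⟩
  generalize (∑ᶠ x ∈ {x ∈ Set.Icc (0 : Fin m → ℝ) 1 | f x - v = 0},
    (SignType.sign (fderiv ℝ (fun x => f x - v) x).det : ℤ)) = d at hdeg
  refine ⟨d, ?_⟩
  have := HasDeg.homotopy (H := fun p => f p.2 - (1 - p.1) • v)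
    ((hf.comp contDiff_snd).sub ((contDiff_const.sub contDiff_fst).smul contDiff_const))
    (fun t ht x hx hi => hne (1 - t) ⟨by linarith [ht.2], by linarith [ht.1]⟩ x hx hi)
    (by simpa using hdeg)
  simpa using this

theorem HasDeg.neg_comp_perm (hm : Even m) {f : (Fin m → ℝ) → Fin m → ℝ} (hf : ContDiff ℝ 2 f)
    {d : ℤ} (h : HasDeg f d) (π : Equiv.Perm (Fin m)) :
    HasDeg (fun z => - f (fun i => z (π i))) (Equiv.Perm.sign π * d) := by
  obtain ⟨Λ, hΛ⟩ := h
  refine ⟨Λ, fun l hl => ?_⟩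
  let P : (Fin m → ℝ) →L[ℝ] (Fin m → ℝ) := LinearMap.toContinuousLinearMap (LinearMap.funLeft ℝ ℝ π)
  have hP : ∀ z, P z = fun i => z (π i) := fun z => rfl
  have hdet : P.det = (Equiv.Perm.sign π : ℤ) := by
    have h1 : LinearMap.funLeft ℝ ℝ π = Matrix.toLin' (π.permMatrix ℝ) := by
      ext v i
      simp [LinearMap.funLeft_apply, Pi.single_apply]
    show LinearMap.det (LinearMap.funLeft ℝ ℝ π) = _
    rw [h1, LinearMap.det_toLin', Matrix.det_permutation]
  have hPI : P '' Set.Icc 0 1 = Set.Icc (0 : Fin m → ℝ) 1 := by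
    refine Set.Subset.antisymm ?_ fun x hx => ⟨fun i => x (π.symm i), ?_, by simp [hP]⟩
    · rintro _ ⟨x, hx, rfl⟩
      exact ⟨fun i => hx.1 (π i), fun i => hx.2 (π i)⟩
    · exact ⟨fun i => hx.1 (π.symm i), fun i => hx.2 (π.symm i)⟩
  have hinj : Function.Injective P := LinearMap.funLeft_injective_of_surjective ℝ ℝ π π.surjective
  have habs : |P.det| = 1 := by
    rw [hdet]
    rcases Int.units_eq_one_or (Equiv.Perm.sign π) with h | h <;> simp [h]
  have hfd : ∀ z, (fderiv ℝ (fun z => l • - f (fun i => z (π i))) z).det =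
      Equiv.Perm.sign π * (fderiv ℝ (fun x => l • f x) (P z)).det := by
    intro z
    have h1 : HasFDerivAt (fun z => l • - f (fun i => z (π i)))
        (-((fderiv ℝ (fun x => l • f x) (P z)) ∘L P)) z := by
      have h2 := (((contDiff_const (c := l)).fun_smul hf).differentiable (by simp)
        (P z)).hasFDerivAt.comp z P.hasFDerivAt
      simpa [Function.comp_def, hP] using h2.neg
    rw [h1.fderiv, ← hdet]
    simp only [ContinuousLinearMap.det]
    rw [← neg_one_smul ℝ, ContinuousLinearMap.toLinearMap_smul, LinearMap.det_smul]
    simp [hm.neg_one_pow, ContinuousLinearMap.toLinearMap_comp, LinearMap.det_comp, mul_comm]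
  have h2 := integral_image_eq_integral_abs_det_fderiv_smul volume measurableSet_Icc
    (fun x _ => (P.hasFDerivAt (x := x)).hasFDerivWithinAt) (hinj.injOn (s := Set.Icc 0 1))
    (fun x => density m (l • f x) * (fderiv ℝ (fun x => l • f x) x).det)
  rw [hPI] at h2
  have h3 := hΛ l hl
  rw [degInt] at h3
  rw [degInt]
  push_cast
  rw [← h3, h2, ← integral_const_mul]
  refine setIntegral_congr_fun measurableSet_Icc fun x _ => ?_
  simp only [hfd, habs, one_smul]
  rw [smul_neg, density_neg, hP]
  ring

end degree

section boundary

/-- The sup-normed space in which cubes and their images live. -/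
abbrev Eu (d : ℕ) := Fin d → ℝ

variable {k : ℕ}

/-- First block of coordinates. -/
def xp (z : Eu (k + 1 + (k + 1))) : Eu (k + 1) := fun i => z (Fin.castAdd _ i)

/-- Second block of coordinates. -/
def yp (z : Eu (k + 1 + (k + 1))) : Eu (k + 1) := fun i => z (Fin.natAdd _ i)

/-- First block of coordinates without the first entry. -/
def up (z : Eu (k + 1 + (k + 1))) : Eu k := fun i => xp z i.succ

theorem contDiff_xp {N : WithTop ℕ∞} : ContDiff ℝ N (xp (k := k)) :=
  contDiff_pi.2 fun _ => contDiff_apply ℝ ℝ _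

theorem contDiff_yp {N : WithTop ℕ∞} : ContDiff ℝ N (yp (k := k)) :=
  contDiff_pi.2 fun _ => contDiff_apply ℝ ℝ _

theorem contDiff_up {N : WithTop ℕ∞} : ContDiff ℝ N (up (k := k)) :=
  contDiff_pi.2 fun _ => contDiff_apply ℝ ℝ _

/-- The permutation exchanging the two blocks, the first entry of the first block kept fixed. -/
def blockSwap (k : ℕ) : Equiv.Perm (Fin (k + 1 + (k + 1))) where
  toFun i := ⟨if i.1 = 0 then 0 else if i.1 < k + 1 then i + (k + 1) else i - k, by
    split_ifs <;> omega⟩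
  invFun j := ⟨if j.1 = 0 then 0 else if j.1 < k + 2 then j + k else j - (k + 1), by
    split_ifs <;> omega⟩
  left_inv i := by
    ext
    dsimp only
    grind
  right_inv i := by
    ext
    dsimp only
    grind

theorem blockSwap_left (l : Fin k) :
    blockSwap k (Fin.castAdd (k + 1) l.succ) = Fin.natAdd (k + 1) l.succ := by
  ext
  simp only [blockSwap, Equiv.coe_fn_mk, Fin.val_castAdd, Fin.val_succ, Fin.val_natAdd]
  split_ifs <;> omega

theorem blockSwap_right (i : Fin (k + 1)) :
    blockSwap k (Fin.natAdd (k + 1) i) = ⟨i + 1, by omega⟩ := by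
  ext
  simp only [blockSwap, Equiv.coe_fn_mk, Fin.val_natAdd]
  split_ifs <;> omega

theorem exists_boundary_formula (k : ℕ) : ∃ s : ℤ, ∀ {H : ℝ × Eu (k + 1) × Eu (k + 1) → Eu (k + 1 + (k + 1))},
    ContDiff ℝ 2 H → ∀ {o₀ o₁ : ℤ} {p q : Fin (k + 1) → Bool → ℤ},
    HasDeg (fun z => H (0, xp z, yp z)) o₀ → HasDeg (fun z => H (1, xp z, yp z)) o₁ →
    (∀ j b, HasDeg (fun z => H (z 0, j.insertNth (α := fun _ => ℝ) (cond b 1 0) (up z), yp z)) (p j b)) →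
    (∀ j b, HasDeg (fun z => -H (z 0, yp z, j.insertNth (α := fun _ => ℝ) (cond b 1 0) (up z))) (q j b)) →
    o₁ - o₀ = ∑ j : Fin (k + 1), (-1) ^ (j : ℕ) * (p j true - p j false) +
      s * ∑ j : Fin (k + 1), (-1) ^ (j : ℕ) * (q j true - q j false) := by
  refine ⟨(-1) ^ (k + 1) * Equiv.Perm.sign (blockSwap k), ?_⟩
  intro H hH o₀ o₁ p q h0 h1 hp hq
  let g : Eu (k + 1 + (k + 1) + 1) → Eu (k + 1 + (k + 1)) := fun Z =>
    H (Z 0, fun i => Z (Fin.succ (Fin.castAdd _ i)), fun i => Z (Fin.succ (Fin.natAdd _ i)))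
  have hg : ContDiff ℝ 2 g := hH.comp ((contDiff_apply ℝ ℝ _).prodMk
    ((contDiff_pi.2 fun _ => contDiff_apply ℝ ℝ _).prodMk
      (contDiff_pi.2 fun _ => contDiff_apply ℝ ℝ _)))
  have hx : ∀ (j : Fin (k + 1)) (c : ℝ) (z : Eu (k + 1 + (k + 1))),
      g ((Fin.castAdd (k + 1) j).succ.insertNth (α := fun _ => ℝ) c z) =
        H (z 0, j.insertNth (α := fun _ => ℝ) c (up z), yp z) := by
    intro j c z
    have e0 : (0 : Fin (k + 1 + (k + 1) + 1)) =
        (Fin.castAdd (k + 1) j).succ.succAbove 0 := by simp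
    have e1 : ∀ l : Fin k, (Fin.castAdd (k + 1) (j.succAbove l)).succ =
        (Fin.castAdd (k + 1) j).succ.succAbove (Fin.castAdd (k + 1) l.succ) := by
      intro l
      ext
      simp only [Fin.succAbove, Fin.lt_def, Fin.val_succ, Fin.val_castAdd, Fin.val_castSucc]
      split_ifs <;> simp <;> omega
    have e2 : ∀ i : Fin (k + 1), (Fin.natAdd (k + 1) i).succ =
        (Fin.castAdd (k + 1) j).succ.succAbove (Fin.natAdd (k + 1) i) := by
      intro l
      ext
      simp only [Fin.succAbove, Fin.lt_def, Fin.val_succ, Fin.val_castAdd, Fin.val_castSucc, Fin.val_natAdd]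
      split_ifs <;> simp <;> omega
    simp only [g]
    refine congrArg H (Prod.ext ?_ (Prod.ext ?_ ?_))
    · simp only
      rw [e0, Fin.insertNth_apply_succAbove]
    · ext i
      refine Fin.succAboveCases j ?_ (fun l => ?_) i
      · simp
      · dsimp only
        rw [e1, Fin.insertNth_apply_succAbove, Fin.insertNth_apply_succAbove]
        rfl
    · ext i
      dsimp only
      rw [e2, Fin.insertNth_apply_succAbove]
      rfl
  have hy : ∀ (j : Fin (k + 1)) (c : ℝ) (z : Eu (k + 1 + (k + 1))),
      g ((Fin.natAdd (k + 1) j).succ.insertNth (α := fun _ => ℝ) c z) =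
        H (z (blockSwap k 0), yp (fun i => z (blockSwap k i)),
          j.insertNth (α := fun _ => ℝ) c (up fun i => z (blockSwap k i))) := by
    intro j c z
    have e0 : (0 : Fin (k + 1 + (k + 1) + 1)) =
        (Fin.natAdd (k + 1) j).succ.succAbove 0 := by simp
    have e1 : ∀ l : Fin k, (Fin.natAdd (k + 1) (j.succAbove l)).succ =
        (Fin.natAdd (k + 1) j).succ.succAbove (blockSwap k (Fin.castAdd (k + 1) l.succ)) := by
      intro l
      ext
      simp only [blockSwap_left, Fin.succAbove, Fin.lt_def, Fin.val_succ,
        Fin.val_natAdd, Fin.val_castSucc]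
      split_ifs <;> simp <;> omega
    have e2 : ∀ i : Fin (k + 1), (Fin.castAdd (k + 1) i).succ =
        (Fin.natAdd (k + 1) j).succ.succAbove (blockSwap k (Fin.natAdd (k + 1) i)) := by
      intro l
      ext
      simp only [blockSwap_right, Fin.succAbove, Fin.lt_def, Fin.val_succ,
        Fin.val_natAdd, Fin.val_castSucc, Fin.val_castAdd]
      split_ifs
      all_goals simp
      all_goals omega
    have e3 : blockSwap k 0 = 0 := by simp [blockSwap]
    simp only [g]
    refine congrArg H (Prod.ext ?_ (Prod.ext ?_ ?_))
    · simp only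
      rw [e0, Fin.insertNth_apply_succAbove, e3]
    · ext i
      dsimp only
      rw [e2, Fin.insertNth_apply_succAbove]
      rfl
    · ext i
      refine Fin.succAboveCases j ?_ (fun l => ?_) i
      · simp
      · dsimp only
        rw [e1, Fin.insertNth_apply_succAbove, Fin.insertNth_apply_succAbove]
        rfl
  have hm : Even (k + 1 + (k + 1)) := ⟨k + 1, rfl⟩
  have hsm : ∀ (j : Fin (k + 1)) (c : ℝ),
      ContDiff ℝ 2 fun z => -H (z 0, yp z, j.insertNth (α := fun _ => ℝ) c (up z)) := fun j c =>
    (hH.comp ((contDiff_apply ℝ ℝ _).prodMk (contDiff_yp.prodMk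
      ((contDiff_insertNth _ _).comp contDiff_up)))).neg
  let d : Bool → Fin (k + 1 + (k + 1) + 1) → ℤ := fun b => Fin.cons (cond b o₁ o₀)
    (Fin.append (fun j => p j b) fun j => Equiv.Perm.sign (blockSwap k) * q j b)
  have hd : ∀ b i, HasDeg (fun x => g (i.insertNth (α := fun _ => ℝ) (cond b 1 0) x)) (d b i) := by
    intro b i
    induction i using Fin.cases with
    | zero =>
      have : (fun x => g ((0 : Fin _).insertNth (α := fun _ => ℝ) (cond b 1 0) x)) =
          fun z => H (cond b 1 0, xp z, yp z) := by
        funext z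
        simp only [g, Fin.insertNth_zero', Fin.cons_zero, Fin.cons_succ]
        rfl
      rw [this]
      cases b <;> simpa [d]
    | succ i =>
      induction i using Fin.addCases with
      | left j => simpa [d, hx] using hp j b
      | right j =>
        simp only [d, Fin.cons_succ, Fin.append_right, hy]
        simpa using (hq j b).neg_comp_perm hm (hsm j _) (blockSwap k)
  have hs := sum_hasDeg_faces hg (hd false) (hd true)
  rw [Fin.sum_univ_succ, Fin.sum_univ_add] at hs
  simp only [d, Fin.cons_zero, Fin.cons_succ, Fin.append_left, Fin.append_right, Fin.val_zero,
    pow_zero, one_mul, cond_true, cond_false, Fin.val_succ, Fin.val_castAdd, Fin.val_natAdd] at hs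
  have e4 : ∀ x : Fin (k + 1), (-1 : ℤ) ^ (k + 1 + (x : ℕ) + 1) * (Equiv.Perm.sign (blockSwap k) * q x true -
      Equiv.Perm.sign (blockSwap k) * q x false) = -((-1) ^ (k + 1) * Equiv.Perm.sign (blockSwap k) *
        ((-1) ^ (x : ℕ) * (q x true - q x false))) := fun x => by ring
  have e5 : ∀ x : Fin (k + 1), (-1 : ℤ) ^ ((x : ℕ) + 1) * (p x true - p x false) =
      -((-1) ^ (x : ℕ) * (p x true - p x false)) := fun x => by ring
  simp only [e4, e5, Finset.sum_neg_distrib, ← Finset.mul_sum] at hs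
  linarith

end boundary

section path
variable {E V ι : Type*} [NormedAddCommGroup E] [NormedSpace ℝ E] [FiniteDimensional ℝ E]
  [NormedAddCommGroup V] [NormedSpace ℝ V] [FiniteDimensional ℝ V]

theorem exists_path [Countable ι] {q : ι → E → V} (hq : ∀ i, ContDiff ℝ 1 (q i))
    (hd : Module.finrank ℝ E + 2 < Module.finrank ℝ V) {φ : V →L[ℝ] ℝ} {w k : V} (hw : φ w = 1)
    (hk : φ k = 0) (z : V) :
    ∃ c : ℝ → V, ContDiff ℝ 2 c ∧ c 0 = 0 ∧ c 1 = w ∧ HasDerivAt c (w + k) 1 ∧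
      (∀ s, φ (c s) = s) ∧ ∀ s, 0 < s → s ≠ 1 → ∀ i y, z + c s ≠ q i y := by
  let K := LinearMap.ker (φ : V →ₗ[ℝ] ℝ)
  have hφ : (φ : V →ₗ[ℝ] ℝ) ≠ 0 := fun h => by
    have := LinearMap.congr_fun h w
    simp [hw] at this
  have hK : Module.finrank ℝ K + 1 = Module.finrank ℝ V := Module.Dual.finrank_ker_add_one_of_ne_zero hφ
  let P : V →L[ℝ] K := (ContinuousLinearMap.id ℝ V - φ.smulRight w).codRestrict K fun u => by
    simp [K, hw]
  have hP : ∀ u ∈ K, (P u : V) = u := fun u hu => by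
    have : φ u = 0 := hu
    simp [P, this]
  let θ : Bool → ℝ → ℝ := fun b r => if b then 1 + Real.exp r else (1 + Real.exp r)⁻¹
  have hθ : ∀ b, ContDiff ℝ 1 (θ b) := by
    have h1 : ContDiff ℝ 1 fun r : ℝ => 1 + Real.exp r := contDiff_const.add Real.contDiff_exp
    intro b
    cases b
    · exact h1.inv fun r => by positivity
    · exact h1
  have hθ0 : ∀ b r, θ b r ≠ 0 ∧ θ b r - 1 ≠ 0 := by
    intro b r
    have hr := Real.exp_pos r
    cases b
    · refine ⟨by simp only [θ]; positivity, ?_⟩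
      have : (1 + Real.exp r)⁻¹ < 1 := inv_lt_one_of_one_lt₀ (by linarith)
      simp only [θ, Bool.false_eq_true, if_false]
      linarith
    · refine ⟨by simp only [θ]; positivity, by simp [θ]⟩
  have hθs : ∀ s, 0 < s → s ≠ 1 → ∃ b r, θ b r = s := by
    intro s hs h1
    rcases lt_or_gt_of_ne h1 with h | h
    · refine ⟨false, Real.log (s⁻¹ - 1), ?_⟩
      have : 1 < s⁻¹ := (one_lt_inv₀ hs).2 h
      simp [θ, Real.exp_log (sub_pos.2 this)]
    · exact ⟨true, Real.log (s - 1), by simp [θ, Real.exp_log (sub_pos.2 h)]⟩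
  let F : ι × Bool → ℝ × E → K := fun i p => P ((θ i.2 p.1 * (θ i.2 p.1 - 1) ^ 2)⁻¹ •
    (q i.1 p.2 - z - θ i.2 p.1 • w - (θ i.2 p.1 * (θ i.2 p.1 - 1)) • k))
  have hF : ∀ i, ContDiff ℝ 1 (F i) := by
    intro i
    have h1 : ContDiff ℝ 1 fun p : ℝ × E => θ i.2 p.1 := (hθ i.2).comp contDiff_fst
    refine P.contDiff.comp (ContDiff.smul (ContDiff.inv (h1.mul ((h1.sub contDiff_const).pow 2)) ?_) ?_)
    · intro p
      have := hθ0 i.2 p.1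
      exact mul_ne_zero this.1 (pow_ne_zero 2 this.2)
    · exact ((((hq i.1).comp contDiff_snd).sub contDiff_const).sub (h1.smul contDiff_const)).sub
        ((h1.mul (h1.sub contDiff_const)).smul contDiff_const)
  obtain ⟨b, hb⟩ := (dense_compl_iUnion_range hF (by
    rw [Module.finrank_prod, Module.finrank_self]; omega)).nonempty
  have hbk : φ b = 0 := b.2
  refine ⟨fun s => s • w + (s * (s - 1)) • k + (s * (s - 1) ^ 2) • (b : V), ?_, by simp, by simp,
    ?_, fun s => by simp [hw, hk, hbk], ?_⟩
  · exact ((contDiff_id.smul contDiff_const).add ((contDiff_id.mul (contDiff_id.sub contDiff_const)).smul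
      contDiff_const)).add ((contDiff_id.mul ((contDiff_id.sub contDiff_const).pow 2)).smul contDiff_const)
  · have h1 : HasDerivAt (fun s : ℝ => s) 1 1 := hasDerivAt_id 1
    have h2 : HasDerivAt (fun s : ℝ => s * (s - 1)) 1 1 := by
      simpa using h1.fun_mul (h1.sub_const 1)
    have h3 : HasDerivAt (fun s : ℝ => s * (s - 1) ^ 2) 0 1 := by
      simpa using h1.fun_mul ((h1.sub_const 1).fun_pow 2)
    simpa using ((h1.smul_const w).fun_add (h2.smul_const k)).fun_add (h3.smul_const (b : V))
  · intro s hs hs1 i y h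
    obtain ⟨c, r, rfl⟩ := hθs s hs hs1
    refine hb (Set.mem_iUnion.2 ⟨(i, c), (r, y), ?_⟩)
    have h0 := hθ0 c r
    have h2 : q i y - z - θ c r • w - (θ c r * (θ c r - 1)) • k =
        (θ c r * (θ c r - 1) ^ 2) • (b : V) := by
      rw [← h]
      module
    refine Subtype.ext ?_
    simp only [F]
    rw [h2, inv_smul_smul₀ (mul_ne_zero h0.1 (pow_ne_zero 2 h0.2)), hP _ b.2]

end path

section functional
variable {k : ℕ}

/-- Assemble a point of the product from its first entry and the two remaining blocks. -/
def glue (t : ℝ) (u : Eu k) (y : Eu (k + 1)) : Eu (k + 1 + (k + 1)) :=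
  Fin.append (Fin.cons t u : Eu (k + 1)) y

@[simp] theorem glue_zero (t : ℝ) (u : Eu k) (y : Eu (k + 1)) : glue t u y 0 = t := by
  have : (0 : Fin (k + 1 + (k + 1))) = Fin.castAdd (k + 1) 0 := rfl
  rw [glue, this, Fin.append_left]
  rfl

@[simp] theorem up_glue (t : ℝ) (u : Eu k) (y : Eu (k + 1)) : up (glue t u y) = u := by
  ext i
  simp only [up, xp, glue, Fin.append_left, Fin.cons_succ]

@[simp] theorem yp_glue (t : ℝ) (u : Eu k) (y : Eu (k + 1)) : yp (glue t u y) = y := by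
  ext i
  simp only [yp, glue, Fin.append_right]

@[simp] theorem glue_self (z : Eu (k + 1 + (k + 1))) : glue (z 0) (up z) (yp z) = z := by
  ext i
  induction i using Fin.addCases with
  | left i =>
    rw [glue, Fin.append_left]
    induction i using Fin.cases with
    | zero => rfl
    | succ i => rfl
  | right i => simp only [glue, Fin.append_right, yp]

theorem continuous_glue : Continuous fun p : ℝ × Eu k × Eu (k + 1) => glue p.1 p.2.1 p.2.2 := by
  refine continuous_pi fun i => ?_
  induction i using Fin.addCases with
  | left i =>
    simp only [glue, Fin.append_left]
    induction i using Fin.cases with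
    | zero => exact continuous_fst
    | succ i => exact (continuous_apply i).comp (continuous_fst.comp continuous_snd)
  | right i =>
    simp only [glue, Fin.append_right]
    exact (continuous_apply i).comp (continuous_snd.comp continuous_snd)

/-- The derivative of `glue t u y ↦ b u - a y - c t`. -/
noncomputable def tipMap (B : Eu k →L[ℝ] Eu (k + 1 + (k + 1))) (A : Eu (k + 1) →L[ℝ] Eu (k + 1 + (k + 1)))
    (v : Eu (k + 1 + (k + 1))) : Eu (k + 1 + (k + 1)) →L[ℝ] Eu (k + 1 + (k + 1)) :=
  B ∘L ContinuousLinearMap.pi (fun i => ContinuousLinearMap.proj (Fin.castAdd (k + 1) i.succ)) -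
    A ∘L ContinuousLinearMap.pi (fun i => ContinuousLinearMap.proj (Fin.natAdd (k + 1) i)) -
    (ContinuousLinearMap.proj (R := ℝ) (φ := fun _ => ℝ) (0 : Fin (k + 1 + (k + 1)))).smulRight v

variable {B : Eu k →L[ℝ] Eu (k + 1 + (k + 1))} {A : Eu (k + 1) →L[ℝ] Eu (k + 1 + (k + 1))}

theorem tipMap_apply (v z : Eu (k + 1 + (k + 1))) :
    tipMap B A v z = B (up z) - A (yp z) - z 0 • v := rfl

theorem exists_det_tipMap (B : Eu k →L[ℝ] Eu (k + 1 + (k + 1)))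
    (A : Eu (k + 1) →L[ℝ] Eu (k + 1 + (k + 1))) :
    ∃ Λ : Eu (k + 1 + (k + 1)) →ₗ[ℝ] ℝ, ∀ v, (tipMap B A v).det = Λ v := by
  classical
  let w : Fin (k + 1 + (k + 1)) → Eu (k + 1 + (k + 1)) := fun i => tipMap B A 0 (Pi.single i 1)
  refine ⟨((detForm _).toMultilinearMap.toLinearMap w 0) ∘ₗ (-LinearMap.id), fun v => ?_⟩
  rw [← detForm_clm]
  show _ = detForm _ (Function.update w 0 (-v))
  congr 1
  funext i
  by_cases hi : i = 0
  · subst hi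
    have h1 : up (Pi.single 0 1 : Eu (k + 1 + (k + 1))) = 0 := by
      ext i
      simp only [up, xp, Pi.zero_apply]
      exact Pi.single_eq_of_ne (by simp [Fin.ext_iff]) _
    have h2 : yp (Pi.single 0 1 : Eu (k + 1 + (k + 1))) = 0 := by
      ext i
      simp only [yp, Pi.zero_apply]
      refine Pi.single_eq_of_ne (Fin.ne_of_val_ne ?_) _
      simp only [Fin.val_natAdd, Fin.val_zero]
      omega
    simp [tipMap_apply, h1, h2]
  · simp [Function.update_of_ne hi, w, tipMap_apply, Pi.single_eq_of_ne (Ne.symm hi)]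

theorem exists_functional (hk : 0 < k) (hBA : ∀ u y, B u = A y → u = 0 ∧ y = 0)
    {w : Eu (k + 1 + (k + 1))} (hw : w ∉ Set.range A) (η : ℤ) :
    ∃ (φ : Eu (k + 1 + (k + 1)) →L[ℝ] ℝ) (k₀ : Eu (k + 1 + (k + 1))), (∀ y, φ (A y) = 0) ∧
      φ w = 1 ∧ φ k₀ = 0 ∧ (tipMap B A (w + k₀)).det = η := by
  obtain ⟨Λ, hΛ⟩ := exists_det_tipMap B A
  have hu0 : up (0 : Eu (k + 1 + (k + 1))) = 0 := rfl
  have hy0 : yp (0 : Eu (k + 1 + (k + 1))) = 0 := rfl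
  have hΛB : ∀ u, Λ (B u) = 0 := by
    intro u
    rw [← hΛ]
    by_contra h
    have h1 := (ContinuousLinearMap.toContinuousLinearEquivOfDetNeZero _ h).injective
      (a₁ := glue 1 u 0) (a₂ := 0) (by simp [tipMap_apply, hu0, hy0])
    have := congrFun h1 0
    simp at this
  have hΛ0 : ∃ v, Λ v ≠ 0 := by
    have hr : LinearMap.range (B.coprod A).toLinearMap ≠ ⊤ := by
      intro h
      have h1 := LinearMap.finrank_range_le (B.coprod A).toLinearMap
      rw [h, finrank_top] at h1
      simp at h1
    obtain ⟨v, hv⟩ : ∃ v, v ∉ LinearMap.range (B.coprod A).toLinearMap := by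
      by_contra! h
      exact hr (eq_top_iff.2 fun v _ => h v)
    refine ⟨v, ?_⟩
    rw [← hΛ]
    have hinj : Function.Injective (tipMap B A v).toLinearMap := by
      rw [← LinearMap.ker_eq_bot, LinearMap.ker_eq_bot']
      intro z hz
      have hz' : B (up z) - A (yp z) - z 0 • v = 0 := hz
      have h0 : z 0 = 0 := by
        by_contra h0
        refine hv ⟨((z 0)⁻¹ • up z, -((z 0)⁻¹ • yp z)), ?_⟩
        have : v = (z 0)⁻¹ • (B (up z) - A (yp z)) := by
          rw [sub_eq_zero.1 hz', inv_smul_smul₀ h0]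
        rw [this]
        simp [sub_eq_add_neg]
      rw [h0, zero_smul, sub_zero, sub_eq_zero] at hz'
      obtain ⟨h1, h2⟩ := hBA _ _ hz'
      rw [← glue_self z, h0, h1, h2]
      rw [← glue_self (0 : Eu (k + 1 + (k + 1)))]
      rfl
    exact (LinearEquiv.ofInjectiveEndo _ hinj).isUnit_det'.ne_zero
  obtain ⟨v, hv⟩ := hΛ0
  let d := B (Pi.single ⟨0, hk⟩ 1)
  have hd : d ∉ LinearMap.range A.toLinearMap := by
    rintro ⟨y, hy⟩
    have := congrFun (hBA _ y hy.symm).1 ⟨0, hk⟩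
    simp at this
  have hw' : w ∉ LinearMap.range A.toLinearMap := hw
  obtain ⟨φ, hφA, hφw, hφd⟩ : ∃ φ : Eu (k + 1 + (k + 1)) →ₗ[ℝ] ℝ,
      (∀ y, φ (A y) = 0) ∧ φ w ≠ 0 ∧ φ d ≠ 0 := by
    obtain ⟨φ₁, h1, h1'⟩ := Submodule.exists_le_ker_of_notMem hw'
    obtain ⟨φ₂, h2, h2'⟩ := Submodule.exists_le_ker_of_notMem hd
    have a1 : ∀ y, φ₁ (A y) = 0 := fun y => h1' ⟨y, rfl⟩
    have a2 : ∀ y, φ₂ (A y) = 0 := fun y => h2' ⟨y, rfl⟩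
    by_cases b1 : φ₁ d = 0
    · by_cases b2 : φ₂ w = 0
      · exact ⟨φ₁ + φ₂, by simp [a1, a2], by simpa [b2] using h1, by simpa [b1] using h2⟩
      · exact ⟨φ₂, a2, b2, h2⟩
    · exact ⟨φ₁, a1, h1, b1⟩
  obtain ⟨k₁, hk₁, hk₁'⟩ : ∃ k₁, φ k₁ = 0 ∧ Λ k₁ ≠ 0 := by
    refine ⟨v - (φ v / φ d) • d, by simp [hφd], ?_⟩
    have : Λ d = 0 := hΛB _
    simpa [this] using hv
  refine ⟨LinearMap.toContinuousLinearMap ((φ w)⁻¹ • φ), ((η - Λ w) / Λ k₁) • k₁, ?_, ?_, ?_, ?_⟩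
  · simp [hφA]
  · simp [hφw]
  · simp [hk₁]
  · rw [hΛ, map_add, map_smul, smul_eq_mul, div_mul_cancel₀ _ hk₁']
    ring

end functional

section

/-- The space in which maps of `(k + 1)`-dimensional cubes are separated. -/
abbrev Amb (k : ℕ) := Eu (k + 1 + (k + 1))

/-- The centre of the unit cube. -/
noncomputable def ctr (k : ℕ) : Eu k := fun _ => 1 / 2

variable {k : ℕ}

theorem ctr_mem : ctr k ∈ Set.Icc (0 : Eu k) 1 :=
  ⟨fun i => by simp [ctr], fun i => by simp only [ctr, Pi.one_apply]; norm_num⟩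

theorem two_smul_det_tipMap (B : Eu k →L[ℝ] Amb k) (A : Eu (k + 1) →L[ℝ] Amb k) (v : Amb k) :
    (tipMap B A ((2 : ℝ) • v)).det = 2 * (tipMap B A v).det := by
  obtain ⟨Λ, hΛ⟩ := exists_det_tipMap B A
  rw [hΛ, hΛ, map_smul, smul_eq_mul]

theorem hasFDerivAt_tip (B : Eu k →L[ℝ] Amb k) (A : Eu (k + 1) →L[ℝ] Amb k) {b c : Amb k}
    {γ : ℝ → Amb k} {v : Amb k} {z : Amb k} (h : HasDerivAt γ v (z 0)) :
    HasFDerivAt (fun z : Amb k => (b + B (up z)) - (c + A (yp z)) - γ (z 0)) (tipMap B A v) z := by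
  have h0 : HasFDerivAt (fun z : Amb k => z 0) (ContinuousLinearMap.proj (R := ℝ)
      (φ := fun _ => ℝ) (0 : Fin (k + 1 + (k + 1)))) z := hasFDerivAt_apply 0 z
  have h1 : HasFDerivAt (fun z : Amb k => γ (z 0)) _ z := h.hasFDerivAt.comp z h0
  have h2 : HasFDerivAt (fun z : Amb k => b + B (up z)) _ z :=
    (ContinuousLinearMap.hasFDerivAt (B ∘L ContinuousLinearMap.pi
      (fun i => ContinuousLinearMap.proj (R := ℝ) (φ := fun _ => ℝ)
        (Fin.castAdd (k + 1) i.succ : Fin (k + 1 + (k + 1))))) (x := z)).const_add b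
  have h3 : HasFDerivAt (fun z : Amb k => c + A (yp z)) _ z :=
    (ContinuousLinearMap.hasFDerivAt (A ∘L ContinuousLinearMap.pi
      (fun i => ContinuousLinearMap.proj (R := ℝ) (φ := fun _ => ℝ)
        (Fin.natAdd (k + 1) i : Fin (k + 1 + (k + 1))))) (x := z)).const_add c
  refine ((h2.sub h3).sub h1).congr_fderiv ?_
  ext x
  simp [tipMap]

/-- The set of pairs controlled by the finger. -/
theorem exists_finger_radius {κ : Type*} [Finite κ] (hk : 1 < k) {f : Eu (k + 1) → Amb k}
    (hf : ContDiff ℝ 2 f) (hinj : Set.InjOn f (Set.Icc 0 1)) {y₀ : Eu (k + 1)} {r₀ : ℝ} (hr₀ : 0 < r₀)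
    (hball : closedBall y₀ r₀ ⊆ Set.Icc 0 1)
    {α : Amb k} {A : Eu (k + 1) →L[ℝ] Amb k}
    (hfa : ∀ y ∈ closedBall y₀ r₀, f y = α + A y)
    {β : κ → Amb k} {B : κ → Eu k →L[ℝ] Amb k}
    {FL : Set κ} (hfl : ∀ c ∈ FL, ∀ y ∈ Set.Icc (0 : Eu (k + 1)) 1, ∀ u ∈ Set.Icc (0 : Eu k) 1,
      f y ≠ β c + B c u) {ρ : κ} (hρ : ρ ∈ FL) (hBA : ∀ u y, B ρ u = A y → u = 0 ∧ y = 0)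
    (hρc : ∀ c, c ≠ ρ → ∀ u ∈ Set.Icc (0 : Eu k) 1, β c + B c u ≠ β ρ + B ρ (ctr k))
    (hρa : ∀ y, α + A y ≠ β ρ + B ρ (ctr k)) {η : ℤ} (hη : η ≠ 0) :
    ∃ (φ : Amb k →L[ℝ] ℝ) (c : ℝ → Amb k) (v : Amb k) (r : ℝ), (∀ y, φ (A y) = 0) ∧
      (∀ s, φ (c s) = s) ∧ ContDiff ℝ 2 c ∧ c 0 = 0 ∧
      f y₀ + c 1 = β ρ + B ρ (ctr k) ∧ HasDerivAt c v 1 ∧ (tipMap (B ρ) A v).det = η ∧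
      0 < r ∧ r < r₀ ∧ ∀ y ∈ ball y₀ r, ∀ s ∈ Set.Icc (0 : ℝ) 2,
        (∀ i ∈ FL, i ≠ ρ → ∀ u ∈ Set.Icc (0 : Eu k) 1, f y + c s ≠ β i + B i u) ∧
        (∀ y' ∈ Set.Icc (0 : Eu (k + 1)) 1, y' ∉ ball y₀ r₀ → f y + c s ≠ f y') ∧
        (∀ u ∈ Set.Icc (0 : Eu k) 1, f y + c s = β ρ + B ρ u → s = 1 ∧ u = ctr k ∧ y = y₀) := by
  have hy₀ : y₀ ∈ closedBall y₀ r₀ := mem_closedBall_self hr₀.le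
  have hy₀Q := hball hy₀
  set p := β ρ + B ρ (ctr k) with hp
  obtain ⟨φ, k₀, hφA, hφw, hφk, hdet⟩ := exists_functional (B := B ρ) (A := A) (by omega) hBA
    (w := p - f y₀) (by
      rintro ⟨y, hy⟩
      refine hρa (y + y₀) ?_
      rw [map_add, hy, hfa _ hy₀]
      abel) η
  let q : κ ⊕ Unit → Eu (k + 1) → Amb k := fun i => i.elim (fun i y => β i + B i (Fin.tail y)) fun _ => f
  have hq : ∀ i, ContDiff ℝ 1 (q i) := by
    rintro (i | i)
    · exact contDiff_const.add ((B i).contDiff.comp (contDiff_pi.2 fun j => contDiff_apply ℝ ℝ _))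
    · exact hf.of_le (by norm_num)
  obtain ⟨c, hc, hc0, hc1, hcd, hφc, hcq⟩ := exists_path (k := k₀) hq (by simp; omega) hφw hφk (f y₀)
  have hqk : ∀ i u, q (Sum.inl i) (Fin.cons 0 u : Eu (k + 1)) = β i + B i u := fun i u => rfl
  have hfc : Continuous f := hf.continuous
  have hcc : Continuous c := hc.continuous
  have hp1 : f y₀ + c 1 = p := by rw [hc1]; abel
  have hBinj : ∀ u, β ρ + B ρ u = p → u = ctr k := by
    intro u hu
    have : B ρ (u - ctr k) = A 0 := by
      rw [map_sub, map_zero, sub_eq_zero]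
      exact add_left_cancel hu
    exact sub_eq_zero.1 (hBA _ _ this).1
  have cases : ∀ s ∈ Set.Icc (0 : ℝ) 2, s = 0 ∨ s = 1 ∨ 0 < s ∧ s ≠ 1 := by
    intro s hs
    rcases hs.1.eq_or_lt with h | h
    · exact Or.inl h.symm
    · by_cases h1 : s = 1
      · exact Or.inr (Or.inl h1)
      · exact Or.inr (Or.inr ⟨h, h1⟩)
  have e1 : ∀ i, i ∈ FL → i ≠ ρ → ∀ᶠ y in 𝓝 y₀, ∀ x ∈ Set.Icc (0 : ℝ) 2 ×ˢ Set.Icc (0 : Eu k) 1,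
      f y + c x.1 ≠ β i + B i x.2 := by
    intro i hi hiρ
    refine (isCompact_Icc.prod isCompact_Icc).eventually_forall_of_forall_eventually fun x hx => ?_
    refine (ContinuousAt.ne_iff_eventually_ne ?_ ?_).1 ?_
    · fun_prop
    · fun_prop
    · rcases cases _ hx.1 with h | h | h
      · simpa [h, hc0] using hfl i hi y₀ hy₀Q _ hx.2
      · simpa only [h, hp1] using (hρc i hiρ _ hx.2).symm
      · simpa only [hqk] using hcq _ h.1 h.2 (Sum.inl i) (Fin.cons 0 x.2 : Eu (k + 1))
  have e2 : ∀ᶠ y in 𝓝 y₀, ∀ x ∈ Set.Icc (0 : ℝ) 2 ×ˢ (Set.Icc (0 : Eu (k + 1)) 1 \ ball y₀ r₀),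
      f y + c x.1 ≠ f x.2 := by
    refine (isCompact_Icc.prod (isCompact_Icc.diff isOpen_ball)).eventually_forall_of_forall_eventually
      fun x hx => ?_
    refine (ContinuousAt.ne_iff_eventually_ne ?_ ?_).1 ?_
    · fun_prop
    · fun_prop
    · rcases cases _ hx.1 with h | h | h
      · simp only [h, hc0, add_zero]
        intro h'
        refine hx.2.2 ?_
        rw [← hinj hy₀Q hx.2.1 h']
        exact mem_ball_self hr₀
      · simpa only [h, hp1] using (hfl ρ hρ _ hx.2.1 _ ctr_mem).symm
      · exact hcq _ h.1 h.2 (Sum.inr ()) x.2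
  have e3 : ∀ᶠ y in 𝓝 y₀, ∀ x ∈ Set.Icc (0 : ℝ) 2 ×ˢ Set.Icc (0 : Eu k) 1,
      f y + c x.1 = β ρ + B ρ x.2 → x.1 = 1 ∧ x.2 = ctr k ∧ y = y₀ := by
    refine (isCompact_Icc.prod isCompact_Icc).eventually_forall_of_forall_eventually fun x hx => ?_
    by_cases hx1 : x.1 = 1 ∧ x.2 = ctr k
    · have hd := hasFDerivAt_tip (B ρ) A (b := β ρ) (c := α) (z := glue 1 (ctr k) y₀) (by rwa [glue_zero])
      have hdet' : (tipMap (B ρ) A (p - f y₀ + k₀)).det ≠ 0 := by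
        rw [hdet]
        exact_mod_cast hη
      have hne := hd.eventually_ne (c := β ρ + B ρ (ctr k) - (α + A y₀) - c 1) (by
        let e := ContinuousLinearMap.toContinuousLinearEquivOfDetNeZero _ hdet'
        exact ⟨_, e.antilipschitz⟩)
      rw [eventually_nhdsWithin_iff] at hne
      have ht : Filter.Tendsto (fun z : Eu (k + 1) × ℝ × Eu k => glue z.2.1 z.2.2 z.1)
          (𝓝 (y₀, x)) (𝓝 (glue 1 (ctr k) y₀)) := by
        rw [← hx1.1, ← hx1.2]
        exact (continuous_glue.comp (continuous_snd.fst.prodMk (continuous_snd.snd.prodMk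
          continuous_fst))).tendsto (y₀, x)
      have hb : ∀ᶠ z : Eu (k + 1) × ℝ × Eu k in 𝓝 (y₀, x), z.1 ∈ closedBall y₀ r₀ :=
        continuous_fst.continuousAt.eventually (closedBall_mem_nhds y₀ hr₀)
      filter_upwards [ht.eventually hne, hb] with z hz hzb hzeq
      by_contra hcon
      refine hz ?_ ?_
      · intro h
        have h : glue z.2.1 z.2.2 z.1 = glue 1 (ctr k) y₀ := h
        refine hcon ⟨?_, ?_, ?_⟩
        · simpa using congrFun h 0
        · simpa using congrArg up h
        · simpa using congrArg yp h
      · simp only [up_glue, yp_glue, glue_zero]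
        rw [← hzeq, hfa _ hzb, ← hp, ← hp1, hfa _ hy₀]
        abel
    · have : ∀ᶠ z : Eu (k + 1) × ℝ × Eu k in 𝓝 (y₀, x), f z.1 + c z.2.1 ≠ β ρ + B ρ z.2.2 := by
        refine (ContinuousAt.ne_iff_eventually_ne ?_ ?_).1 ?_
        · fun_prop
        · fun_prop
        · rcases cases _ hx.1 with h | h | h
          · simpa [h, hc0] using hfl ρ hρ y₀ hy₀Q _ hx.2
          · simp only [h, hp1]
            exact fun h' => hx1 ⟨h, hBinj _ h'.symm⟩
          · simpa only [hqk] using hcq _ h.1 h.2 (Sum.inl ρ) (Fin.cons 0 x.2 : Eu (k + 1))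
      filter_upwards [this] with z hz hz'
      exact absurd hz' hz
  have e1' : ∀ᶠ y in 𝓝 y₀, ∀ i, i ∈ FL → i ≠ ρ → ∀ x ∈ Set.Icc (0 : ℝ) 2 ×ˢ Set.Icc (0 : Eu k) 1,
      f y + c x.1 ≠ β i + B i x.2 := by
    simp only [Filter.eventually_all]
    exact e1
  obtain ⟨r, hr, hball'⟩ := Metric.eventually_nhds_iff_ball.1 (e1'.and (e2.and e3))
  refine ⟨φ, c, p - f y₀ + k₀, min r (r₀ / 2), hφA, hφc, hc, hc0, hp1, hcd, hdet, by positivity,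
    (min_le_right _ _).trans_lt (by linarith), fun y hy s hs => ?_⟩
  obtain ⟨h1, h2, h3⟩ := hball' y (ball_subset_ball (min_le_left _ _) hy)
  exact ⟨fun i hi hiρ u hu => h1 i hi hiρ (s, u) ⟨hs, hu⟩, fun y' hy' hn => h2 (s, y') ⟨hs, hy', hn⟩,
    fun u hu h => h3 (s, u) ⟨hs, hu⟩ h⟩

end

section

variable {k : ℕ}

theorem exists_finger {κ : Type*} [Finite κ] (hk : 1 < k) {f : Eu (k + 1) → Amb k}
    (hf : ContDiff ℝ 2 f) (hinj : Set.InjOn f (Set.Icc 0 1))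
    (himm : ∀ y ∈ Set.Icc (0 : Eu (k + 1)) 1, Function.Injective (fderiv ℝ f y))
    {O : Set (Eu (k + 1))} (hO : IsOpen O) (hOne : O.Nonempty) (hOQ : O ⊆ Set.Icc 0 1)
    {α : Amb k} {A : Eu (k + 1) →L[ℝ] Amb k} (hfa : ∀ y ∈ O, f y = α + A y)
    {β : κ → Amb k} {B : κ → Eu k →L[ℝ] Amb k}
    {FL : Set κ} (hfl : ∀ c ∈ FL, ∀ y ∈ Set.Icc (0 : Eu (k + 1)) 1, ∀ u ∈ Set.Icc (0 : Eu k) 1,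
      f y ≠ β c + B c u) {ρ : κ} (hρ : ρ ∈ FL) (hBA : ∀ u y, B ρ u = A y → u = 0 ∧ y = 0)
    (hρc : ∀ c, c ≠ ρ → ∀ u ∈ Set.Icc (0 : Eu k) 1, β c + B c u ≠ β ρ + B ρ (ctr k))
    (hρa : ∀ y, α + A y ≠ β ρ + B ρ (ctr k)) {η : ℤ} (hη : η = 1 ∨ η = -1) :
    ∃ F : ℝ × Eu (k + 1) → Amb k, ContDiff ℝ 2 F ∧ (∀ y, F (0, y) = f y) ∧
      (∀ t, ∀ y, y ∉ O → F (t, y) = f y) ∧ Set.InjOn (fun y => F (1, y)) (Set.Icc 0 1) ∧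
      (∀ y ∈ Set.Icc (0 : Eu (k + 1)) 1, Function.Injective (fderiv ℝ (fun y => F (1, y)) y)) ∧
      (∀ c ∈ FL, ∀ y ∈ Set.Icc (0 : Eu (k + 1)) 1, ∀ u ∈ Set.Icc (0 : Eu k) 1,
        F (1, y) ≠ β c + B c u) ∧
      (∃ O' ⊆ O, IsOpen O' ∧ O'.Nonempty ∧ ∀ y ∈ O', F (1, y) = α + A y) ∧
      (∀ c ∈ FL, c ≠ ρ → ∀ t ∈ Set.Icc (0 : ℝ) 1, ∀ y ∈ Set.Icc (0 : Eu (k + 1)) 1,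
        ∀ u ∈ Set.Icc (0 : Eu k) 1, F (t, y) ≠ β c + B c u) ∧
      HasDeg (fun z => (β ρ + B ρ (up z)) - F (z 0, yp z)) η := by
  classical
  obtain ⟨y₀, hy₀⟩ := hOne
  obtain ⟨r₁, hr₁, hr₁O⟩ := nhds_basis_closedBall.mem_iff.1 (hO.mem_nhds hy₀)
  have hball : closedBall y₀ (r₁ / 2) ⊆ O := (closedBall_subset_closedBall (by linarith)).trans hr₁O
  obtain ⟨φ, c, v, r, hφA, hφc, hc, hc0, hc1, hcd, hdet, hr, hrr, hgood⟩ := exists_finger_radius hk hf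
    hinj (half_pos hr₁) (hball.trans hOQ) (fun y hy => hfa y (hball hy)) hfl hρ hBA hρc hρa
    (η := η) (by rcases hη with h | h <;> simp [h])
  have hrO : closedBall y₀ r ⊆ O := (closedBall_subset_closedBall hrr.le).trans hball
  have hy₀i : ∀ i, 0 < y₀ i ∧ y₀ i < 1 := by
    intro i
    have hs : ∀ s : ℝ, |s| ≤ r → y₀ + (fun _ => s) ∈ Set.Icc (0 : Eu (k + 1)) 1 := fun s hs =>
      hOQ (hrO (by
        rw [mem_closedBall, dist_eq_norm, add_sub_cancel_left]
        exact (pi_norm_le_iff_of_nonneg hr.le).2 fun _ => by simpa using hs))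
    have h1 := (hs r (abs_of_pos hr).le).2 i
    have h2 := (hs (-r) (by rw [abs_neg]; exact (abs_of_pos hr).le)).1 i
    simp only [Pi.add_apply, Pi.one_apply, Pi.zero_apply] at h1 h2
    constructor <;> linarith
  let ψ : ContDiffBump y₀ := ⟨r / 2, r, half_pos hr, by linarith⟩
  have hψ0 : ∀ y, y ∉ ball y₀ r → ψ y = 0 := fun y hy =>
    ψ.zero_of_le_dist (by simpa using hy)
  have hψ1 : ψ y₀ = 1 := ψ.one_of_mem_closedBall (mem_closedBall_self ψ.rIn_pos.le)
  have hψI : ∀ t ∈ Set.Icc (0 : ℝ) 1, ∀ y, 2 * t * ψ y ∈ Set.Icc (0 : ℝ) 2 := by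
    intro t ht y
    have h0 : 0 ≤ ψ y := ψ.nonneg
    have h1 : ψ y ≤ 1 := ψ.le_one
    refine ⟨by have := ht.1; positivity, ?_⟩
    have := mul_le_mul ht.2 h1 h0 zero_le_one
    linarith
  have hψc : ContDiff ℝ 2 ψ := ψ.contDiff
  let F : ℝ × Eu (k + 1) → Amb k := fun p => f p.2 + c (2 * p.1 * ψ p.2)
  have hF : ContDiff ℝ 2 F := (hf.comp contDiff_snd).add (hc.comp
    ((contDiff_const.mul contDiff_fst).mul (hψc.comp contDiff_snd)))
  have hFout : ∀ t y, y ∉ ball y₀ r → F (t, y) = f y := fun t y hy => by simp [F, hψ0 y hy, hc0]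
  have h1m : (1 : ℝ) ∈ Set.Icc (0 : ℝ) 1 := ⟨zero_le_one, le_rfl⟩
  have hA : Function.Injective A := (injective_iff_map_eq_zero A).2 fun y hy =>
    (hBA 0 y (by rw [hy, map_zero])).2
  have hne : ∀ y₁ ∈ Set.Icc (0 : Eu (k + 1)) 1, ∀ y₂ ∈ Set.Icc (0 : Eu (k + 1)) 1,
      y₂ ∉ ball y₀ (r₁ / 2) → F (1, y₁) = F (1, y₂) → y₁ = y₂ := by
    intro y₁ h₁ y₂ h₂ hn h
    rw [hFout 1 y₂ fun h' => hn (ball_subset_ball hrr.le h')] at h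
    by_cases hy : y₁ ∈ ball y₀ r
    · exact absurd h ((hgood y₁ hy _ (hψI 1 h1m y₁)).2.1 y₂ h₂ hn)
    · rw [hFout 1 _ hy] at h
      exact hinj h₁ h₂ h
  refine ⟨F, hF, fun y => by simp [F, hc0], fun t y hy => hFout t y fun h => hy (hrO (ball_subset_closedBall h)),
    ?_, ?_, ?_, ⟨O \ closedBall y₀ r, Set.sdiff_subset, hO.sdiff isClosed_closedBall, ?_, ?_⟩, ?_, ?_⟩
  · intro y₁ h₁ y₂ h₂ h
    by_cases hn₂ : y₂ ∈ ball y₀ (r₁ / 2)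
    · by_cases hn₁ : y₁ ∈ ball y₀ (r₁ / 2)
      · have e₁ := hfa y₁ (hball (ball_subset_closedBall hn₁))
        have e₂ := hfa y₂ (hball (ball_subset_closedBall hn₂))
        have h : f y₁ + c (2 * 1 * ψ y₁) = f y₂ + c (2 * 1 * ψ y₂) := h
        have h' := congrArg φ h
        rw [e₁, e₂] at h'
        simp only [map_add, hφA, hφc, add_zero, add_right_inj] at h'
        rw [h', add_left_inj] at h
        exact hinj h₁ h₂ h
      · exact (hne y₂ h₂ y₁ h₁ hn₁ h.symm).symm
    · exact hne y₁ h₁ y₂ h₂ hn₂ h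
  · intro y hy
    by_cases hyO : y ∈ O
    · have hfd : HasFDerivAt f A y := by
        have h1 : HasFDerivAt (fun y => α + A y) A y := A.hasFDerivAt.const_add α
        refine h1.congr_of_eventuallyEq ?_
        filter_upwards [hO.mem_nhds hyO] with x hx using hfa x hx
      have hψd : HasFDerivAt (fun y => 2 * 1 * ψ y) ((2 * 1 : ℝ) • fderiv ℝ ψ y) y :=
        ((hψc.differentiable (by norm_num)) y).hasFDerivAt.const_mul _
      have hcd' := ((hc.differentiable (by norm_num)) (2 * 1 * ψ y)).hasDerivAt
      have hFd : HasFDerivAt (fun y => F (1, y)) _ y := hfd.add (hcd'.hasFDerivAt.comp y hψd)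
      rw [hFd.fderiv]
      have hφ' : φ (deriv c (2 * 1 * ψ y)) = 1 := by
        have h1 : HasDerivAt (fun s => φ (c s)) _ (2 * 1 * ψ y) := φ.hasFDerivAt.comp_hasDerivAt _ hcd'
        simp only [hφc] at h1
        exact h1.unique (hasDerivAt_id _)
      refine (injective_iff_map_eq_zero _).2 fun u hu => ?_
      have hu' : A u + ((2 * 1 : ℝ) • fderiv ℝ ψ y) u • deriv c (2 * 1 * ψ y) = 0 := by
        simpa [mul_smul] using hu
      have h2 := congrArg φ hu'
      rw [map_add, hφA, map_smul, hφ', zero_add, smul_eq_mul, mul_one, map_zero] at h2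
      rw [h2, zero_smul, add_zero] at hu'
      exact hA (by rw [hu', map_zero])
    · have : (fun y => F (1, y)) =ᶠ[𝓝 y] f := by
        filter_upwards [isClosed_closedBall.isOpen_compl.mem_nhds fun h => hyO (hrO h)] with x hx
        exact hFout 1 x fun h => hx (ball_subset_closedBall h)
      rw [this.fderiv_eq]
      exact himm y hy
  · intro i hi y hy u hu
    by_cases hyb : y ∈ ball y₀ r
    · obtain ⟨g1, -, g3⟩ := hgood y hyb _ (hψI 1 h1m y)
      by_cases hiρ : i = ρ
      · subst hiρ
        intro h
        obtain ⟨h1, -, h3⟩ := g3 u hu h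
        rw [h3, hψ1] at h1
        norm_num at h1
      · exact g1 i hi hiρ u hu
    · rw [hFout 1 y hyb]
      exact hfl i hi y hy u hu
  · have hn : ‖(fun _ => r₁ : Eu (k + 1))‖ = r₁ := by
      rw [pi_norm_const, Real.norm_of_nonneg hr₁.le]
    refine ⟨y₀ + fun _ => r₁, hr₁O ?_, ?_⟩
    · rw [mem_closedBall, dist_eq_norm, add_sub_cancel_left, hn]
    · rw [mem_closedBall, dist_eq_norm, add_sub_cancel_left, hn]
      linarith
  · intro y hy
    rw [hFout 1 y fun h => hy.2 (ball_subset_closedBall h)]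
    exact hfa y hy.1
  · intro i hi hiρ t ht y hy u hu
    by_cases hyb : y ∈ ball y₀ r
    · exact (hgood y hyb _ (hψI t ht y)).1 i hi hiρ u hu
    · rw [hFout t y hyb]
      exact hfl i hi y hy u hu
  · let zs : Amb k := glue (1 / 2) (ctr k) y₀
    let G : Amb k → Amb k := fun z => (β ρ + B ρ (up z)) - F (z 0, yp z)
    have hG : ContDiff ℝ 1 G := by
      have h1 : ContDiff ℝ 1 fun z : Amb k => F (z 0, yp z) := (hF.of_le (by norm_num)).comp
        ((contDiff_apply ℝ ℝ 0).prodMk contDiff_yp)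
      exact (contDiff_const.add ((B ρ).contDiff.comp contDiff_up)).sub h1
    have hzs : zs ∈ Set.Icc (0 : Amb k) 1 ∧ ∀ i, zs i ≠ 0 ∧ zs i ≠ 1 := by
      have : ∀ i, 0 < zs i ∧ zs i < 1 := by
        intro i
        induction i using Fin.addCases with
        | left i =>
          simp only [zs, glue, Fin.append_left]
          induction i using Fin.cases with
          | zero => norm_num
          | succ i => simp only [Fin.cons_succ, ctr]; norm_num
        | right i =>
          simp only [zs, glue, Fin.append_right]
          exact hy₀i i
      exact ⟨⟨fun i => (this i).1.le, fun i => (this i).2.le⟩, fun i => ⟨(this i).1.ne', (this i).2.ne⟩⟩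
    have hzero : ∀ z ∈ Set.Icc (0 : Amb k) 1, G z = 0 → z = zs := by
      intro z hz h
      have h : (β ρ + B ρ (up z)) - F (z 0, yp z) = 0 := h
      rw [sub_eq_zero] at h
      have hu : up z ∈ Set.Icc (0 : Eu k) 1 := ⟨fun i => hz.1 _, fun i => hz.2 _⟩
      have hy : yp z ∈ Set.Icc (0 : Eu (k + 1)) 1 := ⟨fun i => hz.1 _, fun i => hz.2 _⟩
      have ht : z 0 ∈ Set.Icc (0 : ℝ) 1 := ⟨hz.1 0, hz.2 0⟩
      by_cases hyb : yp z ∈ ball y₀ r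
      · obtain ⟨h1, h2, h3⟩ := (hgood _ hyb _ (hψI _ ht (yp z))).2.2 _ hu h.symm
        rw [h3, hψ1] at h1
        rw [← glue_self z, h2, h3]
        have : z 0 = 1 / 2 := by linarith
        rw [this]
      · rw [hFout _ _ hyb] at h
        exact absurd h.symm (hfl ρ hρ _ hy _ hu)
    have hGzs : G zs = 0 := by
      simp only [G, zs, glue_zero, up_glue, yp_glue, F, hψ1]
      norm_num [hc1]
    have hset : {z ∈ Set.Icc (0 : Amb k) 1 | G z = 0} = {zs} := by
      ext z
      simp only [Set.mem_sep_iff, Set.mem_singleton_iff]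
      constructor
      · exact fun h => hzero z h.1 h.2
      · rintro rfl
        exact ⟨hzs.1, hGzs⟩
    have hder : fderiv ℝ G zs = tipMap (B ρ) A ((2 : ℝ) • v) := by
      have hγ : HasDerivAt (fun s : ℝ => c (2 * s)) ((2 : ℝ) • v) (zs 0) := by
        have h1 : HasDerivAt (fun s : ℝ => 2 * s) 2 (zs 0) := by
          simpa using (hasDerivAt_id (zs 0)).const_mul 2
        refine HasDerivAt.scomp (zs 0) ?_ h1
        have : 2 * zs 0 = 1 := by simp [zs]
        rw [this]
        exact hcd
      refine ((hasFDerivAt_tip (B ρ) A (b := β ρ) (c := α) hγ).congr_of_eventuallyEq ?_).fderiv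
      have hyc : Filter.Tendsto (fun z : Amb k => yp z) (𝓝 zs) (𝓝 y₀) := by
        have := (contDiff_yp (k := k) (N := 1)).continuous.tendsto zs
        simpa only [zs, yp_glue] using this
      filter_upwards [hyc.eventually ψ.eventuallyEq_one, hyc.eventually (hO.mem_nhds hy₀)] with z h1 h2
      have h1 : ψ (yp z) = 1 := h1
      simp only [G, F]
      rw [h1, mul_one, hfa _ h2]
      abel
    have hdz : (fderiv ℝ G zs).det = 2 * η := by
      rw [hder, two_smul_det_tipMap, hdet]
    obtain ⟨-, h⟩ := hasDeg_of_nondegenerate hG (fun z hz ⟨i, hi⟩ h0 => by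
      rw [hzero z hz h0] at hi
      exact hi.elim (hzs.2 i).1 (hzs.2 i).2) (fun z hz h0 => by
      rw [hzero z hz h0, hdz]
      rcases hη with h | h <;> simp [h])
    rw [hset, finsum_mem_singleton, hdz] at h
    convert h using 1
    rcases hη with h | h <;> simp [h]

end

section

variable {k : ℕ} {T κ : Type*}

/-- Affine cells `α t + A t y` of dimension `k + 1` and `β c + B c u` of dimension `k` in general position. -/
structure Complex (k : ℕ) (T κ : Type*) where
  α : T → Amb k
  A : T → Eu (k + 1) →L[ℝ] Amb k
  β : κ → Amb k
  B : κ → Eu k →L[ℝ] Amb k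
  facet : T → Fin (k + 1) → Bool → κ
  far : T → T → Prop
  farL : T → κ → Prop
  facet_eq : ∀ t j b u, α t + A t (j.insertNth (α := fun _ => ℝ) (cond b 1 0) u) =
    β (facet t j b) + B (facet t j b) u
  symm : ∀ s t, far s t → far t s
  irrefl : ∀ t, ¬ far t t
  far_facet : ∀ s t, far s t → ∀ j b, farL s (facet t j b)
  avoid : ∀ t c, farL t c → ∀ y ∈ Set.Icc (0 : Eu (k + 1)) 1, ∀ u ∈ Set.Icc (0 : Eu k) 1,
    α t + A t y ≠ β c + B c u
  injective : ∀ t, Function.Injective (A t)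
  joint : ∀ t s j b, farL t (facet s j b) → ∀ u y, B (facet s j b) u = A t y → u = 0 ∧ y = 0
  centre : ∀ s j b c, c ≠ facet s j b → ∀ u ∈ Set.Icc (0 : Eu k) 1,
    β c + B c u ≠ β (facet s j b) + B (facet s j b) (ctr k)
  off : ∀ t s j b, farL t (facet s j b) → ∀ y,
    α t + A t y ≠ β (facet s j b) + B (facet s j b) (ctr k)

/-- The sign in the boundary formula. -/
noncomputable def bsign (k : ℕ) : ℤ := (exists_boundary_formula k).choose

theorem bsign_spec {H : ℝ × Eu (k + 1) × Eu (k + 1) → Amb k} (hH : ContDiff ℝ 2 H)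
    {o₀ o₁ : ℤ} {p q : Fin (k + 1) → Bool → ℤ} (h₀ : HasDeg (fun z => H (0, xp z, yp z)) o₀)
    (h₁ : HasDeg (fun z => H (1, xp z, yp z)) o₁)
    (hp : ∀ j b, HasDeg (fun z => H (z 0,
      j.insertNth (α := fun _ => ℝ) (cond b 1 0) (up z), yp z)) (p j b))
    (hq : ∀ j b, HasDeg (fun z => -H (z 0, yp z,
      j.insertNth (α := fun _ => ℝ) (cond b 1 0) (up z))) (q j b)) :
    o₁ - o₀ = ∑ j : Fin (k + 1), (-1) ^ (j : ℕ) * (p j true - p j false) +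
      bsign k * ∑ j : Fin (k + 1), (-1) ^ (j : ℕ) * (q j true - q j false) :=
  (exists_boundary_formula k).choose_spec hH h₀ h₁ hp hq

namespace Complex

variable (C : Complex k T κ)

/-- The affine map of a cell of dimension `k + 1`. -/
def top (t : T) (y : Eu (k + 1)) : Amb k := C.α t + C.A t y

/-- The affine map of a cell of dimension `k`. -/
def low (c : κ) (u : Eu k) : Amb k := C.β c + C.B c u

/-- The coboundary of a cochain on pairs of cells. -/
noncomputable def bd (e : κ → T → ℤ) (s t : T) : ℤ :=
  ∑ j : Fin (k + 1), (-1) ^ (j : ℕ) * (e (C.facet s j true) t - e (C.facet s j false) t) +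
    bsign k * ∑ j : Fin (k + 1), (-1) ^ (j : ℕ) * (e (C.facet t j true) s - e (C.facet t j false) s)

theorem bd_add (e e' : κ → T → ℤ) (s t : T) : C.bd (e + e') s t = C.bd e s t + C.bd e' s t := by
  simp only [bd, Pi.add_apply]
  rw [add_add_add_comm, ← mul_add, ← Finset.sum_add_distrib, ← Finset.sum_add_distrib]
  congr 2
  · funext j
    ring
  · congr 2
    funext j
    ring

theorem contDiff_top (t : T) {N : WithTop ℕ∞} : ContDiff ℝ N (C.top t) :=
  contDiff_const.add (C.A t).contDiff

theorem contDiff_low (c : κ) {N : WithTop ℕ∞} : ContDiff ℝ N (C.low c) :=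
  contDiff_const.add (C.B c).contDiff

/-- Embeddings of the cells of dimension `k + 1` fixed on the boundaries and avoiding the
far cells of dimension `k`. -/
structure Admissible (f : T → Eu (k + 1) → Amb k) : Prop where
  smooth : ∀ t, ContDiff ℝ 2 (f t)
  injOn : ∀ t, Set.InjOn (f t) (Set.Icc 0 1)
  immersion : ∀ t, ∀ y ∈ Set.Icc (0 : Eu (k + 1)) 1, Function.Injective (fderiv ℝ (f t) y)
  eq_top : ∀ t, ∀ y ∉ interior (Set.Icc (0 : Eu (k + 1)) 1), f t y = C.top t y
  avoid : ∀ t c, C.farL t c → ∀ y ∈ Set.Icc (0 : Eu (k + 1)) 1, ∀ u ∈ Set.Icc (0 : Eu k) 1,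
    f t y ≠ C.low c u

variable {C}

theorem notMem_interior_of_face {m : ℕ} {y : Eu m} (h : ∃ i, y i = 0 ∨ y i = 1) :
    y ∉ interior (Set.Icc (0 : Eu m) 1) := by
  obtain ⟨i, hi⟩ := h
  rw [← Set.pi_univ_Icc, interior_pi_set Set.finite_univ]
  intro h
  have := h i trivial
  simp only [interior_Icc, Pi.zero_apply, Pi.one_apply, Set.mem_Ioo] at this
  rcases hi with h | h <;> linarith [this.1, this.2]

theorem top_face (t : T) {j : Fin (k + 1)} {y : Eu (k + 1)} (b : Bool) (h : y j = cond b 1 0) :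
    C.top t y = C.low (C.facet t j b) (fun i => y (j.succAbove i)) := by
  rw [low, ← C.facet_eq, ← h]
  congr 2
  exact (Fin.insertNth_self_removeNth j y).symm

theorem exists_facet (t : T) {y : Eu (k + 1)} (hy : y ∈ Set.Icc (0 : Eu (k + 1)) 1)
    (h : ∃ i, y i = 0 ∨ y i = 1) :
    ∃ j b, ∃ u ∈ Set.Icc (0 : Eu k) 1, C.top t y = C.low (C.facet t j b) u := by
  obtain ⟨j, hj⟩ := h
  have hu : (fun i => y (j.succAbove i)) ∈ Set.Icc (0 : Eu k) 1 :=
    ⟨fun i => hy.1 _, fun i => hy.2 _⟩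
  rcases hj with hj | hj
  · exact ⟨j, false, _, hu, top_face t false hj⟩
  · exact ⟨j, true, _, hu, top_face t true hj⟩

namespace Admissible

variable {f : T → Eu (k + 1) → Amb k}

theorem ne_of_face (hf : C.Admissible f) {s t : T} (h : C.far s t) {x y : Eu (k + 1)}
    (hx : x ∈ Set.Icc (0 : Eu (k + 1)) 1) (hy : y ∈ Set.Icc (0 : Eu (k + 1)) 1)
    (hxi : ∃ i, x i = 0 ∨ x i = 1) : f s x ≠ f t y := by
  obtain ⟨j, b, u, hu, e⟩ := exists_facet (C := C) s hx hxi
  rw [hf.eq_top s x (notMem_interior_of_face hxi), e]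
  exact (hf.avoid t _ (C.far_facet t s (C.symm s t h) j b) y hy u hu).symm

theorem ne_zero_of_face (hf : C.Admissible f) {s t : T} (h : C.far s t) {z : Amb k} (hz : z ∈ Set.Icc (0 : Amb k) 1)
    (hzi : ∃ i, z i = 0 ∨ z i = 1) : f s (xp z) - f t (yp z) ≠ 0 := by
  have hx : xp z ∈ Set.Icc (0 : Eu (k + 1)) 1 := ⟨fun i => hz.1 _, fun i => hz.2 _⟩
  have hy : yp z ∈ Set.Icc (0 : Eu (k + 1)) 1 := ⟨fun i => hz.1 _, fun i => hz.2 _⟩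
  rw [sub_ne_zero]
  obtain ⟨i, hi⟩ := hzi
  induction i using Fin.addCases with
  | left i => exact hf.ne_of_face h hx hy ⟨i, hi⟩
  | right i => exact (hf.ne_of_face (C.symm s t h) hy hx ⟨i, hi⟩).symm

theorem contDiff_sub (hf : C.Admissible f) (s t : T) : ContDiff ℝ 2 fun z : Amb k => f s (xp z) - f t (yp z) :=
  ((hf.smooth s).comp contDiff_xp).sub ((hf.smooth t).comp contDiff_yp)

end Admissible

/-- The effect of a deformation of the cells on the degrees. -/
theorem hasDeg_deform {F : T → ℝ × Eu (k + 1) → Amb k} (hF : ∀ t, ContDiff ℝ 2 (F t))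
    (hFb : ∀ t r, ∀ y ∉ interior (Set.Icc (0 : Eu (k + 1)) 1), F t (r, y) = C.top t y)
    {D e : κ → T → ℤ} (hD : ∀ s t j b, C.far t s → HasDeg (fun z =>
      C.low (C.facet s j b) (up z) - F t (z 0, yp z)) (D (C.facet s j b) t))
    (h1 : C.Admissible fun t y => F t (1, y)) {s t : T} (h : C.far s t)
    (he : HasDeg (fun z => F s (0, xp z) - F t (0, yp z)) (C.bd e s t)) :
    HasDeg (fun z => F s (1, xp z) - F t (1, yp z)) (C.bd (e + D) s t) := by
  obtain ⟨o, ho⟩ := exists_hasDeg (h1.contDiff_sub s t) fun z hz hzi => h1.ne_zero_of_face h hz hzi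
  let H : ℝ × Eu (k + 1) × Eu (k + 1) → Amb k := fun p => F s (p.1, p.2.1) - F t (p.1, p.2.2)
  have hH : ContDiff ℝ 2 H := ((hF s).comp (contDiff_fst.prodMk contDiff_snd.fst)).sub
    ((hF t).comp (contDiff_fst.prodMk contDiff_snd.snd))
  have hface : ∀ t r (j : Fin (k + 1)) b (u : Eu k),
      F t (r, j.insertNth (α := fun _ => ℝ) (cond b 1 0) u) = C.low (C.facet t j b) u := by
    intro t r j b u
    rw [hFb t r _ (notMem_interior_of_face ⟨j, ?_⟩)]
    · exact C.facet_eq t j b u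
    · cases b <;> simp
  have hformula := bsign_spec hH he ho
    (p := fun j b => D (C.facet s j b) t) (q := fun j b => D (C.facet t j b) s)
    (fun j b => by
      simp only [H, hface]
      exact hD s t j b (C.symm s t h))
    (fun j b => by
      simp only [H, hface, neg_sub]
      exact hD t s j b h)
  have : o = C.bd (e + D) s t := by
    rw [bd_add]
    have h2 : C.bd D s t = o - C.bd e s t := hformula.symm
    omega
  rwa [this] at ho

variable (C) in
/-- Admissible maps with prescribed degrees, each affine on an open set. -/
def Reach (f : T → Eu (k + 1) → Amb k) (e : κ → T → ℤ) : Prop :=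
  C.Admissible f ∧ (∀ t, ∃ O ⊆ Set.Icc (0 : Eu (k + 1)) 1, IsOpen O ∧ O.Nonempty ∧
    ∀ y ∈ O, f t y = C.top t y) ∧
  ∀ s t, C.far s t → HasDeg (fun z => f s (xp z) - f t (yp z)) (C.bd e s t)

open Classical in
theorem Reach.finger [Finite κ] (hk : 1 < k) {f : T → Eu (k + 1) → Amb k} {e : κ → T → ℤ}
    (h : C.Reach f e) {τ σ : T} {i : Fin (k + 1)} {b : Bool} (hρ : C.farL τ (C.facet σ i b)) {η : ℤ}
    (hη : η = 1 ∨ η = -1) :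
    ∃ f', C.Reach f' (e + fun c t => if c = C.facet σ i b ∧ t = τ then η else 0) := by
  obtain ⟨hf, hO, he⟩ := h
  set ρ := C.facet σ i b with hρd
  choose O hOQ hO hOne hOf using hO
  obtain ⟨G, hG, hG0, hGO, hGinj, hGimm, hGl, hGO', hGt, hGdeg⟩ := exists_finger hk (hf.smooth τ)
    (hf.injOn τ) (hf.immersion τ) (hO τ) (hOne τ) (hOQ τ) (hOf τ) (FL := {c | C.farL τ c})
    (fun c hc => hf.avoid τ c (by simpa using hc)) (ρ := ρ) (by simpa using hρ)
    (C.joint τ σ i b hρ) (C.centre σ i b) (C.off τ σ i b hρ) hη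
  let F : T → ℝ × Eu (k + 1) → Amb k := fun t p => if t = τ then G p else f t p.2
  have hFτ : ∀ p, F τ p = G p := fun p => if_pos rfl
  have hFn : ∀ t, t ≠ τ → ∀ p, F t p = f t p.2 := fun t ht p => if_neg ht
  have hF : ∀ t, ContDiff ℝ 2 (F t) := by
    intro t
    by_cases ht : t = τ
    · subst ht
      simpa only [funext hFτ] using hG
    · rw [funext (hFn t ht)]
      exact (hf.smooth t).comp contDiff_snd
  have hF0 : ∀ t y, F t (0, y) = f t y := by
    intro t y
    by_cases ht : t = τ
    · subst ht
      rw [hFτ, hG0]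
    · exact hFn t ht _
  have hFb : ∀ t r, ∀ y ∉ interior (Set.Icc (0 : Eu (k + 1)) 1), F t (r, y) = C.top t y := by
    intro t r y hy
    rw [← hf.eq_top t y hy]
    by_cases ht : t = τ
    · subst ht
      rw [hFτ]
      exact hGO r y fun h => hy (interior_maximal (hOQ t) (hO t) h)
    · exact hFn t ht _
  have hadm : C.Admissible fun t y => F t (1, y) := by
    refine ⟨fun t => (hF t).comp (contDiff_const.prodMk contDiff_id), ?_, ?_, fun t => hFb t 1, ?_⟩ <;>
    · intro t
      by_cases ht : t = τ
      · subst ht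
        simp only [hFτ]
        first
          | exact hGinj
          | exact hGimm
          | exact fun c hc => hGl c (by simpa using hc)
      · simp only [hFn t ht]
        first
          | exact hf.injOn t
          | exact hf.immersion t
          | exact hf.avoid t
  refine ⟨fun t y => F t (1, y), hadm, fun t => ?_, fun s t hst => ?_⟩
  · by_cases ht : t = τ
    · subst ht
      obtain ⟨O', h1, h2, h3, h4⟩ := hGO'
      exact ⟨O', h1.trans (hOQ t), h2, h3, fun y hy => (hFτ _).trans (h4 y hy)⟩
    · exact ⟨O t, hOQ t, hO t, hOne t, fun y hy => (hFn t ht _).trans (hOf t y hy)⟩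
  · refine hasDeg_deform hF hFb ?_ hadm hst (by simpa only [hF0] using he s t hst)
    intro s t j b' hts
    have hz : ∀ z ∈ Set.Icc (0 : Amb k) 1, up z ∈ Set.Icc (0 : Eu k) 1 ∧
        yp z ∈ Set.Icc (0 : Eu (k + 1)) 1 ∧ z 0 ∈ Set.Icc (0 : ℝ) 1 := fun z hz =>
      ⟨⟨fun i => hz.1 _, fun i => hz.2 _⟩, ⟨fun i => hz.1 _, fun i => hz.2 _⟩, hz.1 0, hz.2 0⟩
    have hc : Continuous fun z : Amb k => C.low (C.facet s j b') (up z) - F t (z 0, yp z) :=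
      ((C.contDiff_low _ (N := 1)).continuous.comp (contDiff_up (N := 1)).continuous).sub
        ((hF t).continuous.comp ((continuous_apply 0).prodMk (contDiff_yp (N := 1)).continuous))
    have hfl := C.far_facet t s hts j b'
    by_cases ht : t = τ
    · subst ht
      by_cases hc' : C.facet s j b' = ρ
      · rw [if_pos ⟨hc', rfl⟩, hc']
        simp only [hFτ]
        exact hGdeg
      · rw [if_neg fun h => hc' h.1]
        refine hasDeg_zero_of_ne_zero hc fun z hzI => ?_
        obtain ⟨h1, h2, h3⟩ := hz z hzI
        rw [sub_ne_zero, hFτ]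
        exact (hGt _ (by simpa using hfl) hc' _ h3 _ h2 _ h1).symm
    · rw [if_neg fun h => ht h.2]
      refine hasDeg_zero_of_ne_zero hc fun z hzI => ?_
      obtain ⟨h1, h2, h3⟩ := hz z hzI
      rw [sub_ne_zero, hFn t ht]
      exact (hf.avoid t _ hfl _ h2 _ h1).symm

theorem ctr_mem_interior {m : ℕ} : ctr m ∈ interior (Set.Icc (0 : Eu m) 1) := by
  rw [← Set.pi_univ_Icc, interior_pi_set Set.finite_univ]
  intro i _
  simp only [interior_Icc, ctr, Pi.zero_apply, Pi.one_apply]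
  norm_num

theorem admissible_top : C.Admissible C.top where
  smooth t := C.contDiff_top t
  injOn t := fun x _ y _ h => C.injective t (add_left_cancel h)
  immersion t := fun y _ => by
    have : HasFDerivAt (C.top t) (C.A t) y := (C.A t).hasFDerivAt.const_add _
    rw [this.fderiv]
    exact C.injective t
  eq_top _ _ _ := rfl
  avoid := C.avoid

theorem exists_degree_zero [Finite κ] [Finite T] (hk : 1 < k) {e : κ → T → ℤ}
    (he : ∀ s t, C.far s t → HasDeg (fun z => C.top s (xp z) - C.top t (yp z)) (C.bd e s t)) :
    ∃ f, C.Admissible f ∧ ∀ s t, C.far s t → HasDeg (fun z => f s (xp z) - f t (yp z)) 0 := by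
  classical
  have := Fintype.ofFinite κ
  have := Fintype.ofFinite T
  let R : (κ → T → ℤ) → Prop := fun D => ∀ f e, C.Reach f e → ∃ f', C.Reach f' (e + D)
  have h0 : R 0 := fun f e h => ⟨f, by simpa using h⟩
  have hadd : ∀ D D', R D → R D' → R (D + D') := by
    intro D D' h h' f e hf
    obtain ⟨f', hf'⟩ := h f e hf
    obtain ⟨f'', hf''⟩ := h' f' _ hf'
    exact ⟨f'', by rwa [← add_assoc]⟩
  let good : κ → T → Prop := fun c t => ∃ s j b, c = C.facet s j b ∧ C.farL t c
  have hsingle : ∀ c t, good c t → ∀ n : ℤ, R fun c' t' => if c' = c ∧ t' = t then n else 0 := by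
    rintro c t ⟨s, j, b, rfl, hfar⟩ n
    have hs : ∀ (m η : ℤ), η = 1 ∨ η = -1 →
        (R fun c' t' => if c' = C.facet s j b ∧ t' = t then m else 0) →
        R fun c' t' => if c' = C.facet s j b ∧ t' = t then m + η else 0 := by
      intro m η hη hm
      convert hadd _ _ hm (fun f e h => h.finger hk hfar hη) using 1
      funext c' t'
      simp only [Pi.add_apply]
      split_ifs <;> rfl
    induction n using Int.induction_on with
    | zero =>
      simp only [ite_self]
      exact h0
    | succ n ih => exact hs _ 1 (Or.inl rfl) ih
    | pred n ih => exact hs _ (-1) (Or.inr rfl) ih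
  let D : κ → T → ℤ := ∑ p : κ × T, fun c' t' => if c' = p.1 ∧ t' = p.2 then
    (if good p.1 p.2 then - e p.1 p.2 else 0) else 0
  have hD : R D := by
    refine Finset.sum_induction _ R hadd h0 fun p _ => ?_
    by_cases hp : good p.1 p.2
    · exact hsingle p.1 p.2 hp _
    · simp only [if_neg hp, ite_self]
      exact h0
  have hDv : ∀ c t, D c t = if good c t then - e c t else 0 := by
    intro c t
    simp only [D, Finset.sum_apply]
    rw [Finset.sum_eq_single (c, t)]
    · simp
    · rintro ⟨c', t'⟩ - hne
      refine if_neg fun h => hne ?_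
      rw [h.1, h.2]
    · simp
  obtain ⟨f, hf, -, hdeg⟩ := hD C.top e ⟨admissible_top, fun t => ⟨interior (Set.Icc 0 1),
    interior_subset, isOpen_interior, ⟨_, ctr_mem_interior⟩, fun _ _ => rfl⟩, he⟩
  refine ⟨f, hf, fun s t hst => ?_⟩
  have hz : ∀ s t j b, C.far t s → (e + D) (C.facet s j b) t = 0 := by
    intro s t j b h
    rw [Pi.add_apply, Pi.add_apply, hDv, if_pos ⟨s, j, b, rfl, C.far_facet t s h j b⟩, add_neg_cancel]
  have : C.bd (e + D) s t = 0 := by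
    simp only [bd, hz s t _ _ (C.symm s t hst), hz t s _ _ hst]
    simp
  rw [← this]
  exact hdeg s t hst

end Complex

end

section stability
variable {V W : Type*} [NormedAddCommGroup V] [NormedSpace ℝ V] [FiniteDimensional ℝ V]
  [NormedAddCommGroup W] [NormedSpace ℝ W] {f : V → W} {χ : V → ℝ} {K : Set V}

theorem fderiv_add_smul_const (hf : ContDiff ℝ 1 f) (hχ : ContDiff ℝ 1 χ) (v : W) (x : V) :
    fderiv ℝ (fun x => f x + χ x • v) x = fderiv ℝ f x + (fderiv ℝ χ x).smulRight v :=
  (((hf.differentiable (by simp)) x).hasFDerivAt.add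
    (((hχ.differentiable (by simp)) x).hasFDerivAt.smul_const v)).fderiv

/-- Embeddings of compact sets are stable under small perturbations. -/
theorem eventually_embedding (hf : ContDiff ℝ 1 f) (hχ : ContDiff ℝ 1 χ) (hK : IsCompact K)
    (hinj : Set.InjOn f K) (himm : ∀ x ∈ K, Function.Injective (fderiv ℝ f x)) :
    ∀ᶠ v : W in 𝓝 0, Set.InjOn (fun x => f x + χ x • v) K ∧
      ∀ x ∈ K, Function.Injective (fderiv ℝ (fun x => f x + χ x • v) x) := by
  have hfc := hf.continuous
  have hχc := hχ.continuous
  refine Filter.Eventually.and ?_ ?_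
  · have : ∀ᶠ v : W in 𝓝 0, ∀ p ∈ K ×ˢ K, f p.1 + χ p.1 • v = f p.2 + χ p.2 • v → p.1 = p.2 := by
      refine (hK.prod hK).eventually_forall_of_forall_eventually fun p hp => ?_
      by_cases h : p.1 = p.2
      · obtain ⟨x, y⟩ := p
        obtain rfl : x = y := h
        let G : W × V → W := fun q => f q.2 + χ q.2 • q.1
        have hG : ContDiff ℝ 1 G := (hf.comp contDiff_snd).add ((hχ.comp contDiff_snd).smul contDiff_fst)
        have hGs : HasStrictFDerivAt G (fderiv ℝ G (0, x)) (0, x) :=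
          hG.contDiffAt.hasStrictFDerivAt (by simp)
        have hGv : ∀ u : V, fderiv ℝ G (0, x) (0, u) = fderiv ℝ f x u := by
          intro u
          have h1 : HasFDerivAt (fun y : V => G (0, y)) _ x :=
            (hG.differentiable (by simp) (0, x)).hasFDerivAt.comp x (hasFDerivAt_prodMk_right (0 : W) x)
          have h2 : (fun y : V => G (0, y)) = f := by funext y; simp [G]
          rw [h2] at h1
          rw [h1.fderiv]
          simp
        obtain ⟨c, hc, hcA⟩ := (fderiv ℝ f x).toLinearMap.exists_antilipschitzWith
          (LinearMap.ker_eq_bot.2 (himm x hp.1))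
        have hcA' : ∀ u : V, ‖u‖ ≤ c * ‖fderiv ℝ f x u‖ := fun u => by
          simpa using hcA.le_mul_dist u 0
        have hlo := (hGs.isLittleO.bound (c := (2 * (c : ℝ))⁻¹) (by positivity))
        have ht : Filter.Tendsto (fun q : W × V × V => ((q.1, q.2.1), (q.1, q.2.2)))
            (𝓝 (0, x, x)) (𝓝 ((0, x), (0, x))) :=
          Continuous.tendsto (by fun_prop) (0, x, x)
        filter_upwards [ht.eventually hlo] with q hq hqe
        rw [show G (q.1, q.2.1) = G (q.1, q.2.2) from hqe, sub_self, zero_sub, norm_neg] at hq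
        rw [Prod.mk_sub_mk, sub_self, hGv] at hq
        have h1 := hcA' (q.2.1 - q.2.2)
        have h2 : ‖((0 : W), q.2.1 - q.2.2)‖ = ‖q.2.1 - q.2.2‖ := by
          rw [Prod.norm_mk, norm_zero]
          exact max_eq_right (norm_nonneg _)
        rw [h2] at hq
        have hc' : (0 : ℝ) < c := hc
        have h3 : (c : ℝ) * ‖fderiv ℝ f x (q.2.1 - q.2.2)‖ ≤ 1 / 2 * ‖q.2.1 - q.2.2‖ := by
          refine (mul_le_mul_of_nonneg_left hq hc'.le).trans (le_of_eq ?_)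
          field_simp
        rw [← sub_eq_zero, ← norm_eq_zero]
        linarith [norm_nonneg (q.2.1 - q.2.2)]
      · have : ∀ᶠ q : W × V × V in 𝓝 (0, p), f q.2.1 + χ q.2.1 • q.1 ≠ f q.2.2 + χ q.2.2 • q.1 := by
          refine (ContinuousAt.ne_iff_eventually_ne ?_ ?_).1 ?_
          · fun_prop
          · fun_prop
          · simpa using fun h' => h (hinj hp.1 hp.2 h')
        filter_upwards [this] with q hq h'
        exact absurd h' hq
    filter_upwards [this] with v hv x hx y hy h
    exact hv (x, y) ⟨hx, hy⟩ h
  · refine hK.eventually_forall_of_forall_eventually fun x hx => ?_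
    have h1 : Continuous fun q : W × V => fderiv ℝ f q.2 + (fderiv ℝ χ q.2).smulRight q.1 :=
      ((hf.continuous_fderiv (by simp)).comp continuous_snd).add
        (((ContinuousLinearMap.smulRightL ℝ V W).continuous₂).comp
          (((hχ.continuous_fderiv (by simp)).comp continuous_snd).prodMk continuous_fst))
    have h2 := (h1.continuousAt (x := ((0 : W), x))).eventually
      (ContinuousLinearMap.isOpen_injective.mem_nhds (by simpa using himm x hx))
    filter_upwards [h2] with q hq
    rw [fderiv_add_smul_const hf hχ]
    simpa using hq

end stability

section generic
variable {k : ℕ} {T κ : Type*} {C : Complex k T κ}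

/-- The splitting of the ambient space in two blocks. -/
noncomputable def splitEquiv (k : ℕ) : (Eu (k + 1) × Eu (k + 1)) ≃L[ℝ] Amb k :=
  LinearEquiv.toContinuousLinearEquiv
    { toFun := fun p => Fin.append p.1 p.2
      invFun := fun z => (xp z, yp z)
      map_add' := fun p q => by
        ext i
        induction i using Fin.addCases with
        | left i => simp only [Fin.append_left, Prod.fst_add, Pi.add_apply]
        | right i => simp only [Fin.append_right, Prod.snd_add, Pi.add_apply]
      map_smul' := fun c p => by
        ext i
        induction i using Fin.addCases with
        | left i => simp only [Fin.append_left, Prod.smul_fst, Pi.smul_apply, RingHom.id_apply]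
        | right i => simp only [Fin.append_right, Prod.smul_snd, Pi.smul_apply, RingHom.id_apply]
      left_inv := fun p => by
        refine Prod.ext ?_ ?_ <;> ext i
        · simp only [xp, Fin.append_left]
        · simp only [yp, Fin.append_right]
      right_inv := fun z => by
        ext i
        induction i using Fin.addCases with
        | left i => simp only [Fin.append_left, xp]
        | right i => simp only [Fin.append_right, yp] }

theorem splitEquiv_symm (z : Amb k) : (splitEquiv k).symm z = (xp z, yp z) := rfl

namespace Complex

/-- The interior of the unit cube. -/
abbrev openCube (m : ℕ) : Set (Eu m) := interior (Set.Icc 0 1)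

theorem Admissible.exists_perturb [Finite κ] [Finite T] {f : T → Eu (k + 1) → Amb k} (hf : C.Admissible f)
    (hdeg : ∀ s t, C.far s t → HasDeg (fun z => f s (xp z) - f t (yp z)) 0)
    {χ : Eu (k + 1) → ℝ} (hχ : ContDiff ℝ 2 χ) (hχ0 : ∀ x ∉ openCube (k + 1), χ x = 0) (t : T) :
    ∃ δ > 0, ∀ v : Amb k, ‖v‖ < δ → ∀ f' : T → Eu (k + 1) → Amb k, (∀ x, f' t x = f t x + χ x • v) →
      (∀ s, s ≠ t → f' s = f s) → C.Admissible f' ∧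
      ∀ s t, C.far s t → HasDeg (fun z => f' s (xp z) - f' t (yp z)) 0 := by
  classical
  have hχ1 : ContDiff ℝ 1 χ := hχ.of_le (by norm_num)
  have hχc := hχ.continuous
  have e1 := eventually_embedding (hf.smooth t |>.of_le (by norm_num)) hχ1 isCompact_Icc (hf.injOn t)
    (hf.immersion t)
  have hfc := (hf.smooth t).continuous
  have e2 : ∀ᶠ v : Amb k in 𝓝 0, ∀ c, C.farL t c → ∀ p ∈ Set.Icc (0 : Eu (k + 1)) 1 ×ˢ
      Set.Icc (0 : Eu k) 1, f t p.1 + χ p.1 • v ≠ C.low c p.2 := by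
    simp only [Filter.eventually_all]
    intro c hc
    refine (isCompact_Icc.prod isCompact_Icc).eventually_forall_of_forall_eventually fun p hp => ?_
    have hl := (C.contDiff_low c (N := 1)).continuous
    refine (ContinuousAt.ne_iff_eventually_ne ?_ ?_).1 ?_
    · fun_prop
    · fun_prop
    · simpa using hf.avoid t c hc _ hp.1 _ hp.2
  obtain ⟨δ, hδ, hball⟩ := Metric.eventually_nhds_iff.1 (e1.and e2)
  have key : ∀ v : Amb k, ‖v‖ < δ → ∀ f' : T → Eu (k + 1) → Amb k, (∀ x, f' t x = f t x + χ x • v) →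
      (∀ s, s ≠ t → f' s = f s) → C.Admissible f' := by
    intro v hv f' hft hfs
    obtain ⟨⟨h1, h2⟩, h3⟩ := hball (y := v) (by simpa using hv)
    have hft' : f' t = fun x => f t x + χ x • v := funext hft
    have hcase : ∀ {P : (Eu (k + 1) → Amb k) → T → Prop}, P (fun x => f t x + χ x • v) t →
        (∀ s, P (f s) s) → ∀ s, P (f' s) s := by
      intro P h h' s
      by_cases hs : s = t
      · subst hs
        rwa [hft']
      · rw [hfs s hs]
        exact h' s
    refine ⟨?_, ?_, ?_, ?_, ?_⟩
    · exact hcase (P := fun g _ => ContDiff ℝ 2 g) ((hf.smooth t).add (hχ.smul contDiff_const)) hf.smooth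
    · exact hcase (P := fun g _ => Set.InjOn g _) h1 hf.injOn
    · exact hcase (P := fun g _ => ∀ y ∈ Set.Icc (0 : Eu (k + 1)) 1, Function.Injective (fderiv ℝ g y))
        h2 hf.immersion
    · refine hcase (P := fun g s => ∀ y ∉ openCube (k + 1), g y = C.top s y) ?_ hf.eq_top
      intro y hy
      show f t y + χ y • v = C.top t y
      rw [hχ0 y hy, zero_smul, add_zero]
      exact hf.eq_top t y hy
    · exact hcase (P := fun g s => ∀ c, C.farL s c → ∀ y ∈ Set.Icc (0 : Eu (k + 1)) 1,
        ∀ u ∈ Set.Icc (0 : Eu k) 1, g y ≠ C.low c u) (fun c hc y hy u hu => h3 c hc (y, u) ⟨hy, hu⟩)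
        hf.avoid
  refine ⟨δ, hδ, fun v hv f' hft hfs => ⟨key v hv f' hft hfs, fun s s' hss => ?_⟩⟩
  let F : ℝ → T → Eu (k + 1) → Amb k := fun r s x => f s x + (if s = t then r * χ x else 0) • v
  have hF : ∀ r ∈ Set.Icc (0 : ℝ) 1, C.Admissible (F r) := by
    intro r hr
    refine key (r • v) ?_ _ (fun x => ?_) fun s hs => ?_
    · rw [norm_smul, Real.norm_of_nonneg hr.1]
      exact (mul_le_of_le_one_left (norm_nonneg v) hr.2).trans_lt hv
    · simp [F, smul_smul, mul_comm]
    · funext x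
      simp [F, hs]
  have hsm : ∀ s, ContDiff ℝ 2 fun p : ℝ × Eu (k + 1) => F p.1 s p.2 := by
    intro s
    have h : ContDiff ℝ 2 fun p : ℝ × Eu (k + 1) => if s = t then p.1 * χ p.2 else 0 := by
      split_ifs
      · exact contDiff_fst.mul (hχ.comp contDiff_snd)
      · exact contDiff_const
    exact ((hf.smooth s).comp contDiff_snd).add (h.smul contDiff_const)
  have hH : ContDiff ℝ 2 fun p : ℝ × Amb k => F p.1 s (xp p.2) - F p.1 s' (yp p.2) :=
    ((hsm s).comp (contDiff_fst.prodMk (contDiff_xp.comp contDiff_snd))).sub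
      ((hsm s').comp (contDiff_fst.prodMk (contDiff_yp.comp contDiff_snd)))
  have h1 := HasDeg.homotopy hH (fun r hr z hz hzi => (hF r hr).ne_zero_of_face hss hz hzi)
    (d := 0) (by simpa [F] using hdeg s s' hss)
  have hF1 : F 1 = f' := by
    funext s x
    by_cases hs : s = t
    · subst hs
      simp [F, hft]
    · simp [F, hs, hfs s hs]
  simpa only [hF1] using h1

theorem Admissible.exists_generic [Finite κ] [Finite T] {f : T → Eu (k + 1) → Amb k}
    (hf : C.Admissible f)
    (hdeg : ∀ s t, C.far s t → HasDeg (fun z => f s (xp z) - f t (yp z)) 0) :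
    ∃ f', C.Admissible f' ∧ (∀ s t, C.far s t → HasDeg (fun z => f' s (xp z) - f' t (yp z)) 0) ∧
      (∀ t, ∀ x ∈ openCube (k + 1), ∀ c u, f' t x ≠ C.low c u) ∧
      (∀ s t, s ≠ t → ∀ x ∈ openCube (k + 1), ∀ y ∈ openCube (k + 1), f' s x = f' t y →
        orn (splitEquiv k) (fderiv ℝ (f' s) x) (fderiv ℝ (f' t) y) ≠ 0) ∧
      ∀ s t t', s ≠ t → s ≠ t' → t ≠ t' → ∀ x ∈ openCube (k + 1), ∀ y ∈ openCube (k + 1),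
        ∀ z ∈ openCube (k + 1), f' s x = f' t y → f' s x ≠ f' t' z := by
  classical
  have := Fintype.ofFinite T
  obtain ⟨χ, hχs, hχ, -⟩ := (isOpen_interior (s := Set.Icc (0 : Eu (k + 1)) 1)).exists_contDiff_support_eq (n := 2)
  have hχ : ContDiff ℝ 2 χ := hχ
  have hχU : ∀ x ∈ openCube (k + 1), χ x ≠ 0 := fun x hx => by
    have hx : x ∈ Function.support χ := hχs ▸ hx
    exact hx
  have hχ0 : ∀ x ∉ openCube (k + 1), χ x = 0 := fun x hx => by
    have hx : x ∉ Function.support χ := by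
      rw [hχs]
      exact hx
    simpa using hx
  suffices ∀ S : Finset T, ∃ f', C.Admissible f' ∧
      (∀ s t, C.far s t → HasDeg (fun z => f' s (xp z) - f' t (yp z)) 0) ∧
      (∀ t ∈ S, ∀ x ∈ openCube (k + 1), ∀ c u, f' t x ≠ C.low c u) ∧
      (∀ s ∈ S, ∀ t ∈ S, s ≠ t → ∀ x ∈ openCube (k + 1), ∀ y ∈ openCube (k + 1), f' s x = f' t y →
        orn (splitEquiv k) (fderiv ℝ (f' s) x) (fderiv ℝ (f' t) y) ≠ 0) ∧
      ∀ s ∈ S, ∀ t ∈ S, ∀ t' ∈ S, s ≠ t → s ≠ t' → t ≠ t' → ∀ x ∈ openCube (k + 1),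
        ∀ y ∈ openCube (k + 1), ∀ z ∈ openCube (k + 1), f' s x = f' t y → f' s x ≠ f' t' z by
    obtain ⟨f', h1, h2, h3, h4, h5⟩ := this Finset.univ
    exact ⟨f', h1, h2, fun t => h3 t (Finset.mem_univ _),
      fun s t => h4 s (Finset.mem_univ _) t (Finset.mem_univ _),
      fun s t t' => h5 s (Finset.mem_univ _) t (Finset.mem_univ _) t' (Finset.mem_univ _)⟩
  intro S
  induction S using Finset.induction_on with
  | empty => exact ⟨f, hf, hdeg, by simp, by simp, by simp⟩
  | insert a S ha ih =>
    obtain ⟨f, hf, hdeg, hlow, htr, htrip⟩ := ih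
    obtain ⟨δ, hδ, hpert⟩ := hf.exists_perturb hdeg hχ hχ0 a
    have hf1 : ∀ t, ContDiff ℝ 1 (f t) := fun t => (hf.smooth t).of_le (by norm_num)
    let Z : Set (Amb k) := ⋃ p : {p : S × S // p.1 ≠ p.2}, (fun q : Eu (k + 1) × Eu (k + 1) => f p.1.1 q.1) ''
      {q ∈ openCube (k + 1) ×ˢ openCube (k + 1) | f p.1.1 q.1 = f p.1.2 q.2}
    have hZ : Z.Countable := Set.countable_iUnion fun p => by
      refine Set.Countable.image (countable_coincidences (e := splitEquiv k)
        (M := fderiv ℝ (f p.1.1)) (D := fderiv ℝ (f p.1.2)) ?_ ?_ ?_) _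
      · exact fun q _ => ((hf1 _).differentiable (by simp) _).hasFDerivAt
      · exact fun q _ => ((hf1 _).differentiable (by simp) _).hasFDerivAt
      · exact fun q hq h => htr _ p.1.1.2 _ p.1.2.2 (fun h => p.2 (Subtype.ext h)) _ hq.1 _ hq.2 h
    have := hZ.to_subtype
    let g : κ ⊕ S ⊕ Z → Eu (k + 1) → Amb k := Sum.elim (fun c x => C.low c (Fin.tail x))
      (Sum.elim (fun s => f s) fun z _ => z)
    have hg : ∀ i, ContDiff ℝ 1 (g i) := by
      rintro (c | s | z)
      · exact (C.contDiff_low c).comp (contDiff_pi.2 fun j => contDiff_apply ℝ ℝ _)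
      · exact hf1 s
      · exact contDiff_const
    obtain ⟨v, hv, hvg⟩ := exists_transverse (e := splitEquiv k) isOpen_interior
      (hχ.of_le (by norm_num)) hχU (hf1 a) hg hδ
    let f' : T → Eu (k + 1) → Amb k := Function.update f a fun x => f a x + χ x • v
    have hfa : f' a = fun x => f a x + χ x • v := Function.update_self ..
    have hfs : ∀ s, s ≠ a → f' s = f s := fun s hs => Function.update_of_ne hs ..
    have hfS : ∀ s ∈ S, f' s = f s := fun s hs => hfs s fun h => ha (h ▸ hs)
    obtain ⟨hadm, hdeg'⟩ := hpert v hv f' (fun x => congrFun hfa x) hfs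
    have hdegen : ∀ (M D : Eu (k + 1) →L[ℝ] Amb k) u, u ≠ 0 → D u = 0 → orn (splitEquiv k) M D = 0 := by
      intro M D u hu hD
      by_contra h
      exact hu (orn_ne_zero_iff.1 h 0 u (by simp [hD])).2
    have hsing : (Pi.single 0 1 : Eu (k + 1)) ≠ 0 := by simp
    have hfaS : ∀ s ∈ S, ∀ x ∈ openCube (k + 1), ∀ y, f' a x = f s y →
        orn (splitEquiv k) (fderiv ℝ (f' a) x) (fderiv ℝ (f s) y) ≠ 0 := by
      intro s hs x hx y h
      rw [hfa] at h ⊢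
      exact hvg (Sum.inr (Sum.inl ⟨s, hs⟩)) x hx y h
    have hfaZ : ∀ z ∈ Z, ∀ x ∈ openCube (k + 1), f' a x ≠ z := by
      intro z hz x hx h
      rw [hfa] at h
      refine hvg (Sum.inr (Sum.inr ⟨z, hz⟩)) x hx 0 h (hdegen _ _ _ hsing ?_)
      simp [g]
    have hmemZ : ∀ s ∈ S, ∀ t ∈ S, s ≠ t → ∀ x ∈ openCube (k + 1), ∀ y ∈ openCube (k + 1),
        f s x = f t y → f s x ∈ Z := by
      intro s hs t ht hst x hx y hy h
      exact Set.mem_iUnion.2 ⟨⟨(⟨s, hs⟩, ⟨t, ht⟩), fun h => hst (congrArg Subtype.val h)⟩, (x, y), ⟨⟨hx, hy⟩, h⟩, rfl⟩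
    refine ⟨f', hadm, hdeg', ?_, ?_, ?_⟩
    · intro t ht x hx c u h
      rcases Finset.mem_insert.1 ht with rfl | ht
      · rw [hfa] at h
        refine hvg (Sum.inl c) x hx (Fin.cons 0 u : Eu (k + 1)) h (hdegen _ _ _ hsing ?_)
        let P : Eu (k + 1) →L[ℝ] Eu k := ContinuousLinearMap.pi fun i =>
          ContinuousLinearMap.proj (R := ℝ) (φ := fun _ => ℝ) i.succ
        have h1 : HasFDerivAt (g (Sum.inl c)) (C.B c ∘L P) (Fin.cons 0 u : Eu (k + 1)) :=
          ((C.B c ∘L P).hasFDerivAt).const_add (C.β c)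
        rw [h1.fderiv]
        have : P (Pi.single 0 1) = 0 := by
          ext i
          simp [P]
        simp [this]
      · rw [hfS t ht] at h
        exact hlow t ht x hx c u h
    · intro s hs₀ t ht₀ hst x hx y hy h
      rcases Finset.mem_insert.1 hs₀ with rfl | hs
      · rcases Finset.mem_insert.1 ht₀ with rfl | ht
        · exact absurd rfl hst
        · rw [hfS t ht] at h ⊢
          exact hfaS t ht x hx y h
      · rcases Finset.mem_insert.1 ht₀ with rfl | ht
        · rw [hfS s hs] at h ⊢
          have := orn_ne_zero_iff.1 (hfaS s hs y hy x h.symm)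
          exact orn_ne_zero_iff.2 fun u v huv => (this v u (by rwa [add_comm])).symm
        · rw [hfS s hs, hfS t ht] at h ⊢
          exact htr s hs t ht hst x hx y hy h
    · intro s hs₀ t ht₀ t' ht₀' h1 h2 h3 x hx y hy z hz h h'
      rcases Finset.mem_insert.1 hs₀ with rfl | hs
      · have ht := Finset.mem_of_mem_insert_of_ne ht₀ (Ne.symm h1)
        have ht' := Finset.mem_of_mem_insert_of_ne ht₀' (Ne.symm h2)
        rw [hfS t ht] at h
        rw [hfS t' ht'] at h'
        exact hfaZ _ (hmemZ t ht t' ht' h3 y hy z hz (h.symm.trans h')) x hx h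
      · rw [hfS s hs] at h h'
        rcases Finset.mem_insert.1 ht₀ with rfl | ht
        · have ht' := Finset.mem_of_mem_insert_of_ne ht₀' (Ne.symm h3)
          rw [hfS t' ht'] at h'
          exact hfaZ _ (hmemZ s hs t' ht' h2 x hx z hz h') y hy h.symm
        · rw [hfS t ht] at h
          rcases Finset.mem_insert.1 ht₀' with rfl | ht'
          · exact hfaZ _ (hmemZ s hs t ht h1 x hx y hy h) z hz h'.symm
          · rw [hfS t' ht'] at h'
            exact htrip s hs t ht t' ht' h1 h2 h3 x hx y hy z hz h h'

end Complex
end generic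

section
variable {k : ℕ}

/-- The reflection changing the sign of the second block. -/
noncomputable def flipSnd (k : ℕ) : (Eu (k + 1) × Eu (k + 1)) →L[ℝ] Eu (k + 1) × Eu (k + 1) :=
  (ContinuousLinearMap.id ℝ _).prodMap (-ContinuousLinearMap.id ℝ _)

theorem det_flipSnd_ne_zero : (flipSnd k).toLinearMap.det ≠ 0 := by
  have h : (flipSnd k).toLinearMap ∘ₗ (flipSnd k).toLinearMap = LinearMap.id := by
    refine LinearMap.ext fun p => ?_
    simp [flipSnd]
  have := congrArg LinearMap.det h
  rw [LinearMap.det_comp, LinearMap.det_id] at this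
  exact fun h0 => by simp [h0] at this

theorem fderiv_sub_blocks {f g : Eu (k + 1) → Amb k} (hf : ContDiff ℝ 1 f) (hg : ContDiff ℝ 1 g)
    (z : Amb k) : (fderiv ℝ (fun z => f (xp z) - g (yp z)) z).det =
      orn (splitEquiv k) (fderiv ℝ f (xp z)) (fderiv ℝ g (yp z)) * (flipSnd k).toLinearMap.det := by
  set M := fderiv ℝ f (xp z)
  set D := fderiv ℝ g (yp z)
  let P : Amb k →L[ℝ] Eu (k + 1) := ContinuousLinearMap.fst ℝ _ _ ∘L
    ((splitEquiv k).symm : Amb k →L[ℝ] Eu (k + 1) × Eu (k + 1))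
  let P' : Amb k →L[ℝ] Eu (k + 1) := ContinuousLinearMap.snd ℝ _ _ ∘L
    ((splitEquiv k).symm : Amb k →L[ℝ] Eu (k + 1) × Eu (k + 1))
  have hM : HasFDerivAt f M (P z) := ((hf.differentiable (by simp)) _).hasFDerivAt
  have hD : HasFDerivAt g D (P' z) := ((hg.differentiable (by simp)) _).hasFDerivAt
  have h : HasFDerivAt (fun z => f (xp z) - g (yp z)) (M ∘L P - D ∘L P') z :=
    (hM.comp z P.hasFDerivAt).sub (hD.comp z P'.hasFDerivAt)
  rw [h.fderiv, orn]
  let e : (Eu (k + 1) × Eu (k + 1)) ≃ₗ[ℝ] Amb k := (splitEquiv k).toLinearEquiv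
  let S : (Eu (k + 1) × Eu (k + 1)) →ₗ[ℝ] Eu (k + 1) × Eu (k + 1) :=
    e.symm.toLinearMap ∘ₗ (M.coprod D).toLinearMap
  have h1 : (M ∘L P - D ∘L P').toLinearMap =
      e.toLinearMap ∘ₗ (S ∘ₗ (flipSnd k).toLinearMap) ∘ₗ e.symm.toLinearMap := by
    refine LinearMap.ext fun w => ?_
    simp only [LinearMap.comp_apply, S, LinearEquiv.coe_coe, LinearEquiv.apply_symm_apply]
    show M (xp w) - D (yp w) = M.coprod D (xp w, - yp w)
    rw [ContinuousLinearMap.coprod_apply, map_neg, sub_eq_add_neg]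
  show LinearMap.det (M ∘L P - D ∘L P').toLinearMap = LinearMap.det S * _
  rw [h1, LinearMap.det_conj, LinearMap.det_comp]

end

namespace Complex

variable {k : ℕ} {T κ : Type*} {C : Complex k T κ}

theorem finsum_sign_orn {f : T → Eu (k + 1) → Amb k} (hf : C.Admissible f) {s t : T} (hst : C.far s t)
    (hdeg : HasDeg (fun z => f s (xp z) - f t (yp z)) 0)
    (htr : ∀ x ∈ openCube (k + 1), ∀ y ∈ openCube (k + 1), f s x = f t y →
      orn (splitEquiv k) (fderiv ℝ (f s) x) (fderiv ℝ (f t) y) ≠ 0) :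
    ∑ᶠ p ∈ {p ∈ openCube (k + 1) ×ˢ openCube (k + 1) | f s p.1 = f t p.2},
      (SignType.sign (orn (splitEquiv k) (fderiv ℝ (f s) p.1) (fderiv ℝ (f t) p.2)) : ℤ) = 0 := by
  have hf1 : ∀ t, ContDiff ℝ 1 (f t) := fun t => (hf.smooth t).of_le (by norm_num)
  have hmem : ∀ z : Amb k, z ∈ Set.Icc (0 : Amb k) 1 → f s (xp z) - f t (yp z) = 0 →
      xp z ∈ openCube (k + 1) ∧ yp z ∈ openCube (k + 1) := by
    intro z hz h
    have hi : ∀ i, z i ∈ Set.Ioo (0 : ℝ) 1 := by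
      intro i
      have : ¬ (z i = 0 ∨ z i = 1) := fun hzi => hf.ne_zero_of_face hst hz ⟨i, hzi⟩ h
      rw [not_or] at this
      exact ⟨lt_of_le_of_ne (hz.1 i) (Ne.symm this.1), lt_of_le_of_ne (hz.2 i) this.2⟩
    rw [openCube, ← Set.pi_univ_Icc, interior_pi_set Set.finite_univ]
    simp only [Set.mem_univ_pi, interior_Icc]
    exact ⟨fun i => hi _, fun i => hi _⟩
  have hIcc : ∀ z : Amb k, xp z ∈ Set.Icc (0 : Eu (k + 1)) 1 → yp z ∈ Set.Icc (0 : Eu (k + 1)) 1 →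
      z ∈ Set.Icc (0 : Amb k) 1 := by
    intro z h1 h2
    constructor <;> intro i
    · induction i using Fin.addCases with
      | left i => exact h1.1 i
      | right i => exact h2.1 i
    · induction i using Fin.addCases with
      | left i => exact h1.2 i
      | right i => exact h2.2 i
  have hG : ContDiff ℝ 1 fun z : Amb k => f s (xp z) - f t (yp z) :=
    (hf.contDiff_sub s t).of_le (by norm_num)
  obtain ⟨-, h⟩ := hasDeg_of_nondegenerate hG (fun z hz hzi => hf.ne_zero_of_face hst hz hzi)
    (fun z hz h => by
      rw [fderiv_sub_blocks (hf1 s) (hf1 t)]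
      obtain ⟨h1, h2⟩ := hmem z hz h
      exact mul_ne_zero (htr _ h1 _ h2 (sub_eq_zero.1 h)) det_flipSnd_ne_zero)
  have h0 := h.unique hdeg
  have hset : {z ∈ Set.Icc (0 : Amb k) 1 | f s (xp z) - f t (yp z) = 0} = splitEquiv k ''
      {p ∈ openCube (k + 1) ×ˢ openCube (k + 1) | f s p.1 = f t p.2} := by
    ext z
    constructor
    · rintro ⟨hz, h⟩
      exact ⟨(xp z, yp z), ⟨hmem z hz h, sub_eq_zero.1 h⟩, (splitEquiv k).apply_symm_apply z⟩
    · rintro ⟨p, ⟨⟨h1, h2⟩, h⟩, rfl⟩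
      have hp := (splitEquiv k).symm_apply_apply p
      rw [splitEquiv_symm] at hp
      have hx : xp (splitEquiv k p) = p.1 := congrArg Prod.fst hp
      have hy : yp (splitEquiv k p) = p.2 := congrArg Prod.snd hp
      refine ⟨hIcc _ (hx ▸ interior_subset h1) (hy ▸ interior_subset h2), ?_⟩
      rw [hx, hy]
      exact sub_eq_zero.2 h
  rw [hset, finsum_mem_image ((splitEquiv k).injective.injOn)] at h0
  have hterm : ∀ p : Eu (k + 1) × Eu (k + 1), (SignType.sign (fderiv ℝ (fun z => f s (xp z) - f t (yp z))
      (splitEquiv k p)).det : ℤ) = SignType.sign (flipSnd k).toLinearMap.det *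
      SignType.sign (orn (splitEquiv k) (fderiv ℝ (f s) p.1) (fderiv ℝ (f t) p.2)) := by
    intro p
    have hp := (splitEquiv k).symm_apply_apply p
    rw [splitEquiv_symm] at hp
    have hx : xp (splitEquiv k p) = p.1 := congrArg Prod.fst hp
    have hy : yp (splitEquiv k p) = p.2 := congrArg Prod.snd hp
    rw [fderiv_sub_blocks (hf1 s) (hf1 t), hx, hy, sign_mul, mul_comm]
    push_cast
    rfl
  simp only [hterm] at h0
  rw [← mul_finsum_mem] at h0
  refine (mul_eq_zero.1 h0).resolve_left ?_
  rcases lt_or_gt_of_ne (det_flipSnd_ne_zero (k := k)) with h | h <;> simp [h]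

theorem exists_disjoint [Finite κ] [Finite T] (hk : 1 < k) {e : κ → T → ℤ}
    (he : ∀ s t, C.far s t → HasDeg (fun z => C.top s (xp z) - C.top t (yp z)) (C.bd e s t)) :
    ∃ g : T → Eu (k + 1) → Amb k, (∀ t, Continuous (g t)) ∧
      (∀ t, ∀ y ∈ Set.Icc (0 : Eu (k + 1)) 1, (∃ i, y i = 0 ∨ y i = 1) → g t y = C.top t y) ∧
      (∀ s t, C.far s t → ∀ x ∈ Set.Icc (0 : Eu (k + 1)) 1, ∀ y ∈ Set.Icc (0 : Eu (k + 1)) 1,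
        g s x ≠ g t y) ∧
      ∀ t c, C.farL t c → ∀ y ∈ Set.Icc (0 : Eu (k + 1)) 1, ∀ u ∈ Set.Icc (0 : Eu k) 1,
        g t y ≠ C.low c u := by
  obtain ⟨f, hf, hdeg⟩ := exists_degree_zero hk he
  obtain ⟨f, hf, hdeg, hlow, htr, htrip⟩ := hf.exists_generic hdeg
  have hf1 : ∀ t, ContDiff ℝ 1 (f t) := fun t => (hf.smooth t).of_le (by norm_num)
  have hcl : closedBall (ctr (k + 1)) (1 / 2) = Set.Icc (0 : Eu (k + 1)) 1 := by
    rw [closedBall_pi _ (by norm_num), ← Set.pi_univ_Icc]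
    refine congrArg _ (funext fun i => ?_)
    rw [Real.closedBall_eq_Icc, ctr]
    norm_num
  have hop : ball (ctr (k + 1)) (1 / 2) = openCube (k + 1) := by
    rw [openCube, ← hcl, interior_closedBall _ (by norm_num)]
  have hsph : ∀ x ∈ sphere (ctr (k + 1)) (1 / 2), x ∈ Set.Icc (0 : Eu (k + 1)) 1 ∧
      ∃ i, x i = 0 ∨ x i = 1 := by
    intro x hx
    have hx1 : x ∈ Set.Icc (0 : Eu (k + 1)) 1 := hcl ▸ sphere_subset_closedBall hx
    refine ⟨hx1, ?_⟩
    by_contra! h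
    have : x ∈ openCube (k + 1) := by
      rw [openCube, ← Set.pi_univ_Icc, interior_pi_set Set.finite_univ]
      simp only [Set.mem_univ_pi, interior_Icc]
      exact fun i => ⟨lt_of_le_of_ne (hx1.1 i) (h i).1.symm, lt_of_le_of_ne (hx1.2 i) (h i).2⟩
    rw [← hop, mem_ball] at this
    rw [mem_sphere] at hx
    linarith
  have hsph' : ∀ x : Eu (k + 1), x ∈ Set.Icc (0 : Eu (k + 1)) 1 → (∃ i, x i = 0 ∨ x i = 1) →
      x ∈ sphere (ctr (k + 1)) (1 / 2) := by
    intro x hx hi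
    have h := notMem_interior_of_face hi
    rw [← hcl, ← ball_union_sphere] at hx
    exact hx.resolve_left fun hx => h (by rwa [hop] at hx)
  have : Nontrivial (Eu k) := by
    have : Nonempty (Fin k) := ⟨⟨0, by omega⟩⟩
    exact Function.nontrivial
  obtain ⟨χ, hχs, hχ, -⟩ := (isOpen_ball (x := ctr (k + 1)) (ε := 1 / 2)).exists_contDiff_support_eq (n := 1)
  let P : Eu (k + 1) →L[ℝ] Eu k := ContinuousLinearMap.pi fun i =>
    ContinuousLinearMap.proj (R := ℝ) (φ := fun _ => ℝ) i.succ
  let i : (ℝ × Eu k) ≃L[ℝ] Eu (k + 1) := (Fin.consEquivL ℝ fun _ => ℝ)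
  let l : κ → Eu (k + 1) → Amb k := fun c y => C.low c (P y)
  have hl : ∀ c y, HasFDerivAt (l c) (C.B c ∘L P) y := fun c y =>
    ((C.B c ∘L P).hasFDerivAt).const_add (C.β c)
  have hP : ∀ y ∈ Set.Icc (0 : Eu (k + 1)) 1, P y ∈ Set.Icc (0 : Eu k) 1 := fun y hy =>
    ⟨fun j => hy.1 _, fun j => hy.2 _⟩
  have hPc : ∀ u ∈ Set.Icc (0 : Eu k) 1, ∃ y ∈ Set.Icc (0 : Eu (k + 1)) 1, P y = u := by
    intro u hu
    refine ⟨(Fin.cons 0 u : Eu (k + 1)), ⟨fun j => ?_, fun j => ?_⟩, ?_⟩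
    · refine Fin.cases ?_ (fun j => ?_) j
      · simp
      · simpa using hu.1 j
    · refine Fin.cases ?_ (fun j => ?_) j
      · simp
      · simpa using hu.2 j
    · ext j
      simp [P]
  have hfac : ∀ t, ∀ x ∈ sphere (ctr (k + 1)) (1 / 2), ∃ j b, ∃ y ∈ closedBall (ctr (k + 1)) (1 / 2),
      l (C.facet t j b) y = f t x := by
    intro t x hx
    obtain ⟨hx1, hx2⟩ := hsph x hx
    obtain ⟨j, b, u, hu, h⟩ := exists_facet (C := C) t hx1 hx2
    obtain ⟨y, hy, rfl⟩ := hPc u hu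
    refine ⟨j, b, y, hcl ▸ hy, ?_⟩
    rw [hf.eq_top t x (notMem_interior_of_face hx2), h]
  obtain ⟨g, hg, hgs, hgg, hgl⟩ := whitney i (e := splitEquiv k) (c := ctr (k + 1)) (r := 1 / 2) (χ := χ)
    (far := C.far) (farL := C.farL) (f := f) (l := l) (by simp; omega) (by norm_num) hχ
    (fun x hx => by
      rw [← hχs] at hx
      exact hx)
    (fun x hx => by
      have : x ∉ Function.support χ := by
        rw [hχs, mem_ball]
        rw [mem_sphere] at hx
        exact hx.not_lt
      simpa using this)
    C.symm C.irrefl hf1 (fun c => (C.contDiff_low c).comp P.contDiff)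
    (fun c y => ⟨Pi.single 0 1, by simp, by
      rw [(hl c y).fderiv]
      have : P (Pi.single 0 1) = 0 := by
        ext j
        simp [P]
      simp [this]⟩)
    (fun t x hx => by
      obtain ⟨j, b, y, hy, h⟩ := hfac t x hx
      exact ⟨_, y, hy, h⟩)
    (fun t x hx c y _ => hlow t x (hop ▸ hx) c _)
    (fun t c hc x hx y hy => hf.avoid t c hc x (hsph x hx).1 _ (hP y (hcl ▸ hy)))
    (fun s t hst x hx => by
      obtain ⟨j, b, y, hy, h⟩ := hfac t x hx
      exact ⟨_, C.far_facet s t hst j b, y, hy, h⟩)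
    (fun t => hcl ▸ hf.injOn t)
    (fun t x hx => hf.immersion t x (hcl ▸ ball_subset_closedBall hx))
    (hop ▸ htr) (hop ▸ htrip)
    (fun s t hst => by
      rw [hop]
      exact finsum_sign_orn hf hst (hdeg s t hst) (htr s t fun h => C.irrefl t (h ▸ hst)))
  refine ⟨g, hg, fun t y hy hi => ?_, fun s t hst => hcl ▸ hgg s t hst, fun t c hc y hy u hu => ?_⟩
  · rw [hgs t (hsph' y hy hi), hf.eq_top t y (notMem_interior_of_face hi)]
  · obtain ⟨z, hz, rfl⟩ := hPc u hu
    exact hgl t c hc y (hcl ▸ hy) z (hcl ▸ hz)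

end Complex

section generic
variable {k M : ℕ}

/-- Linear combinations of the vectors `L v`. -/
noncomputable def comb {V E : Type*} [Fintype V] [AddCommGroup E] [Module ℝ E] (L : V → E) :
    (V → ℝ) →ₗ[ℝ] E :=
  Fintype.linearCombination ℝ L

theorem comb_apply {V E : Type*} [Fintype V] [AddCommGroup E] [Module ℝ E] (L : V → E) (x : V → ℝ) :
    comb L x = ∑ v, x v • L v := rfl

/-- The bilinear expression with coefficients `c`. -/
noncomputable def bil {V E : Type*} [Fintype V] [AddCommGroup E] [Module ℝ E] (c : V → V → E)
    (x y : V → ℝ) : E :=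
  ∑ v, ∑ w, (x v * y w) • c v w

theorem exists_avoiding {ι : Type*} [Countable ι] {m : ℕ} {E : Type*} [NormedAddCommGroup E]
    [NormedSpace ℝ E] [FiniteDimensional ℝ E] (hm : m < Module.finrank ℝ E)
    (w : ι → Eu m → Fin (M + 1) → ℝ) (hw : ∀ i v, ContDiff ℝ 1 fun s => w i s v)
    (u : ι → Eu m → E) (hu : ∀ i, ContDiff ℝ 1 (u i)) (v₀ : ι → Fin (M + 1))
    (h₀ : ∀ i s, w i s (v₀ i) ≠ 0) :
    ∃ L : Fin (M + 1) → E, ∀ i s, comb L (w i s) ≠ u i s := by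
  let G : ι → Eu m × (Fin M → E) → Fin (M + 1) → E := fun i p =>
    (v₀ i).insertNth ((w i p.1 (v₀ i))⁻¹ • (u i p.1 - ∑ j, w i p.1 ((v₀ i).succAbove j) • p.2 j)) p.2
  have hG : ∀ i, ContDiff ℝ 1 (G i) := by
    intro i
    refine contDiff_pi.2 fun v => ?_
    have hp : ∀ j, ContDiff ℝ 1 fun p : Eu m × (Fin M → E) => p.2 j := fun j =>
      (contDiff_apply ℝ E j).comp contDiff_snd
    refine Fin.succAboveCases (v₀ i) ?_ (fun j => ?_) v
    · simp only [G, Fin.insertNth_apply_same]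
      refine ContDiff.fun_smul (((hw i _).comp contDiff_fst).inv fun p => h₀ i _) ?_
      exact ((hu i).comp contDiff_fst).sub (ContDiff.sum fun j _ =>
        ((hw i _).comp contDiff_fst).fun_smul (hp j))
    · simp only [G, Fin.insertNth_apply_succAbove]
      exact hp j
  have hdim : Module.finrank ℝ (Eu m × (Fin M → E)) < Module.finrank ℝ (Fin (M + 1) → E) := by
    simp only [Module.finrank_prod, Module.finrank_pi_fintype, Module.finrank_self,
      Finset.sum_const, Finset.card_univ, Fintype.card_fin, smul_eq_mul]
    linarith
  obtain ⟨L, hL⟩ := (dense_compl_iUnion_range hG hdim).nonempty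
  refine ⟨L, fun i s h => hL (Set.mem_iUnion.2 ⟨i, (s, fun j => L ((v₀ i).succAbove j)), ?_⟩)⟩
  have h1 : w i s (v₀ i) • L (v₀ i) = u i s - ∑ j, w i s ((v₀ i).succAbove j) • L ((v₀ i).succAbove j) := by
    rw [← h, comb_apply, Fin.sum_univ_succAbove _ (v₀ i), add_sub_cancel_right]
  simp only [G]
  rw [← h1, inv_smul_smul₀ (h₀ i s)]
  exact Fin.insertNth_self_removeNth (v₀ i) L

/-- A finite family of real numbers as a vector of given length. -/
theorem exists_param {P : Type*} [Fintype P] {m : ℕ} (h : Fintype.card P ≤ m) (f : P → ℝ) :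
    ∃ (q : P → Fin m) (s : Eu m), ∀ p, s (q p) = f p := by
  obtain ⟨q⟩ := Function.Embedding.nonempty_of_card_le (α := P) (β := Fin m) (by simpa using h)
  exact ⟨q, Function.extend q f 0, fun p => q.injective.extend_apply f 0 p⟩

theorem exists_vertices (c : Fin (M + 1) → Fin (M + 1) → Amb k) :
    ∃ L : Fin (M + 1) → Amb k, ∀ (a a' : Fin (M + 1) → ℚ) (R R' : Finset (Fin (M + 1))),
      (∃ v, v ∉ R ∧ v ∉ R' ∧ a v ≠ a' v) → ∀ x y : Fin (M + 1) → ℝ, (∀ v ∉ R, x v = a v) →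
      (∀ v ∉ R', y v = a' v) → (R.card + R'.card ≤ 2 * k + 1 → comb L x ≠ comb L y) ∧
      (R.card + R'.card ≤ 2 * k → ∀ r : ℝ, comb L (x - y) ≠ r • bil c x y) := by
  classical
  let V := Fin (M + 1)
  let m := 2 * k + 1
  let ι := {i : ((V → ℚ) × (V → ℚ)) × (Finset V × Finset V) × (V → Fin m) × (V → Fin m) × Option (Fin m) //
    ∃ v, v ∉ i.2.1.1 ∧ v ∉ i.2.1.2 ∧ i.1.1 v ≠ i.1.2 v}
  let pat : (V → ℚ) → Finset V → (V → Fin m) → Eu m → V → ℝ := fun a R q s v =>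
    if v ∈ R then s (q v) else a v
  have hpat : ∀ a R q v, ContDiff ℝ 1 fun s => pat a R q s v := by
    intro a R q v
    by_cases h : v ∈ R
    · simp only [pat, if_pos h]
      exact contDiff_apply ℝ ℝ _
    · simp only [pat, if_neg h]
      exact contDiff_const
  let X : ι → Eu m → V → ℝ := fun i => pat i.1.1.1 i.1.2.1.1 i.1.2.2.1
  let Y : ι → Eu m → V → ℝ := fun i => pat i.1.1.2 i.1.2.1.2 i.1.2.2.2.1
  let r : ι → Eu m → ℝ := fun i s => i.1.2.2.2.2.elim 0 s
  have hr : ∀ i, ContDiff ℝ 1 (r i) := by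
    intro i
    simp only [r]
    cases i.1.2.2.2.2 with
    | none => exact contDiff_const
    | some j => exact contDiff_apply ℝ ℝ _
  obtain ⟨L, hL⟩ := exists_avoiding (m := m) (E := Amb k) (by simp [m]; omega)
    (fun (i : ι) s => X i s - Y i s) (fun i v => (hpat _ _ _ v).sub (hpat _ _ _ v))
    (fun i s => r i s • bil c (X i s) (Y i s))
    (fun i => (hr i).fun_smul (ContDiff.sum fun v _ => ContDiff.sum fun w _ =>
      ((hpat _ _ _ v).mul (hpat _ _ _ w)).fun_smul contDiff_const))
    (fun i => i.2.choose) (fun i s => by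
      obtain ⟨h1, h2, h3⟩ := i.2.choose_spec
      simp only [X, Y, pat, Pi.sub_apply, if_neg h1, if_neg h2]
      exact sub_ne_zero.2 (by exact_mod_cast h3))
  have key : ∀ (a a' : V → ℚ) (R R' : Finset V), (∃ v, v ∉ R ∧ v ∉ R' ∧ a v ≠ a' v) →
      ∀ (q q' : V → Fin m) (o : Option (Fin m)) (s : Eu m) (x y : V → ℝ), (∀ v ∉ R, x v = a v) →
      (∀ v ∉ R', y v = a' v) → (∀ v ∈ R, s (q v) = x v) → (∀ v ∈ R', s (q' v) = y v) →
      comb L (x - y) ≠ (o.elim 0 s : ℝ) • bil c x y := by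
    intro a a' R R' h q q' o s x y hx hy hq hq'
    have := hL ⟨((a, a'), (R, R'), q, q', o), h⟩ s
    have hX : pat a R q s = x := by
      funext v
      by_cases hv : v ∈ R
      · simp [pat, hv, hq]
      · simp [pat, hv, hx]
    have hY : pat a' R' q' s = y := by
      funext v
      by_cases hv : v ∈ R'
      · simp [pat, hv, hq']
      · simp [pat, hv, hy]
    simpa only [X, Y, r, hX, hY] using this
  refine ⟨L, fun a a' R R' h x y hx hy => ⟨fun hc => ?_, fun hc ρ => ?_⟩⟩
  · obtain ⟨q, s, hq⟩ := exists_param (P := R ⊕ R') (m := m) (by simpa using hc)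
      (Sum.elim (fun v => x v) fun v => y v)
    have := key a a' R R' h (fun v => if h : v ∈ R then q (Sum.inl ⟨v, h⟩) else 0)
      (fun v => if h : v ∈ R' then q (Sum.inr ⟨v, h⟩) else 0) none s x y hx hy
      (fun v hv => by simp [hv, hq]) (fun v hv => by simp [hv, hq])
    rw [Option.elim_none, zero_smul, map_sub] at this
    exact sub_ne_zero.1 this
  · obtain ⟨q, s, hq⟩ := exists_param (P := Option (R ⊕ R')) (m := m) (by simpa [m] using hc)
      (fun o => o.elim ρ (Sum.elim (fun v => x v) fun v => y v))
    have := key a a' R R' h (fun v => if h : v ∈ R then q (some (Sum.inl ⟨v, h⟩)) else 0)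
      (fun v => if h : v ∈ R' then q (some (Sum.inr ⟨v, h⟩)) else 0) (some (q none)) s x y hx hy
      (fun v hv => by simp [hv, hq]) (fun v hv => by simp [hv, hq])
    simpa [hq] using this

end generic

section cells
variable {V : Type*} [Fintype V] [LinearOrder V] {m : ℕ} {R : Finset V}

/-- The vertex of `R` in the given position, if there is one. -/
def cellVertex (R : Finset V) (m : ℕ) (j : Fin m) : Option V :=
  if h : (j : ℕ) < R.card then some (R.orderEmbOfFin rfl ⟨j, h⟩) else none

/-- Vectors supported in `R`, in coordinates. -/
def dir (R : Finset V) (m : ℕ) : Eu m →ₗ[ℝ] V → ℝ where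
  toFun u v := ∑ j, if cellVertex R m j = some v then u j else 0
  map_add' u w := by
    funext v
    simp only [Pi.add_apply, ← Finset.sum_add_distrib]
    refine Finset.sum_congr rfl fun j _ => ?_
    split_ifs <;> simp
  map_smul' a u := by
    funext v
    simp only [Pi.smul_apply, smul_eq_mul, RingHom.id_apply, Finset.mul_sum, mul_ite, mul_zero]

theorem cellVertex_mem {j : Fin m} {v : V} (h : cellVertex R m j = some v) : v ∈ R := by
  rw [cellVertex] at h
  split_ifs at h with hj
  rw [← Option.some.inj h]
  exact R.orderEmbOfFin_mem _ _

theorem cellVertex_inj {i j : Fin m} {v : V} (hi : cellVertex R m i = some v)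
    (hj : cellVertex R m j = some v) : i = j := by
  rw [cellVertex] at hi hj
  split_ifs at hi hj with h1 h2
  have := (R.orderEmbOfFin rfl).injective ((Option.some.inj hi).trans (Option.some.inj hj).symm)
  exact Fin.ext (Fin.mk.inj_iff.1 this)

theorem exists_cellVertex (h : R.card ≤ m) {v : V} (hv : v ∈ R) : ∃ j, cellVertex R m j = some v := by
  have : v ∈ Set.range (R.orderEmbOfFin rfl) := by
    rw [R.range_orderEmbOfFin]
    exact hv
  obtain ⟨i, rfl⟩ := this
  exact ⟨⟨i, i.2.trans_le h⟩, by rw [cellVertex, dif_pos i.2]⟩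

theorem dir_of_notMem {v : V} (hv : v ∉ R) (u : Eu m) : dir R m u v = 0 := by
  show (∑ j, if cellVertex R m j = some v then u j else 0) = 0
  exact Finset.sum_eq_zero fun _ _ => if_neg fun h => hv (cellVertex_mem h)

theorem dir_of_eq {v : V} {j : Fin m} (h : cellVertex R m j = some v) (u : Eu m) : dir R m u v = u j := by
  show (∑ i, if cellVertex R m i = some v then u i else 0) = u j
  rw [Finset.sum_eq_single j, if_pos h]
  · exact fun i _ hi => if_neg fun h' => hi (cellVertex_inj h' h)
  · simp

/-- The coordinates of a vector on the vertices in `R`. -/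
def cellCoord (R : Finset V) (m : ℕ) (p : V → ℝ) : Eu m := fun j => (cellVertex R m j).elim 0 p

theorem dir_cellCoord (h : R.card ≤ m) {v : V} (hv : v ∈ R) (p : V → ℝ) :
    dir R m (cellCoord R m p) v = p v := by
  obtain ⟨j, hj⟩ := exists_cellVertex h hv
  rw [dir_of_eq hj, cellCoord, hj, Option.elim_some]

theorem cellVertex_of_card (h : R.card = m) (j : Fin m) :
    cellVertex R m j = some (R.orderEmbOfFin h j) := by
  subst h
  rw [cellVertex, dif_pos j.2]

theorem dir_injective (h : R.card = m) {u : Eu m} (hu : dir R m u = 0) : u = 0 := by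
  ext j
  rw [← dir_of_eq (cellVertex_of_card h j) u, hu]
  rfl

theorem cellVertex_erase (h : R.card = m + 1) (j : Fin (m + 1)) (i : Fin m) :
    cellVertex (R.erase (R.orderEmbOfFin h j)) m i = some (R.orderEmbOfFin h (j.succAbove i)) := by
  have hc : (R.erase (R.orderEmbOfFin h j)).card = m := by
    rw [Finset.card_erase_of_mem (R.orderEmbOfFin_mem h j), h, Nat.add_sub_cancel]
  rw [cellVertex_of_card hc]
  have := Finset.orderEmbOfFin_unique hc (f := fun i => R.orderEmbOfFin h (j.succAbove i))
    (fun i => Finset.mem_erase.2 ⟨fun h' => j.succAbove_ne i ((R.orderEmbOfFin h).injective h'),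
      R.orderEmbOfFin_mem h _⟩)
    ((R.orderEmbOfFin h).strictMono.comp (Fin.strictMono_succAbove j))
  rw [← this]

/-- The indicator of a set of vertices. -/
def vind (A : Finset V) : V → ℝ := fun v => if v ∈ A then 1 else 0

theorem vind_insertNth {A : Finset V} (h : R.card = m + 1) (hA : Disjoint A R) (j : Fin (m + 1)) (b : Bool)
    (u : Eu m) : vind A + dir R (m + 1) (j.insertNth (α := fun _ => ℝ) (cond b 1 0) u) =
      vind (cond b (insert (R.orderEmbOfFin h j) A) A) + dir (R.erase (R.orderEmbOfFin h j)) m u := by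
  funext v
  have hj : R.orderEmbOfFin h j ∉ A := fun h' => Finset.disjoint_left.1 hA h' (R.orderEmbOfFin_mem h j)
  show vind A v + (∑ i, if cellVertex R (m + 1) i = some v then _ else 0) = vind _ v +
    ∑ i, if cellVertex (R.erase (R.orderEmbOfFin h j)) m i = some v then u i else 0
  rw [Fin.sum_univ_succAbove _ j]
  simp only [Fin.insertNth_apply_same, Fin.insertNth_apply_succAbove, cellVertex_erase h,
    cellVertex_of_card h]
  rw [← add_assoc]
  congr 1
  cases b
  · simp
  · simp only [vind, cond_true, Finset.mem_insert, Option.some.injEq]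
    by_cases hv : R.orderEmbOfFin h j = v
    · subst hv
      simp [hj]
    · simp [hv, Ne.symm hv]

/-- The point of a cell with given coordinates. -/
def cellPt (p : Finset V × Finset V) (m : ℕ) (u : Eu m) : V → ℝ := vind p.1 + dir p.2 m u

theorem cellPt_of_notMem {p : Finset V × Finset V} {v : V} (hv : v ∉ p.2) (u : Eu m) :
    cellPt p m u v = vind p.1 v := by
  rw [cellPt, Pi.add_apply, dir_of_notMem hv, add_zero]

theorem cellPt_cellCoord {p : Finset V × Finset V} (hd : Disjoint p.1 p.2) (h : p.2.card ≤ m) {x : V → ℝ}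
    (h1 : ∀ v ∈ p.1, x v = 1) (h0 : ∀ v, v ∉ p.1 → v ∉ p.2 → x v = 0) :
    cellPt p m (cellCoord p.2 m x) = x := by
  funext v
  by_cases hv : v ∈ p.2
  · rw [cellPt, Pi.add_apply, dir_cellCoord h hv, vind, if_neg (Finset.disjoint_right.1 hd hv), zero_add]
  · rw [cellPt_of_notMem hv, vind]
    split_ifs with hv'
    · exact (h1 v hv').symm
    · exact (h0 v hv' hv).symm

theorem cellPt_nonneg (p : Finset V × Finset V) {u : Eu m} (hu : u ∈ Set.Icc (0 : Eu m) 1) (v : V) :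
    0 ≤ cellPt p m u v := by
  have h : 0 ≤ dir p.2 m u v := by
    show 0 ≤ ∑ j, if cellVertex p.2 m j = some v then u j else 0
    refine Finset.sum_nonneg fun j _ => ?_
    split_ifs
    · exact hu.1 j
    · exact le_rfl
  refine add_nonneg ?_ h
  rw [vind]
  split_ifs <;> norm_num

theorem cellPt_of_mem {p : Finset V × Finset V} (hd : Disjoint p.1 p.2) {v : V} (hv : v ∈ p.1) (u : Eu m) :
    cellPt p m u v = 1 := by
  rw [cellPt_of_notMem (Finset.disjoint_left.1 hd hv), vind, if_pos hv]

theorem cellPt_eq_zero {p : Finset V × Finset V} {v : V} (hv : v ∉ p.1 ∪ p.2) (u : Eu m) :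
    cellPt p m u v = 0 := by
  rw [Finset.mem_union, not_or] at hv
  rw [cellPt_of_notMem hv.2, vind, if_neg hv.1]

end cells

/-- A simplicial complex with a relation `far` and vectors `c` indexed by pairs of vertices. -/
structure Nerve (k M : ℕ) where
  S : Finset (Fin (M + 1)) → Prop
  mono : ∀ σ τ, σ ⊆ τ → S τ → S σ
  far : Fin (M + 1) → Fin (M + 1) → Prop
  symm : ∀ v w, far v w → far w v
  irrefl : ∀ v, ¬ far v v
  c : Fin (M + 1) → Fin (M + 1) → Amb k
  antisymm : ∀ v w, c w v = - c v w
  bil_ne_zero : ∀ σ τ, S σ → S τ → (∀ v ∈ σ, ∀ w ∈ τ, far v w) → ∀ x y : Fin (M + 1) → ℝ,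
    (∀ v, 0 ≤ x v) → (∀ v, 0 ≤ y v) → (∃ v, x v ≠ 0) → (∃ v, y v ≠ 0) → (∀ v ∉ σ, x v = 0) →
    (∀ v ∉ τ, y v = 0) → bil c x y ≠ 0

namespace Nerve
variable {k M : ℕ} (N : Nerve k M)

/-- The cell with given vertices. -/
structure IsCell (p : Finset (Fin (M + 1)) × Finset (Fin (M + 1))) : Prop where
  nonempty : p.1.Nonempty
  disj : Disjoint p.1 p.2
  simplex : N.S (p.1 ∪ p.2)

/-- Cells of dimension `k + 1`. -/
abbrev Top := {p : Finset (Fin (M + 1)) × Finset (Fin (M + 1)) // N.IsCell p ∧ p.2.card = k + 1}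

/-- Cells of dimension at most `k`. -/
abbrev Low := {p : Finset (Fin (M + 1)) × Finset (Fin (M + 1)) // N.IsCell p ∧ p.2.card ≤ k}

/-- Cells with pairwise far vertices. -/
def Far (p q : Finset (Fin (M + 1)) × Finset (Fin (M + 1))) : Prop :=
  ∀ v ∈ p.1 ∪ p.2, ∀ w ∈ q.1 ∪ q.2, N.far v w

variable {N}

theorem Far.symm {p q : Finset (Fin (M + 1)) × Finset (Fin (M + 1))} (h : N.Far p q) : N.Far q p :=
  fun v hv w hw => N.symm _ _ (h w hw v hv)

theorem Far.notMem {p q : Finset (Fin (M + 1)) × Finset (Fin (M + 1))} (h : N.Far p q)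
    {v : Fin (M + 1)} (hv : v ∈ p.1 ∪ p.2) : v ∉ q.1 ∪ q.2 := fun hq => N.irrefl v (h v hv v hq)

/-- A facet of a cell. -/
def facet (t : N.Top) (j : Fin (k + 1)) (b : Bool) : N.Low :=
  ⟨(cond b (insert (t.1.2.orderEmbOfFin t.2.2 j) t.1.1) t.1.1, t.1.2.erase (t.1.2.orderEmbOfFin t.2.2 j)), by
    obtain ⟨⟨A, R⟩, ⟨hne, hd, hs⟩, hc⟩ := t
    simp only at hc hne hd hs
    have hm := R.orderEmbOfFin_mem hc j
    set r := R.orderEmbOfFin hc j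
    refine ⟨⟨?_, ?_, N.mono _ _ ?_ hs⟩, ?_⟩
    · cases b
      · exact hne
      · exact Finset.insert_nonempty _ _
    · cases b
      · exact hd.mono_right (Finset.erase_subset _ _)
      · simp only [cond_true, Finset.disjoint_insert_left, Finset.mem_erase, ne_eq, not_true_eq_false,
          false_and, not_false_eq_true, true_and]
        exact hd.mono_right (Finset.erase_subset _ _)
    · refine Finset.union_subset ?_ ((Finset.erase_subset _ _).trans Finset.subset_union_right)
      cases b
      · exact Finset.subset_union_left
      · exact Finset.insert_subset (Finset.mem_union_right _ hm) Finset.subset_union_left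
    · simp only
      rw [Finset.card_erase_of_mem hm, hc, Nat.add_sub_cancel]⟩

theorem facet_card (t : N.Top) (j : Fin (k + 1)) (b : Bool) : (facet t j b).1.2.card = k := by
  show (t.1.2.erase (t.1.2.orderEmbOfFin t.2.2 j)).card = k
  rw [Finset.card_erase_of_mem (t.1.2.orderEmbOfFin_mem _ j), t.2.2, Nat.add_sub_cancel]

theorem facet_subset (t : N.Top) (j : Fin (k + 1)) (b : Bool) :
    (facet t j b).1.1 ∪ (facet t j b).1.2 ⊆ t.1.1 ∪ t.1.2 := by
  refine Finset.union_subset ?_ ((Finset.erase_subset _ _).trans Finset.subset_union_right)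
  cases b
  · exact Finset.subset_union_left
  · exact Finset.insert_subset (Finset.mem_union_right _ (t.1.2.orderEmbOfFin_mem t.2.2 j))
      Finset.subset_union_left

theorem cellPt_facet (t : N.Top) (j : Fin (k + 1)) (b : Bool) (u : Eu k) :
    cellPt t.1 (k + 1) (j.insertNth (α := fun _ => ℝ) (cond b 1 0) u) = cellPt (facet t j b).1 k u :=
  vind_insertNth t.2.2 t.2.1.disj j b u

variable (N) in
/-- Vertices in general position. -/
def General (L : Fin (M + 1) → Amb k) : Prop :=
  ∀ (a a' : Fin (M + 1) → ℚ) (R R' : Finset (Fin (M + 1))),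
      (∃ v, v ∉ R ∧ v ∉ R' ∧ a v ≠ a' v) → ∀ x y : Fin (M + 1) → ℝ, (∀ v ∉ R, x v = a v) →
      (∀ v ∉ R', y v = a' v) → (R.card + R'.card ≤ 2 * k + 1 → comb L x ≠ comb L y) ∧
      (R.card + R'.card ≤ 2 * k → ∀ r : ℝ, comb L (x - y) ≠ r • bil N.c x y)

namespace General
variable {L : Fin (M + 1) → Amb k}

theorem far_avoid {p q : Finset (Fin (M + 1)) × Finset (Fin (M + 1))} (hL : N.General L)
    (hp : N.IsCell p) (h : N.Far p q) {x y : Fin (M + 1) → ℝ} (hx : ∀ v ∉ p.2, x v = vind p.1 v)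
    (hy : ∀ v ∉ q.2, y v = vind q.1 v) : (p.2.card + q.2.card ≤ 2 * k + 1 → comb L x ≠ comb L y) ∧
      (p.2.card + q.2.card ≤ 2 * k → ∀ r : ℝ, comb L (x - y) ≠ r • bil N.c x y) := by
  obtain ⟨v, hv⟩ := hp.nonempty
  have hv' := h.notMem (Finset.mem_union_left _ hv)
  rw [Finset.mem_union, not_or] at hv'
  refine hL (fun v => if v ∈ p.1 then 1 else 0) (fun v => if v ∈ q.1 then 1 else 0) p.2 q.2
    ⟨v, Finset.disjoint_left.1 hp.disj hv, hv'.2, by simp [hv, hv'.1]⟩ x y (fun w hw => ?_) fun w hw => ?_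
  · rw [hx w hw, vind]
    split_ifs <;> simp
  · rw [hy w hw, vind]
    split_ifs <;> simp

theorem independent (hL : N.General L) {σ : Finset (Fin (M + 1))} (hσ : σ.card ≤ 2 * k + 2) {x : Fin (M + 1) → ℝ}
    (hx : ∀ v ∉ σ, x v = 0) (h : comb L x = 0) : x = 0 := by
  by_contra hne
  obtain ⟨v, hv⟩ := Function.ne_iff.1 hne
  have hvσ : v ∈ σ := by
    by_contra h'
    exact hv (hx v h')
  have := (hL (Pi.single v 1) 0 (σ.erase v) ∅ ⟨v, by simp, by simp, by simp⟩ ((x v)⁻¹ • x) 0 ?_ ?_).1 ?_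
  · rw [map_smul, h, smul_zero, map_zero] at this
    exact this rfl
  · intro w hw
    by_cases hwv : w = v
    · subst hwv
      simp only [Pi.smul_apply, smul_eq_mul, Pi.single_eq_same, Rat.cast_one]
      exact inv_mul_cancel₀ hv
    · rw [Pi.smul_apply, hx w fun h => hw (Finset.mem_erase.2 ⟨hwv, h⟩)]
      simp [Pi.single_eq_of_ne hwv]
  · simp
  · rw [Finset.card_erase_of_mem hvσ, Finset.card_empty]
    omega

/-- The complex of the cells mapped by the linear extension of the vertex map. -/
noncomputable def complex (hL : N.General L) : Complex k N.Top N.Low where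
  α t := comb L (vind t.1.1)
  A t := (comb L ∘ₗ dir t.1.2 (k + 1)).toContinuousLinearMap
  β c := comb L (vind c.1.1)
  B c := (comb L ∘ₗ dir c.1.2 k).toContinuousLinearMap
  facet := facet
  far s t := N.Far s.1 t.1
  farL t c := N.Far t.1 c.1
  facet_eq t j b u := by
    have := congrArg (comb L) (cellPt_facet t j b u)
    simp only [cellPt, map_add] at this
    exact this
  symm s t h := h.symm
  irrefl t h := by
    obtain ⟨v, hv⟩ := t.2.1.nonempty
    exact N.irrefl v (h v (Finset.mem_union_left _ hv) v (Finset.mem_union_left _ hv))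
  far_facet s t h j b v hv w hw := h v hv w (facet_subset t j b hw)
  avoid t c h y _ u _ := by
    have := (hL.far_avoid t.2.1 h (fun v hv => cellPt_of_notMem hv y)
      (fun v hv => cellPt_of_notMem hv u)).1 (by have := t.2.2; have := c.2.2; omega)
    simp only [cellPt, map_add] at this
    exact this
  injective t := by
    refine (injective_iff_map_eq_zero _).2 fun y hy => dir_injective t.2.2 ?_
    exact hL.independent (σ := t.1.2) (by have := t.2.2; omega) (fun v hv => dir_of_notMem hv y) hy
  joint t s j b h u y huy := by
    set c := facet s j b
    have hz : comb L (dir c.1.2 k u - dir t.1.2 (k + 1) y) = 0 := by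
      rw [map_sub, sub_eq_zero]
      exact huy
    have h0 := hL.independent (σ := c.1.2 ∪ t.1.2)
      ((Finset.card_union_le _ _).trans (by have := t.2.2; have := c.2.2; omega)) (fun v hv => ?_) hz
    · have h1 : ∀ v, dir c.1.2 k u v = 0 ∧ dir t.1.2 (k + 1) y v = 0 := by
        intro v
        have hv := sub_eq_zero.1 (congrFun h0 v)
        by_cases hvc : v ∈ c.1.2
        · have h2 := h.symm.notMem (Finset.mem_union_right _ hvc)
          rw [Finset.mem_union, not_or] at h2
          have h3 := dir_of_notMem (m := k + 1) h2.2 y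
          exact ⟨hv.trans h3, h3⟩
        · have h3 := dir_of_notMem (m := k) hvc u
          exact ⟨h3, hv.symm.trans h3⟩
      exact ⟨dir_injective (facet_card s j b) (funext fun v => (h1 v).1),
        dir_injective t.2.2 (funext fun v => (h1 v).2)⟩
    · rw [Finset.mem_union, not_or] at hv
      rw [Pi.sub_apply, dir_of_notMem hv.1, dir_of_notMem hv.2, sub_zero]
  centre s j b c hc u _ := by
    set c₀ := facet s j b
    have hcard : c₀.1.2.card = k := facet_card s j b
    let a : Fin (M + 1) → ℚ := fun v => if v ∈ c₀.1.1 then 1 else if v ∈ c₀.1.2 then 1 / 2 else 0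
    let a' : Fin (M + 1) → ℚ := fun v => if v ∈ c.1.1 then 1 else 0
    have hx : ∀ v ∉ (∅ : Finset (Fin (M + 1))), cellPt c₀.1 k (ctr k) v = a v := by
      intro v _
      by_cases hv : v ∈ c₀.1.2
      · obtain ⟨i, hi⟩ := exists_cellVertex hcard.le hv
        have hv' := Finset.disjoint_right.1 c₀.2.1.disj hv
        rw [cellPt, Pi.add_apply, dir_of_eq hi, vind, if_neg hv', ctr]
        simp [a, hv, hv']
      · rw [cellPt_of_notMem hv, vind]
        by_cases hv' : v ∈ c₀.1.1 <;> simp [a, hv, hv']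
    have hy : ∀ v ∉ c.1.2, cellPt c.1 k u v = a' v := by
      intro v hv
      rw [cellPt_of_notMem hv, vind]
      by_cases hv' : v ∈ c.1.1 <;> simp [a', hv']
    have hex : ∃ v, v ∉ (∅ : Finset (Fin (M + 1))) ∧ v ∉ c.1.2 ∧ a v ≠ a' v := by
      by_contra! hall
      have hall : ∀ v, v ∉ c.1.2 → a v = a' v := fun v => hall v (by simp)
      have h1 : c.1.1 ⊆ c₀.1.1 := by
        intro v hv
        have := hall v (Finset.disjoint_left.1 c.2.1.disj hv)
        simp only [a, a', if_pos hv] at this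
        by_contra hv'
        rw [if_neg hv'] at this
        split_ifs at this <;> norm_num at this
      have h2 : c₀.1.2 ⊆ c.1.2 := by
        intro v hv
        by_contra hv'
        have := hall v hv'
        have h3 := Finset.disjoint_right.1 c₀.2.1.disj hv
        simp only [a, a', if_neg h3, if_pos hv, if_neg fun h => h3 (h1 h)] at this
        norm_num at this
      have h3 : c₀.1.2 = c.1.2 := Finset.eq_of_subset_of_card_le h2 (c.2.2.trans hcard.ge)
      refine hc (Subtype.ext (Prod.ext (h1.antisymm fun v hv => ?_) h3.symm))
      by_contra hv'
      have := hall v (by rw [← h3]; exact Finset.disjoint_left.1 c₀.2.1.disj hv)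
      simp [a, a', hv, hv'] at this
    have := (hL a a' ∅ c.1.2 hex _ _ hx hy).1 (by have := c.2.2; simp; omega)
    simp only [cellPt, map_add] at this
    exact this.symm
  off t s j b h y := by
    have := (hL.far_avoid t.2.1 h (fun v hv => cellPt_of_notMem hv y)
      (fun v hv => cellPt_of_notMem hv (ctr k))).1 (by have := t.2.2; have := (facet s j b).2.2; omega)
    simp only [cellPt, map_add] at this
    exact this

theorem complex_top (hL : N.General L) (t : N.Top) (y : Eu (k + 1)) :
    hL.complex.top t y = comb L (cellPt t.1 (k + 1) y) := by
  rw [cellPt, map_add]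
  rfl

theorem complex_low (hL : N.General L) (c : N.Low) (u : Eu k) :
    hL.complex.low c u = comb L (cellPt c.1 k u) := by
  rw [cellPt, map_add]
  rfl

end General
end Nerve

theorem bil_swap {V E : Type*} [Fintype V] [AddCommGroup E] [Module ℝ E] {c : V → V → E}
    (hc : ∀ v w, c w v = - c v w) (x y : V → ℝ) : bil c y x = - bil c x y := by
  rw [bil, bil, Finset.sum_comm]
  simp only [← Finset.sum_neg_distrib]
  refine Finset.sum_congr rfl fun v _ => Finset.sum_congr rfl fun w _ => ?_
  rw [hc v w, smul_neg, mul_comm]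

theorem contDiff_cellPt {V : Type*} [Fintype V] [LinearOrder V] {m : ℕ} (p : Finset V × Finset V)
    {N : WithTop ℕ∞} : ContDiff ℝ N (cellPt p m) :=
  contDiff_const.add (dir p.2 m).toContinuousLinearMap.contDiff

namespace Nerve
variable {k M : ℕ} {N : Nerve k M}

/-- The homotopy from the difference of linear maps to the bilinear expression. -/
noncomputable def hom (N : Nerve k M) (L : Fin (M + 1) → Amb k) (τ : ℝ) (x y : Fin (M + 1) → ℝ) : Amb k :=
  (1 - τ) • comb L (x - y) + τ • bil N.c x y

theorem hom_swap (L : Fin (M + 1) → Amb k) (τ : ℝ) (x y : Fin (M + 1) → ℝ) :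
    N.hom L τ y x = - N.hom L τ x y := by
  rw [hom, hom, bil_swap N.antisymm, ← neg_sub x y, map_neg, smul_neg, smul_neg, neg_add]

theorem contDiff_hom (L : Fin (M + 1) → Amb k) {E : Type*} [NormedAddCommGroup E] [NormedSpace ℝ E]
    {n : WithTop ℕ∞} {τ : E → ℝ} {x y : E → Fin (M + 1) → ℝ} (hτ : ContDiff ℝ n τ) (hx : ContDiff ℝ n x)
    (hy : ContDiff ℝ n y) : ContDiff ℝ n fun z => N.hom L (τ z) (x z) (y z) := by
  have h1 : ContDiff ℝ n fun z => comb L (x z - y z) :=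
    (comb L).toContinuousLinearMap.contDiff.comp (hx.sub hy)
  have h2 : ContDiff ℝ n fun z => bil N.c (x z) (y z) := by
    unfold bil
    exact ContDiff.sum fun v _ => ContDiff.sum fun w _ =>
      ((contDiff_pi.1 hx v).mul (contDiff_pi.1 hy w)).smul contDiff_const
  exact ContDiff.add (ContDiff.fun_smul (contDiff_const.sub hτ) h1) (ContDiff.fun_smul hτ h2)

/-- A boundary point of a cell lies in a cell of smaller dimension. -/
theorem IsCell.exists_face {p : Finset (Fin (M + 1)) × Finset (Fin (M + 1))} (hp : N.IsCell p) {m : ℕ}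
    (hm : p.2.card ≤ m) {u : Eu m} (hu : ∃ j, u j = 0 ∨ u j = 1) :
    ∃ q, N.IsCell q ∧ q.2.card < m ∧ q.1 ∪ q.2 ⊆ p.1 ∪ p.2 ∧ ∀ v ∉ q.2, cellPt p m u v = vind q.1 v := by
  obtain ⟨A, R⟩ := p
  obtain ⟨hne, hd, hs⟩ := hp
  simp only at hm hne hd hs
  rcases hm.lt_or_eq with hlt | hm
  · exact ⟨_, ⟨hne, hd, hs⟩, hlt, subset_rfl, fun v hv => cellPt_of_notMem hv u⟩
  obtain ⟨j, hj⟩ := hu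
  have hr := R.orderEmbOfFin_mem hm j
  have hj' : cellPt (A, R) m u (R.orderEmbOfFin hm j) = u j := by
    rw [cellPt, Pi.add_apply, dir_of_eq (cellVertex_of_card hm j), vind,
      if_neg (Finset.disjoint_right.1 hd hr), zero_add]
  set r := R.orderEmbOfFin hm j
  have hcard : (R.erase r).card < m := by
    rw [← hm]
    exact Finset.card_erase_lt_of_mem hr
  rcases hj with hj | hj
  · have hsub : A ∪ R.erase r ⊆ A ∪ R := Finset.union_subset_union_right (Finset.erase_subset _ _)
    refine ⟨(A, R.erase r), ⟨hne, hd.mono_right (Finset.erase_subset _ _), N.mono _ _ hsub hs⟩, hcard,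
      hsub, fun v hv => ?_⟩
    by_cases hvr : v = r
    · rw [hvr, hj', hj, vind, if_neg (Finset.disjoint_right.1 hd hr)]
    · exact cellPt_of_notMem (fun h => hv (Finset.mem_erase.2 ⟨hvr, h⟩)) u
  · have hsub : insert r A ∪ R.erase r ⊆ A ∪ R := Finset.union_subset
      (Finset.insert_subset (Finset.mem_union_right _ hr) Finset.subset_union_left)
      ((Finset.erase_subset _ _).trans Finset.subset_union_right)
    refine ⟨(insert r A, R.erase r), ⟨Finset.insert_nonempty _ _, ?_, N.mono _ _ hsub hs⟩, hcard, hsub,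
      fun v hv => ?_⟩
    · rw [Finset.disjoint_insert_left]
      exact ⟨Finset.notMem_erase _ _, hd.mono_right (Finset.erase_subset _ _)⟩
    by_cases hvr : v = r
    · rw [hvr, hj', hj, vind, if_pos (Finset.mem_insert_self _ _)]
    · rw [cellPt_of_notMem (fun h => hv (Finset.mem_erase.2 ⟨hvr, h⟩))]
      simp [vind, hvr]

theorem Far.mono {p q p' q' : Finset (Fin (M + 1)) × Finset (Fin (M + 1))} (h : N.Far p q)
    (hp : p'.1 ∪ p'.2 ⊆ p.1 ∪ p.2) (hq : q'.1 ∪ q'.2 ⊆ q.1 ∪ q.2) : N.Far p' q' :=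
  fun v hv w hw => h v (hp hv) w (hq hw)

theorem IsCell.bil_ne_zero {p q : Finset (Fin (M + 1)) × Finset (Fin (M + 1))} (hp : N.IsCell p)
    (hq : N.IsCell q) (h : N.Far p q) {m l : ℕ} {u : Eu m} {w : Eu l} (hu : u ∈ Set.Icc (0 : Eu m) 1)
    (hw : w ∈ Set.Icc (0 : Eu l) 1) : bil N.c (cellPt p m u) (cellPt q l w) ≠ 0 := by
  obtain ⟨v, hv⟩ := hp.nonempty
  obtain ⟨v', hv'⟩ := hq.nonempty
  exact N.bil_ne_zero _ _ hp.simplex hq.simplex h _ _ (cellPt_nonneg p hu) (cellPt_nonneg q hw)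
    ⟨v, by rw [cellPt_of_mem hp.disj hv]; exact one_ne_zero⟩
    ⟨v', by rw [cellPt_of_mem hq.disj hv']; exact one_ne_zero⟩
    (fun v hv => cellPt_eq_zero hv u) (fun v hv => cellPt_eq_zero hv w)

theorem General.hom_ne_zero {L : Fin (M + 1) → Amb k} (hL : N.General L)
    {p q : Finset (Fin (M + 1)) × Finset (Fin (M + 1))} (hp : N.IsCell p)
    (hq : N.IsCell q) (h : N.Far p q) {m l : ℕ} (hm : p.2.card ≤ m) (hl : q.2.card ≤ l)
    {u : Eu m} {w : Eu l} (hu : u ∈ Set.Icc (0 : Eu m) 1) (hw : w ∈ Set.Icc (0 : Eu l) 1)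
    {τ : ℝ} (H : τ = 1 ∨ (τ = 0 ∧ m + l ≤ 2 * k + 1) ∨
      (m + l ≤ 2 * k + 1 ∧ ((∃ j, u j = 0 ∨ u j = 1) ∨ ∃ j, w j = 0 ∨ w j = 1))) :
    N.hom L τ (cellPt p m u) (cellPt q l w) ≠ 0 := by
  by_cases h1 : τ = 1
  · rw [hom, h1, sub_self, zero_smul, zero_add, one_smul]
    exact hp.bil_ne_zero hq h hu hw
  rcases H with H | ⟨h0, hk⟩ | ⟨hk, H⟩
  · exact absurd H h1
  · rw [hom, h0, sub_zero, zero_smul, add_zero, one_smul, map_sub, sub_ne_zero]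
    exact (hL.far_avoid hp h (fun v hv => cellPt_of_notMem hv u) fun v hv => cellPt_of_notMem hv w).1
      (by omega)
  · have key : ∀ r : ℝ, comb L (cellPt p m u - cellPt q l w) ≠ r • bil N.c (cellPt p m u) (cellPt q l w) := by
      rcases H with H | H
      · obtain ⟨p', hp', hc, hsub, hval⟩ := hp.exists_face hm H
        exact (hL.far_avoid hp' (h.mono hsub subset_rfl) hval fun v hv => cellPt_of_notMem hv w).2
          (by omega)
      · obtain ⟨q', hq', hc, hsub, hval⟩ := hq.exists_face hl H
        exact (hL.far_avoid hp (h.mono subset_rfl hsub) (fun v hv => cellPt_of_notMem hv u) hval).2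
          (by omega)
    intro h0
    have h1' : 1 - τ ≠ 0 := sub_ne_zero.2 (Ne.symm h1)
    refine key (-((1 - τ)⁻¹ * τ)) ?_
    rw [hom, add_eq_zero_iff_eq_neg] at h0
    rw [neg_smul, mul_smul, ← smul_neg, ← h0, inv_smul_smul₀ h1']

theorem General.exists_pair_degree {L : Fin (M + 1) → Amb k} (hL : N.General L) (c : N.Low) (t : N.Top) :
    ∃ d : ℤ, N.Far c.1 t.1 → HasDeg (fun z : Amb k =>
      N.hom L (z 0) (cellPt c.1 k (up z)) (cellPt t.1 (k + 1) (yp z))) d := by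
  by_cases h : N.Far c.1 t.1
  swap
  · exact ⟨0, fun h' => absurd h' h⟩
  have hsm : ContDiff ℝ 2 fun z : Amb k =>
      N.hom L (z 0) (cellPt c.1 k (up z)) (cellPt t.1 (k + 1) (yp z)) :=
    contDiff_hom L (contDiff_apply ℝ ℝ (0 : Fin (k + 1 + (k + 1)))) ((contDiff_cellPt _).comp contDiff_up)
      ((contDiff_cellPt _).comp contDiff_yp)
  have hd := exists_hasDeg hsm fun z hz hzi => ?_
  · exact hd.imp fun d hd _ => hd
  · refine hL.hom_ne_zero c.2.1 t.2.1 h c.2.2 t.2.2.le ⟨fun i => hz.1 _, fun i => hz.2 _⟩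
      ⟨fun i => hz.1 _, fun i => hz.2 _⟩ ?_
    obtain ⟨i, hi⟩ := hzi
    induction i using Fin.addCases with
    | left i =>
      induction i using Fin.cases with
      | zero =>
        rcases hi with hi | hi
        · exact Or.inr (Or.inl ⟨hi, by omega⟩)
        · exact Or.inl hi
      | succ i => exact Or.inr (Or.inr ⟨by omega, Or.inl ⟨i, hi⟩⟩)
    | right i => exact Or.inr (Or.inr ⟨by omega, Or.inr ⟨i, hi⟩⟩)

theorem General.exists_cochain {L : Fin (M + 1) → Amb k} (hL : N.General L) :
    ∃ e : N.Low → N.Top → ℤ, ∀ s t : N.Top, N.Far s.1 t.1 →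
      HasDeg (fun z => hL.complex.top s (xp z) - hL.complex.top t (yp z)) (hL.complex.bd e s t) := by
  choose e he using hL.exists_pair_degree
  refine ⟨-e, fun s t h => ?_⟩
  have hadm := hL.complex.admissible_top
  have hsm := hadm.contDiff_sub s t
  obtain ⟨o, ho⟩ := exists_hasDeg hsm fun z hz hzi => hadm.ne_zero_of_face h hz hzi
  let H : ℝ × Eu (k + 1) × Eu (k + 1) → Amb k := fun q =>
    N.hom L q.1 (cellPt s.1 (k + 1) q.2.1) (cellPt t.1 (k + 1) q.2.2)
  have hH : ContDiff ℝ 2 H := contDiff_hom L contDiff_fst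
    ((contDiff_cellPt _).comp (contDiff_fst.comp contDiff_snd))
    ((contDiff_cellPt _).comp (contDiff_snd.comp contDiff_snd))
  have h₀ : HasDeg (fun z => H (0, xp z, yp z)) o := by
    convert ho using 2 with z
    simp only [H, hom, sub_zero, one_smul, zero_smul, add_zero, map_sub, complex_top]
  have hc1 : Continuous fun z : Amb k => H (1, xp z, yp z) :=
    hH.continuous.comp (continuous_const.prodMk
      ((contDiff_xp (N := 0)).continuous.prodMk (contDiff_yp (N := 0)).continuous))
  have h₁ : HasDeg (fun z => H (1, xp z, yp z)) 0 := hasDeg_zero_of_ne_zero hc1 fun z hz =>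
    hL.hom_ne_zero s.2.1 t.2.1 h s.2.2.le t.2.2.le ⟨fun i => hz.1 _, fun i => hz.2 _⟩
      ⟨fun i => hz.1 _, fun i => hz.2 _⟩ (Or.inl rfl)
  have hsum := bsign_spec hH h₀ h₁ (p := fun j b => e (facet s j b) t) (q := fun j b => e (facet t j b) s)
    (fun j b => by
      convert he (facet s j b) t (h.mono (facet_subset s j b) subset_rfl) using 2 with z
      show N.hom L _ _ _ = _
      rw [← cellPt_facet])
    (fun j b => by
      convert he (facet t j b) s (h.symm.mono (facet_subset t j b) subset_rfl) using 2 with z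
      show - N.hom L _ _ _ = _
      rw [← cellPt_facet, hom_swap, neg_neg])
  have hbd : hL.complex.bd e s t = 0 - o := hsum.symm
  have hz : hL.complex.bd (-e + e) s t = 0 := by
    rw [neg_add_cancel]
    simp [Complex.bd]
  rw [Complex.bd_add, hbd] at hz
  rw [show hL.complex.bd (-e) s t = o by omega]
  exact ho

theorem exists_maps (hk : 1 < k) (N : Nerve k M) :
    ∃ (L : Fin (M + 1) → Amb k) (g : N.Top → Eu (k + 1) → Amb k), N.General L ∧ (∀ t, Continuous (g t)) ∧
      (∀ t, ∀ y ∈ Set.Icc (0 : Eu (k + 1)) 1, (∃ i, y i = 0 ∨ y i = 1) →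
        g t y = comb L (cellPt t.1 (k + 1) y)) ∧
      (∀ s t, N.Far s.1 t.1 → ∀ x ∈ Set.Icc (0 : Eu (k + 1)) 1, ∀ y ∈ Set.Icc (0 : Eu (k + 1)) 1,
        g s x ≠ g t y) ∧
      ∀ (t : N.Top) (c : N.Low), N.Far t.1 c.1 → ∀ y ∈ Set.Icc (0 : Eu (k + 1)) 1,
        ∀ u ∈ Set.Icc (0 : Eu k) 1, g t y ≠ comb L (cellPt c.1 k u) := by
  obtain ⟨L, hL⟩ := exists_vertices N.c
  have hL : N.General L := hL
  obtain ⟨e, he⟩ := hL.exists_cochain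
  obtain ⟨g, hg, hb, hd, hl⟩ := hL.complex.exists_disjoint hk he
  refine ⟨L, g, hL, hg, fun t y hy h => ?_, hd, fun t c h y hy u hu => ?_⟩
  · rw [← hL.complex_top]
    exact hb t y hy h
  · rw [← hL.complex_low]
    exact hl t c h y hy u hu

end Nerve

namespace Nerve
variable {k M : ℕ} {N : Nerve k M}

/-- The closed cell with given vertices. -/
def cell (p : Finset (Fin (M + 1)) × Finset (Fin (M + 1))) : Set (Fin (M + 1) → ℝ) :=
  {q | q ∈ Set.Icc (0 : Fin (M + 1) → ℝ) 1 ∧ (∀ v ∈ p.1, q v = 1) ∧ ∀ v, v ∉ p.1 → v ∉ p.2 → q v = 0}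

theorem isClosed_cell (p : Finset (Fin (M + 1)) × Finset (Fin (M + 1))) : IsClosed (cell p) := by
  have h : cell p = Set.Icc 0 1 ∩ ((⋂ v ∈ p.1, {q : Fin (M + 1) → ℝ | q v = 1}) ∩
      ⋂ v, ⋂ (_ : v ∉ p.1), ⋂ (_ : v ∉ p.2), {q : Fin (M + 1) → ℝ | q v = 0}) := by
    ext q
    simp [cell]
  rw [h]
  refine isClosed_Icc.inter (IsClosed.inter ?_ ?_)
  · exact isClosed_biInter fun v _ => isClosed_eq (continuous_apply v) continuous_const
  · exact isClosed_iInter fun v => isClosed_iInter fun _ => isClosed_iInter fun _ =>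
      isClosed_eq (continuous_apply v) continuous_const

variable (N) in
/-- The points of the polyhedron of a nerve, normalised to have maximum one. -/
def poly : Set (Fin (M + 1) → ℝ) :=
  {q | q ∈ Set.Icc (0 : Fin (M + 1) → ℝ) 1 ∧ (∃ v, q v = 1) ∧ N.S (Finset.univ.filter fun v => q v ≠ 0)}

/-- The cell with a given point in its interior. -/
noncomputable def carrier (q : Fin (M + 1) → ℝ) : Finset (Fin (M + 1)) × Finset (Fin (M + 1)) :=
  (Finset.univ.filter fun v => q v = 1, Finset.univ.filter fun v => q v ≠ 0 ∧ q v ≠ 1)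

theorem mem_carrier_union {q : Fin (M + 1) → ℝ} {v : Fin (M + 1)} :
    v ∈ (carrier q).1 ∪ (carrier q).2 ↔ q v ≠ 0 := by
  simp only [carrier, Finset.mem_union, Finset.mem_filter, Finset.mem_univ, true_and]
  constructor
  · rintro (h | h)
    · rw [h]
      exact one_ne_zero
    · exact h.1
  · exact fun h => (em (q v = 1)).imp_right fun h' => ⟨h, h'⟩

theorem isCell_carrier {q : Fin (M + 1) → ℝ} (hq : q ∈ N.poly) : N.IsCell (carrier q) where
  nonempty := by
    obtain ⟨v, hv⟩ := hq.2.1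
    exact ⟨v, by simpa [carrier] using hv⟩
  disj := by
    rw [Finset.disjoint_left]
    intro v hv hv'
    simp only [carrier, Finset.mem_filter, Finset.mem_univ, true_and] at hv hv'
    exact hv'.2 hv
  simplex := by
    convert hq.2.2 using 1
    ext v
    rw [mem_carrier_union]
    simp

theorem mem_cell_carrier {q : Fin (M + 1) → ℝ} (hq : q ∈ Set.Icc (0 : Fin (M + 1) → ℝ) 1) :
    q ∈ cell (carrier q) := by
  refine ⟨hq, fun v hv => by simpa [carrier] using hv, fun v hv hv' => ?_⟩
  by_contra h
  have := mem_carrier_union.2 h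
  rw [Finset.mem_union] at this
  exact this.elim hv hv'

theorem exists_face_vertex {t p : Finset (Fin (M + 1)) × Finset (Fin (M + 1))} (ht : Disjoint t.1 t.2)
    (hp : Disjoint p.1 p.2) (h : p.2.card ≤ t.2.card) (hne : p ≠ t) {q : Fin (M + 1) → ℝ}
    (hqt : q ∈ cell t) (hqp : q ∈ cell p) : ∃ v ∈ t.2, q v = 0 ∨ q v = 1 := by
  by_contra! H
  have h1 : t.2 ⊆ p.2 := fun v hv => by
    by_contra hv'
    by_cases hv1 : v ∈ p.1
    · exact (H v hv).2 (hqp.2.1 v hv1)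
    · exact (H v hv).1 (hqp.2.2 v hv1 hv')
  have h2 : t.2 = p.2 := Finset.eq_of_subset_of_card_le h1 h
  refine hne (Prod.ext ?_ h2.symm)
  ext v
  constructor
  · intro hv
    have hv2 : v ∉ t.2 := h2 ▸ Finset.disjoint_left.1 hp hv
    by_contra hv1
    exact zero_ne_one ((hqt.2.2 v hv1 hv2).symm.trans (hqp.2.1 v hv))
  · intro hv
    have hv2 : v ∉ p.2 := h2 ▸ Finset.disjoint_left.1 ht hv
    by_contra hv1
    exact zero_ne_one ((hqp.2.2 v hv1 hv2).symm.trans (hqt.2.1 v hv))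

theorem cellCoord_mem_Icc (R : Finset (Fin (M + 1))) (m : ℕ) {q : Fin (M + 1) → ℝ}
    (hq : q ∈ Set.Icc (0 : Fin (M + 1) → ℝ) 1) : cellCoord R m q ∈ Set.Icc (0 : Eu m) 1 := by
  constructor
  · intro j
    rw [cellCoord]
    cases cellVertex R m j with
    | none => exact le_rfl
    | some v => exact hq.1 v
  · intro j
    rw [cellCoord]
    cases cellVertex R m j with
    | none => exact zero_le_one
    | some v => exact hq.2 v

theorem continuous_cellCoord (R : Finset (Fin (M + 1))) (m : ℕ) :
    Continuous (cellCoord R m : (Fin (M + 1) → ℝ) → Eu m) := by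
  refine continuous_pi fun j => ?_
  unfold cellCoord
  cases cellVertex R m j with
  | none => exact continuous_const
  | some v => exact continuous_apply v

theorem exists_map (hk : 1 < k) (N : Nerve k M) (hN : ∀ σ, N.S σ → σ.card ≤ k + 2) :
    ∃ F : (Fin (M + 1) → ℝ) → Amb k, ContinuousOn F N.poly ∧ ∀ q ∈ N.poly, ∀ q' ∈ N.poly,
      (∀ v w, q v ≠ 0 → q' w ≠ 0 → N.far v w) → F q ≠ F q' := by
  classical
  obtain ⟨L, g, hL, hg, hb, hd, hl⟩ := exists_maps hk N
  let F : (Fin (M + 1) → ℝ) → Amb k := fun q =>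
    if h : ∃ t : N.Top, q ∈ cell t.1 then g h.choose (cellCoord h.choose.1.2 (k + 1) q) else comb L q
  have hface : ∀ (t : N.Top) (q : Fin (M + 1) → ℝ), q ∈ cell t.1 → (∃ v ∈ t.1.2, q v = 0 ∨ q v = 1) →
      g t (cellCoord t.1.2 (k + 1) q) = comb L q := by
    rintro t q hq ⟨v, hv, hqv⟩
    obtain ⟨j, hj⟩ := exists_cellVertex t.2.2.le hv
    rw [hb t _ (cellCoord_mem_Icc _ _ hq.1) ⟨j, by simpa only [cellCoord, hj, Option.elim_some] using hqv⟩,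
      cellPt_cellCoord t.2.1.disj t.2.2.le hq.2.1 hq.2.2]
  have htop : ∀ (t : N.Top) (q : Fin (M + 1) → ℝ), q ∈ cell t.1 →
      F q = g t (cellCoord t.1.2 (k + 1) q) := by
    intro t q hq
    have h : ∃ t : N.Top, q ∈ cell t.1 := ⟨t, hq⟩
    have hF : F q = g h.choose (cellCoord h.choose.1.2 (k + 1) q) := dif_pos h
    rw [hF]
    have hs := h.choose_spec
    generalize h.choose = s at hs
    by_cases hst : s = t
    · rw [hst]
    have hst' : s.1 ≠ t.1 := fun h => hst (Subtype.ext h)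
    have hc := s.2.2.trans t.2.2.symm
    rw [hface s q hs (exists_face_vertex s.2.1.disj t.2.1.disj hc.ge hst'.symm hs hq),
      hface t q hq (exists_face_vertex t.2.1.disj s.2.1.disj hc.le hst' hq hs)]
  have hlow : ∀ (c : N.Low) (q : Fin (M + 1) → ℝ), q ∈ cell c.1 → F q = comb L q := by
    intro c q hq
    by_cases h : ∃ t : N.Top, q ∈ cell t.1
    · obtain ⟨t, ht⟩ := h
      have hlt : c.1.2.card < t.1.2.card := by
        rw [t.2.2]
        exact Nat.lt_succ_of_le c.2.2
      rw [htop t q ht, hface t q ht (exists_face_vertex t.2.1.disj c.2.1.disj hlt.le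
        (fun h => hlt.ne (by rw [h])) ht hq)]
    · exact dif_neg h
  have hcard : ∀ p, N.IsCell p → p.2.card ≤ k ∨ p.2.card = k + 1 := by
    intro p hp
    have h1 := hN _ hp.simplex
    rw [Finset.card_union_of_disjoint hp.disj] at h1
    have h2 := hp.nonempty.card_pos
    omega
  refine ⟨F, ?_, ?_⟩
  · have h1 : ContinuousOn F (⋃ p : {p // N.IsCell p}, cell p.1) := by
      refine (locallyFinite_of_finite _).continuousOn_iUnion (fun p => isClosed_cell p.1) fun p => ?_
      rcases hcard _ p.2 with hp | hp
      · exact (comb L).toContinuousLinearMap.continuous.continuousOn.congr fun q hq =>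
          hlow ⟨p.1, p.2, hp⟩ q hq
      · exact ((hg ⟨p.1, p.2, hp⟩).comp (continuous_cellCoord _ _)).continuousOn.congr fun q hq =>
          htop ⟨p.1, p.2, hp⟩ q hq
    refine h1.mono fun q hq => ?_
    exact Set.mem_iUnion.2 ⟨⟨carrier q, isCell_carrier hq⟩, mem_cell_carrier hq.1⟩
  · intro q hq q' hq' hfar
    have hp := isCell_carrier hq
    have hp' := isCell_carrier hq'
    have hc := mem_cell_carrier hq.1
    have hc' := mem_cell_carrier hq'.1
    have hF : N.Far (carrier q) (carrier q') := fun v hv w hw =>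
      hfar v w (mem_carrier_union.1 hv) (mem_carrier_union.1 hw)
    have hval : ∀ {q : Fin (M + 1) → ℝ}, q ∈ cell (carrier q) → N.IsCell (carrier q) →
        (carrier q).2.card ≤ k → comb L q = comb L (cellPt (carrier q) k (cellCoord (carrier q).2 k q)) :=
      fun hc hp h => by rw [cellPt_cellCoord hp.disj h hc.2.1 hc.2.2]
    rcases hcard _ hp with h | h <;> rcases hcard _ hp' with h' | h'
    · rw [hlow ⟨_, hp, h⟩ q hc, hlow ⟨_, hp', h'⟩ q' hc', hval hc hp h, hval hc' hp' h']
      exact (hL.far_avoid hp hF (fun v hv => cellPt_of_notMem hv _) fun v hv => cellPt_of_notMem hv _).1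
        (by omega)
    · rw [hlow ⟨_, hp, h⟩ q hc, htop ⟨_, hp', h'⟩ q' hc', hval hc hp h]
      exact (hl ⟨_, hp', h'⟩ ⟨_, hp, h⟩ hF.symm _ (cellCoord_mem_Icc _ _ hq'.1) _
        (cellCoord_mem_Icc _ _ hq.1)).symm
    · rw [htop ⟨_, hp, h⟩ q hc, hlow ⟨_, hp', h'⟩ q' hc', hval hc' hp' h']
      exact hl ⟨_, hp, h⟩ ⟨_, hp', h'⟩ hF _ (cellCoord_mem_Icc _ _ hq.1) _ (cellCoord_mem_Icc _ _ hq'.1)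
    · rw [htop ⟨_, hp, h⟩ q hc, htop ⟨_, hp', h'⟩ q' hc']
      exact hd ⟨_, hp, h⟩ ⟨_, hp', h'⟩ hF _ (cellCoord_mem_Icc _ _ hq.1) _ (cellCoord_mem_Icc _ _ hq'.1)

end Nerve

section covers
variable {X : Type*} [MetricSpace X] [CompactSpace X]

/-- Finite covers by small open sets of order at most `n + 1`. -/
theorem exists_finite_cover [Nonempty X] {n : ℕ} (h : CoveringDimLE X n) {r : ℝ} (hr : 0 < r) :
    ∃ (M : ℕ) (U : Fin (M + 1) → Set X) (a : Fin (M + 1) → X), (∀ v, IsOpen (U v)) ∧ ⋃ v, U v = Set.univ ∧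
      (∀ v, U v ⊆ ball (a v) r) ∧
      ∀ (σ : Finset (Fin (M + 1))) (x : X), (∀ v ∈ σ, x ∈ U v) → σ.card ≤ n + 1 := by
  classical
  obtain ⟨V, hVo, hVc, hVr, hV⟩ := h (Set.range fun x : X => ball x r)
    (by rintro _ ⟨x, rfl⟩; exact isOpen_ball)
    (Set.eq_univ_of_forall fun x => ⟨ball x r, ⟨x, rfl⟩, mem_ball_self hr⟩)
  obtain ⟨T, hTV, hT⟩ := isCompact_univ.elim_finite_subcover_image (b := V) (c := id) hVo
    (by rw [← hVc, Set.sUnion_eq_biUnion]; exact subset_rfl)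
  obtain ⟨hTf, hT⟩ := hT
  lift T to Finset (Set X) using hTf
  have hTne : T.Nonempty := by
    obtain ⟨x⟩ := ‹Nonempty X›
    obtain ⟨u, hu, _⟩ := Set.mem_iUnion₂.1 (hT (Set.mem_univ x))
    exact ⟨u, hu⟩
  obtain ⟨M, hM⟩ := Nat.exists_eq_succ_of_ne_zero hTne.card_pos.ne'
  let e := (T.equivFinOfCardEq hM).symm
  have hball : ∀ v, ∃ a, (e v : Set X) ⊆ ball a r := fun v => by
    obtain ⟨_, ⟨a, rfl⟩, ha⟩ := hVr _ (hTV (e v).2)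
    exact ⟨a, ha⟩
  choose a ha using hball
  refine ⟨M, fun v => e v, a, fun v => hVo _ (hTV (e v).2), Set.eq_univ_of_forall fun x => ?_, ha,
    fun σ x hx => ?_⟩
  · obtain ⟨u, hu, hxu⟩ := Set.mem_iUnion₂.1 (hT (Set.mem_univ x))
    refine Set.mem_iUnion.2 ⟨e.symm ⟨u, hu⟩, ?_⟩
    rw [e.apply_symm_apply]
    exact hxu
  · obtain ⟨hf, hc⟩ := hV x
    refine le_trans ?_ hc
    have hinj : Function.Injective fun v => (e v : Set X) := Subtype.val_injective.comp e.injective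
    rw [← Finset.card_image_of_injective σ hinj, ← Set.ncard_coe_finset]
    refine Set.ncard_le_ncard (fun u hu => ?_) hf
    rw [Finset.mem_coe, Finset.mem_image] at hu
    obtain ⟨v, hv, rfl⟩ := hu
    exact ⟨hTV (e v).2, hx v hv⟩

/-- Odd maps extend to odd maps of the square. -/
theorem exists_odd_extension {n : ℕ} {K : Set (X × X)} (hK : IsClosed K) (hswap : ∀ p ∈ K, (p.2, p.1) ∈ K)
    {f : K → EuclideanSpace ℝ (Fin n)} (hf : Continuous f)
    (hodd : ∀ (p : X × X) (hp : p ∈ K), f ⟨(p.2, p.1), hswap p hp⟩ = - f ⟨p, hp⟩) :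
    ∃ ψ : X × X → EuclideanSpace ℝ (Fin n), Continuous ψ ∧ (∀ p, ψ (p.2, p.1) = - ψ p) ∧
      ∀ p : K, ψ p = f p := by
  obtain ⟨φ, hφ⟩ := ContinuousMap.exists_extension hK.isClosedEmbedding_subtypeVal ⟨f, hf⟩
  have hφ : ∀ p : K, φ p = f p := fun p => congrArg (fun g => g p) hφ
  refine ⟨fun p => (1 / 2 : ℝ) • (φ p - φ (p.2, p.1)), by fun_prop, fun p => ?_, fun p => ?_⟩
  · rw [← smul_neg, neg_sub]
  · have h2 := hφ ⟨_, hswap _ p.2⟩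
    rw [hodd _ p.2] at h2
    show (1 / 2 : ℝ) • (φ p - φ (p.1.2, p.1.1)) = f p
    rw [hφ p, h2, sub_neg_eq_add, ← two_smul ℝ, smul_smul]
    norm_num

/-- A positive combination of vectors near a fixed unit vector is nonzero. -/
theorem bil_ne_zero_of_near {V E : Type*} [Fintype V] [NormedAddCommGroup E] [InnerProductSpace ℝ E]
    {c : V → V → E} {z : E} (hz : ‖z‖ = 1) {σ τ : Finset V}
    (hc : ∀ v ∈ σ, ∀ w ∈ τ, ‖c v w - z‖ < 1 / 2) {x y : V → ℝ} (hx : ∀ v, 0 ≤ x v) (hy : ∀ v, 0 ≤ y v)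
    (hx' : ∃ v, x v ≠ 0) (hy' : ∃ v, y v ≠ 0) (hσ : ∀ v ∉ σ, x v = 0) (hτ : ∀ v ∉ τ, y v = 0) :
    bil c x y ≠ 0 := by
  have hin : ∀ v ∈ σ, ∀ w ∈ τ, 0 < inner ℝ z (c v w) := by
    intro v hv w hw
    have h1 : inner ℝ z (c v w) = 1 + inner ℝ z (c v w - z) := by
      rw [inner_sub_right, real_inner_self_eq_norm_sq, hz]
      ring
    have h2 := neg_le_of_abs_le (abs_real_inner_le_norm z (c v w - z))
    rw [hz, one_mul] at h2
    linarith [hc v hv w hw]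
  have hmem : ∀ v, x v ≠ 0 → v ∈ σ := fun v hv => by_contra fun h => hv (hσ v h)
  have hmem' : ∀ v, y v ≠ 0 → v ∈ τ := fun v hv => by_contra fun h => hv (hτ v h)
  have hnn : ∀ v w, 0 ≤ x v * y w * inner ℝ z (c v w) := by
    intro v w
    by_cases h1 : x v = 0
    · simp [h1]
    by_cases h2 : y w = 0
    · simp [h2]
    exact mul_nonneg (mul_nonneg (hx v) (hy w)) (hin v (hmem v h1) w (hmem' w h2)).le
  intro h0
  have h1 : inner ℝ z (bil c x y) = ∑ v, ∑ w, x v * y w * inner ℝ z (c v w) := by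
    simp only [bil, inner_sum, inner_smul_right]
  rw [h0, inner_zero_right] at h1
  obtain ⟨v, hv⟩ := hx'
  obtain ⟨w, hw⟩ := hy'
  have h2 := (Finset.sum_eq_zero_iff_of_nonneg fun v _ => Finset.sum_nonneg fun w _ => hnn v w).1 h1.symm v
    (Finset.mem_univ v)
  have h3 := (Finset.sum_eq_zero_iff_of_nonneg fun w _ => hnn v w).1 h2 w (Finset.mem_univ w)
  exact (mul_ne_zero (mul_ne_zero hv hw) (hin v (hmem v hv) w (hmem' w hw)).ne') h3

theorem map_bil {V E F : Type*} [Fintype V] [AddCommGroup E] [Module ℝ E] [AddCommGroup F] [Module ℝ F]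
    (Φ : E →ₗ[ℝ] F) (c : V → V → E) (x y : V → ℝ) : bil (fun v w => Φ (c v w)) x y = Φ (bil c x y) := by
  simp only [bil, map_sum, map_smul]

theorem exists_small_fibres {k : ℕ} (hk : 1 < k) (hdim : CoveringDimLE X (k + 1)) {ε : ℝ} (hε : 0 < ε)
    {ψ : X × X → EuclideanSpace ℝ (Fin (2 * (k + 1)))} (hψ : Continuous ψ)
    (hodd : ∀ p, ψ (p.2, p.1) = - ψ p) (hnorm : ∀ p : X × X, ε ≤ dist p.1 p.2 → ‖ψ p‖ = 1) :
    ∃ f : X → EuclideanSpace ℝ (Fin (2 * (k + 1))), Continuous f ∧ ∀ x y, f x = f y → dist x y < 2 * ε := by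
  classical
  rcases isEmpty_or_nonempty X with hX | hX
  · exact ⟨fun _ => 0, continuous_const, fun x => hX.elim x⟩
  obtain ⟨δ, hδ, hclose⟩ := Metric.uniformContinuous_iff.1
    (CompactSpace.uniformContinuous_of_continuous hψ) (1 / 2) (by norm_num)
  have hr : 0 < min δ ε / 2 := half_pos (lt_min hδ hε)
  obtain ⟨M, U, a, hUo, hUc, hUa, hUn⟩ := exists_finite_cover hdim hr
  have hdist : ∀ v x, x ∈ U v → dist x (a v) < min δ ε / 2 := fun v x hx => hUa v hx
  let Φ : EuclideanSpace ℝ (Fin (2 * (k + 1))) ≃L[ℝ] Amb k := ContinuousLinearEquiv.ofFinrankEq (by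
    simp only [finrank_euclideanSpace, Module.finrank_fintype_fun_eq_card, Fintype.card_fin]
    omega)
  have hirr : ∀ x : X, ¬ ε ≤ dist x x := fun x => by
    rw [dist_self]
    exact hε.not_ge
  let N : Nerve k M := {
    S := fun σ => ∃ x, ∀ v ∈ σ, x ∈ U v
    mono := fun σ τ h ⟨x, hx⟩ => ⟨x, fun v hv => hx v (h hv)⟩
    far := fun v w => ε ≤ dist (a v) (a w)
    symm := fun v w h => by rwa [dist_comm]
    irrefl := fun v => hirr _
    c := fun v w => Φ (ψ (a v, a w))
    antisymm := fun v w => by rw [hodd (a v, a w), map_neg]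
    bil_ne_zero := by
      rintro σ τ ⟨p, hp⟩ ⟨q, hq⟩ hfar x y hx hy ⟨v, hv⟩ ⟨w, hw⟩ hσ hτ
      have hvσ : v ∈ σ := by_contra fun h => hv (hσ v h)
      have hwτ : w ∈ τ := by_contra fun h => hw (hτ w h)
      have hb := bil_ne_zero_of_near (c := fun v w => ψ (a v, a w)) (z := ψ (a v, a w))
        (hnorm _ (hfar v hvσ w hwτ)) (σ := σ) (τ := τ) (fun v' hv' w' hw' => ?_) hx hy ⟨v, hv⟩ ⟨w, hw⟩ hσ hτ
      · intro h0
        have h1 := map_bil (Φ : _ →ₗ[ℝ] Amb k) (fun v w => ψ (a v, a w)) x y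
        exact hb (Φ.map_eq_zero_iff.1 (h1.symm.trans h0))
      · have h1 : ∀ {v v' : Fin (M + 1)} {p : X}, p ∈ U v → p ∈ U v' → dist (a v') (a v) < δ := by
          intro v v' p hv hv'
          have := dist_triangle_left (a v') (a v) p
          linarith [hdist v p hv, hdist v' p hv', min_le_left δ ε]
        rw [← dist_eq_norm]
        refine hclose ?_
        rw [Prod.dist_eq]
        exact max_lt (h1 (hp v hvσ) (hp v' hv')) (h1 (hq w hwτ) (hq w' hw')) }
  obtain ⟨F, hF, hsep⟩ := N.exists_map hk fun σ ⟨x, hx⟩ => hUn σ x hx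
  obtain ⟨f, hf⟩ := BumpCovering.exists_isSubordinate (s := (Set.univ : Set X)) isClosed_univ U hUo hUc.ge
  let p : X → Fin (M + 1) → ℝ := fun x v => f v x
  have hpU : ∀ x v, p x v ≠ 0 → x ∈ U v := fun x v h => hf v (subset_tsupport _ h)
  have hp : ∀ x, p x ∈ N.poly := by
    intro x
    refine ⟨⟨fun v => f.nonneg v x, fun v => f.le_one v x⟩, ?_, x, fun v hv => hpU x v ?_⟩
    · obtain ⟨v, hv⟩ := f.eventuallyEq_one' x (Set.mem_univ x)
      exact ⟨v, hv.self_of_nhds⟩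
    · simpa using hv
  have hpc : Continuous p := continuous_pi fun v => (f v).continuous
  refine ⟨fun x => Φ.symm (F (p x)), Φ.symm.continuous.comp (hF.comp_continuous hpc hp), fun x y hxy => ?_⟩
  have hxy := Φ.symm.injective hxy
  by_contra hd
  refine hsep (p x) (hp x) (p y) (hp y) (fun v w hv hw => ?_) hxy
  show ε ≤ dist (a v) (a w)
  have h1 := hdist v x (hpU x v hv)
  have h2 := hdist w y (hpU y w hw)
  have h3 := dist_triangle4_right x y (a v) (a w)
  linarith [min_le_right δ ε, not_lt.1 hd]

end covers

end QE

/-- Theorem 2.4: for `n > 2`, an `n`-dimensional compactum quasi-embeds in `ℝ^{2n}` iff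
every compact swap-invariant subset of the deleted product admits an equivariant map to
`S^{2n-1}`. -/
theorem stmt3 (n : ℕ) (hn : n > 2)
    (X : Type) [MetricSpace X] [CompactSpace X] (hdim : CoveringDimLE X n) :
    (∀ ε : ℝ, 0 < ε → ∃ f : X → EuclideanSpace ℝ (Fin (2 * n)),
      Continuous f ∧ ∀ z, Metric.diam (f ⁻¹' {z}) < ε) ↔
    (∀ K : Set (X × X), IsCompact K → (∀ p ∈ K, p.1 ≠ p.2) →
      ∀ hswap : (∀ p ∈ K, (p.2, p.1) ∈ K),
      ∃ f : K → EuclideanSpace ℝ (Fin (2 * n)),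
        Continuous f ∧ (∀ p, ‖f p‖ = 1) ∧
        ∀ (p : X × X) (hp : p ∈ K), f ⟨(p.2, p.1), hswap p hp⟩ = - f ⟨p, hp⟩) := by
  constructor
  · intro h K hK hne hswap
    obtain ⟨δ, hδ, hd⟩ := hK.exists_forall_le' (continuous_dist.continuousOn) (a := 0)
      fun p hp => dist_pos.2 (hne p hp)
    obtain ⟨f, hf, hfib⟩ := h δ hδ
    have hsep : ∀ p : K, f p.1.1 - f p.1.2 ≠ 0 := by
      intro p hp
      have h1 := dist_le_diam_of_mem (s := f ⁻¹' {f p.1.2}) (x := p.1.1) (y := p.1.2)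
        (Bornology.IsBounded.all _) (sub_eq_zero.1 hp) rfl
      exact (hfib (f p.1.2)).not_ge ((hd p p.2).trans h1)
    refine ⟨fun p => ‖f p.1.1 - f p.1.2‖⁻¹ • (f p.1.1 - f p.1.2), ?_, fun p => ?_, fun p hp => ?_⟩
    · have hc : Continuous fun p : K => f p.1.1 - f p.1.2 := by fun_prop
      exact (hc.norm.inv₀ fun p => norm_ne_zero_iff.2 (hsep p)).smul hc
    · rw [norm_smul, norm_inv, norm_norm, inv_mul_cancel₀ (norm_ne_zero_iff.2 (hsep p))]
    · show ‖f p.2 - f p.1‖⁻¹ • (f p.2 - f p.1) = -(‖f p.1 - f p.2‖⁻¹ • (f p.1 - f p.2))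
      rw [← smul_neg, neg_sub, norm_sub_rev]
  · intro h ε hε
    obtain ⟨k, rfl⟩ : ∃ k, n = k + 1 := ⟨n - 1, by omega⟩
    have hε4 : 0 < ε / 4 := by linarith
    have hK : IsClosed {p : X × X | ε / 4 ≤ dist p.1 p.2} := isClosed_le continuous_const continuous_dist
    have hswap : ∀ p ∈ {p : X × X | ε / 4 ≤ dist p.1 p.2}, (p.2, p.1) ∈ {p : X × X | ε / 4 ≤ dist p.1 p.2} := by
      intro p hp
      simpa [dist_comm] using hp
    obtain ⟨f, hf, hnorm, hodd⟩ := h _ hK.isCompact (fun p hp he => by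
      have hp : ε / 4 ≤ dist p.1 p.2 := by simpa using hp
      rw [he, dist_self] at hp
      linarith) hswap
    obtain ⟨ψ, hψ, hψodd, hψf⟩ := QE.exists_odd_extension hK hswap hf hodd
    obtain ⟨g, hg, hfib⟩ := QE.exists_small_fibres (by omega) hdim hε4 hψ hψodd fun p hp => by
      rw [hψf ⟨p, by simpa using hp⟩, hnorm]
    refine ⟨g, hg, fun z => ?_⟩
    refine (diam_le_of_forall_dist_le (C := ε / 2) (by linarith) fun x hx y hy => ?_).trans_lt (by linarith)
    have := hfib x y ((show g x = z from hx).trans (show g y = z from hy).symm)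
    linarith
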